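/- arXiv:math/0610371 — 4 statements merged into one kernel-verified Lean document; each statement's English description precedes it below -/
import Mathlib

section
/- Stationary phase for holomorphic families: Let U ⊆ ℝ^n be open and f : ℝ^n → ℝ smooth on U. Let u : ℂ × ℝ^n → ℂ be such that for each z ∈ ℂ the function u(z,·) is smooth with support contained in a fixed compact set K ⊆ U, for each x the function z ↦ u(z,x) is holomorphic on ℂ, and all x-derivatives ∂_x^α u(z,x) are jointly continuous and holomorphic in z. Suppose x₀ ∈ U is the unique critical point of f in K and the Hessian of f at x₀ is nondegenerate. Then there exist entire functions M_j : ℂ → ℂ (j ∈ ℕ) such that for every compact set L ⊆ ℂ and every k ∈ ℕ there exist C > 0 and R ≥ 1 with: for all z ∈ L and all real r ≥ R, ‖∫_{ℝ^n} e^{i r f(x)} u(z,x) dx − Σ_{j<k} e^{i r f(x₀)} M_j(z) r^{-n/2 - j}‖ ≤ C · r^{-k}. -/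
open MeasureTheory Complex

namespace SPH
open scoped ContDiff Topology

section CurrySmooth
variable {L E G : Type} [TopologicalSpace L] [CompactSpace L]
  [NormedAddCommGroup E] [NormedSpace ℝ E] [NormedAddCommGroup G] [NormedSpace ℝ G]

/-- swapping evaluation order for continuous families of linear maps -/
noncomputable def swapL (L E G : Type) [TopologicalSpace L] [CompactSpace L]
    [NormedAddCommGroup E] [NormedSpace ℝ E] [NormedAddCommGroup G] [NormedSpace ℝ G] :
    C(L, E →L[ℝ] G) →L[ℝ] (E →L[ℝ] C(L, G)) :=
  LinearMap.mkContinuous₂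
    (LinearMap.mk₂ ℝ (fun (A : C(L, E →L[ℝ] G)) (v : E) =>
        (⟨fun z => A z v, by fun_prop⟩ : C(L, G)))
      (by intros; ext; simp) (by intros; ext; simp) (by intros; ext; simp)
      (by intros; ext; simp)) 1
    (by
      intro A v
      rw [one_mul, ContinuousMap.norm_le _ (by positivity)]
      intro z
      simp only [LinearMap.mk₂_apply, ContinuousMap.coe_mk]
      exact (ContinuousLinearMap.le_opNorm _ _).trans
        (mul_le_mul_of_nonneg_right (A.norm_coe_le_norm z) (norm_nonneg _)))

lemma swapL_apply (A : C(L, E →L[ℝ] G)) (v : E) (z : L) : swapL L E G A v z = A z v := rfl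

lemma curry_hasFDerivAt (w : L → E → G) (w' : L → E → E →L[ℝ] G)
    (hw' : Continuous (fun p : L × E => w' p.1 p.2))
    (hd : ∀ z x, HasFDerivAt (w z) (w' z x) x)
    (W : E → C(L, G)) (hW : ∀ x z, W x z = w z x)
    (W' : E → C(L, E →L[ℝ] G)) (hW' : ∀ x z, W' x z = w' z x) (x : E) :
    HasFDerivAt W (swapL L E G (W' x)) x := by
  have hcont : Continuous W' := by
    have : W' = (ContinuousMap.curry ⟨fun p : E × L => w' p.2 p.1, by fun_prop⟩) := by
      ext1 x; ext1 z; rw [hW']; rfl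
    rw [this]; exact ContinuousMap.continuous _
  rw [hasFDerivAt_iff_isLittleO, Asymptotics.isLittleO_iff]
  intro c hc
  obtain ⟨δ, hδ, hball⟩ := (Metric.continuousAt_iff (f := W') (a := x)).1 hcont.continuousAt c hc
  filter_upwards [Metric.ball_mem_nhds x hδ] with y hy
  rw [ContinuousMap.norm_le _ (by positivity)]
  intro z
  have := Convex.norm_image_sub_le_of_norm_hasFDerivWithin_le' (𝕜 := ℝ) (f := w z) (f' := w' z)
    (φ := w' z x) (C := c) (s := Metric.ball x δ) (x := x) (y := y)
    (fun t _ => (hd z t).hasFDerivWithinAt) (fun t ht => by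
      have h1 := (hball ht).le
      rw [dist_eq_norm (W' t) (W' x)] at h1
      have h2 := (W' t - W' x).norm_coe_le_norm z
      rw [ContinuousMap.sub_apply, hW', hW'] at h2
      exact h2.trans h1) (convex_ball x δ) (Metric.mem_ball_self hδ) hy
  simpa [hW, hW', swapL_apply] using this

lemma curry_contDiff_aux (m : ℕ) : ∀ (G : Type) [NormedAddCommGroup G] [NormedSpace ℝ G]
    (w : L → E → G) (_ : ∀ z, ContDiff ℝ ∞ (w z))
    (_ : ∀ i : ℕ, Continuous (fun p : L × E => iteratedFDeriv ℝ i (w p.1) p.2))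
    (W : E → C(L, G)) (_ : ∀ x z, W x z = w z x), ContDiff ℝ m W := by
  induction m with
  | zero =>
    intro G _ _ w hs hc W hW
    have h0 : Continuous (fun p : L × E => w p.1 p.2) := by
      have := (continuousMultilinearCurryFin0 ℝ E G).continuous.comp (hc 0)
      refine this.congr ?_
      intro p; simp
    have : W = (ContinuousMap.curry ⟨fun p : E × L => w p.2 p.1, by fun_prop⟩) := by
      ext1 x; ext1 z; rw [hW]; rfl
    simp only [Nat.cast_zero, contDiff_zero]
    rw [this]; exact ContinuousMap.continuous _
  | succ m ih =>
    intro G _ _ w hs hc W hW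
    have hc' : ∀ i : ℕ, Continuous (fun p : L × E => iteratedFDeriv ℝ i (fderiv ℝ (w p.1)) p.2) := by
      intro i
      have := (continuousMultilinearCurryRightEquiv' ℝ i E G).continuous.comp (hc (i+1))
      refine this.congr ?_
      intro p
      simp only [Function.comp_apply]
      rw [iteratedFDeriv_succ_eq_comp_right]
      simp
    have h0 : Continuous (fun p : L × E => fderiv ℝ (w p.1) p.2) := by
      have := (continuousMultilinearCurryFin0 ℝ E (E →L[ℝ] G)).continuous.comp (hc' 0)
      refine this.congr ?_
      intro p; simp
    let W' : E → C(L, E →L[ℝ] G) := fun x => ⟨fun z => fderiv ℝ (w z) x,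
      h0.comp (Continuous.prodMk continuous_id continuous_const)⟩
    have h1 := ih (E →L[ℝ] G) (fun z => fderiv ℝ (w z))
      (fun z => (contDiff_infty_iff_fderiv.1 (hs z)).2) hc' W' (fun _ _ => rfl)
    push_cast
    rw [contDiff_succ_iff_hasFDerivAt]
    refine ⟨fun x => swapL L E G (W' x), ContDiff.comp (g := swapL L E G) (ContinuousLinearMap.contDiff (𝕜 := ℝ)
      (E := C(L, E →L[ℝ] G)) (F := E →L[ℝ] C(L, G)) (swapL L E G)) h1, fun x => ?_⟩
    exact curry_hasFDerivAt w (fun z => fderiv ℝ (w z)) h0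
      (fun z x => ((hs z).differentiable (by simp) x).hasFDerivAt) W hW W' (fun _ _ => rfl) x

lemma curry_contDiff (w : L → E → G) (hs : ∀ z, ContDiff ℝ ∞ (w z))
    (hc : ∀ i : ℕ, Continuous (fun p : L × E => iteratedFDeriv ℝ i (w p.1) p.2))
    (W : E → C(L, G)) (hW : ∀ x z, W x z = w z x) : ContDiff ℝ ∞ W :=
  contDiff_infty.2 fun m => curry_contDiff_aux m G w hs hc W hW

end CurrySmooth

section Hadamard
variable {E G : Type} [NormedAddCommGroup E] [NormedSpace ℝ E] [NormedAddCommGroup G]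
  [NormedSpace ℝ G] [CompleteSpace G]

/-- integration over the unit interval as a continuous linear map -/
noncomputable def intL (G : Type) [NormedAddCommGroup G] [NormedSpace ℝ G] :
    C(unitInterval, G) →L[ℝ] G :=
  LinearMap.mkContinuous
    { toFun := fun φ => ∫ t, φ t
      map_add' := fun φ ψ => by
        simp only [ContinuousMap.add_apply]
        exact integral_add (φ.continuous.integrable_of_hasCompactSupport
          (HasCompactSupport.of_compactSpace _)) (ψ.continuous.integrable_of_hasCompactSupport
          (HasCompactSupport.of_compactSpace _))
      map_smul' := fun c φ => by
        simp only [ContinuousMap.smul_apply, RingHom.id_apply]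
        exact integral_smul c _ } 1
    (by
      intro φ
      have := norm_integral_le_of_norm_le_const (μ := (volume : Measure unitInterval))
        (f := fun t => φ t) (C := ‖φ‖) (Filter.Eventually.of_forall fun t => φ.norm_coe_le_norm t)
      simpa [mul_comm] using this)

lemma hadamard (w : E → G) (hw : ContDiff ℝ ∞ w) (x₀ : E) (h0 : w x₀ = 0) :
    ∃ T : E → (E →L[ℝ] G), ContDiff ℝ ∞ T ∧ T x₀ = fderiv ℝ w x₀ ∧
      ∀ x, w x = T x (x - x₀) := by
  have hD : ContDiff ℝ ∞ (fderiv ℝ w) := (contDiff_infty_iff_fderiv.1 hw).2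
  let A : unitInterval → E → E := fun t x => x₀ + (t : ℝ) • (x - x₀)
  let p : unitInterval → E → (E →L[ℝ] G) := fun t x => fderiv ℝ w (A t x)
  have hp : ∀ t, ContDiff ℝ ∞ (p t) := fun t => hD.comp (by fun_prop)
  have hpi : ∀ i : ℕ, Continuous (fun q : unitInterval × E => iteratedFDeriv ℝ i (p q.1) q.2) := by
    intro i
    have key : ∀ q : unitInterval × E, iteratedFDeriv ℝ i (p q.1) q.2 =
        (q.1 : ℝ) ^ i • iteratedFDeriv ℝ i (fderiv ℝ w) (A q.1 q.2) := by
      rintro ⟨t, x⟩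
      have h1 : p t = fun x => (fun y => fderiv ℝ w (y + (x₀ - (t:ℝ) • x₀))) ((t : ℝ) • x) := by
        ext1 x; simp only [p, A]; congr 1; module
      simp only
      rw [h1, iteratedFDeriv_comp_const_smul (𝕜 := ℝ)
        (f := fun y => fderiv ℝ w (y + (x₀ - (t:ℝ) • x₀)))]
      · simp only [iteratedFDeriv_comp_add_right]
        congr 2; simp only [A]; module
      · exact (hD.comp (by fun_prop : ContDiff ℝ ∞ _)).of_le (by exact_mod_cast le_top)
    simp_rw [key]
    have := (hD.continuous_iteratedFDeriv (m := i) (by exact_mod_cast le_top))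
    have hA : Continuous (fun q : unitInterval × E => A q.1 q.2) := by
      simp only [A]; fun_prop
    exact Continuous.smul ((continuous_subtype_val.comp continuous_fst).pow i) (this.comp hA)
  have hpc : Continuous (fun q : unitInterval × E => p q.1 q.2) :=
    hD.continuous.comp (by fun_prop)
  let W : E → C(unitInterval, E →L[ℝ] G) := fun x => ⟨fun t => p t x, by fun_prop⟩
  have hW : ContDiff ℝ ∞ W := curry_contDiff p hp hpi W (fun _ _ => rfl)
  refine ⟨fun x => intL _ (W x), ContDiff.comp (g := intL (E →L[ℝ] G)) (ContinuousLinearMap.contDiff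
    (𝕜 := ℝ) (E := C(unitInterval, E →L[ℝ] G)) (F := E →L[ℝ] G) (intL _)) hW, ?_, ?_⟩
  · change ∫ t, p t x₀ = _
    simp [p, A]
  · intro x
    change w x = (∫ t, p t x) (x - x₀)
    have hIntegr : Integrable (fun t => p t x) (volume : Measure unitInterval) :=
      Continuous.integrable_of_hasCompactSupport (by fun_prop) (HasCompactSupport.of_compactSpace _)
    rw [ContinuousLinearMap.integral_apply hIntegr]
    have hd : ∀ t ∈ Set.uIcc (0:ℝ) 1, HasDerivAt (fun t : ℝ => w (x₀ + t • (x - x₀)))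
        (fderiv ℝ w (x₀ + t • (x - x₀)) (x - x₀)) t := by
      intro t _
      have h1 : HasDerivAt (fun t : ℝ => x₀ + t • (x - x₀)) (x - x₀) t := by
        simpa using ((hasDerivAt_id t).smul_const (x - x₀)).const_add x₀
      exact ((hw.differentiable (by simp) _).hasFDerivAt).comp_hasDerivAt t h1
    have h2 := intervalIntegral.integral_eq_sub_of_hasDerivAt hd (by
      apply Continuous.intervalIntegrable
      exact (hD.continuous.comp (by fun_prop)).clm_apply continuous_const)
    simp only [one_smul, zero_smul, add_zero, h0, sub_zero, add_sub_cancel] at h2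
    rw [← h2, intervalIntegral.integral_of_le zero_le_one, ← integral_Icc_eq_integral_Ioc,
      ← integral_subtype_comap measurableSet_Icc
        (fun t : ℝ => fderiv ℝ w (x₀ + t • (x - x₀)) (x - x₀))]
    rfl

end Hadamard
end SPH

namespace SPH
open scoped ContDiff Topology

section Division

/-- Data of a phase function with a unique nondegenerate critical point in a compact set. -/
structure Phase (n : ℕ) (f : EuclideanSpace ℝ (Fin n) → ℝ) (x₀ : EuclideanSpace ℝ (Fin n))
    (K : Set (EuclideanSpace ℝ (Fin n))) : Prop where
  smooth : ContDiff ℝ ∞ f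
  cpt : IsCompact K
  nhd : K ∈ 𝓝 x₀
  crit : fderiv ℝ f x₀ = 0
  uniq : ∀ x ∈ K, fderiv ℝ f x = 0 → x = x₀
  nondeg : ∀ v : EuclideanSpace ℝ (Fin n),
      (∀ w : EuclideanSpace ℝ (Fin n), fderiv ℝ (fderiv ℝ f) x₀ v w = 0) → v = 0

/-- standard basis vector -/
noncomputable abbrev bv {n : ℕ} (j : Fin n) : EuclideanSpace ℝ (Fin n) := EuclideanSpace.single j 1

variable {n : ℕ}

lemma dual_expand (l : EuclideanSpace ℝ (Fin n) →L[ℝ] ℝ) :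
    l = ∑ j, l (bv j) • (EuclideanSpace.proj j : EuclideanSpace ℝ (Fin n) →L[ℝ] ℝ) := by
  have hb := (EuclideanSpace.basisFun (Fin n) ℝ).toBasis
  apply ContinuousLinearMap.coe_injective
  refine (EuclideanSpace.basisFun (Fin n) ℝ).toBasis.ext fun i => ?_
  simp [bv]

lemma hess_invertible (f : EuclideanSpace ℝ (Fin n) → ℝ) (x₀ : EuclideanSpace ℝ (Fin n))
    (nondeg : ∀ v : EuclideanSpace ℝ (Fin n),
      (∀ w : EuclideanSpace ℝ (Fin n), fderiv ℝ (fderiv ℝ f) x₀ v w = 0) → v = 0) :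
    ContinuousLinearMap.IsInvertible (fderiv ℝ (fderiv ℝ f) x₀) := by
  set H := fderiv ℝ (fderiv ℝ f) x₀ with hH
  have hinj : Function.Injective (H : EuclideanSpace ℝ (Fin n) →ₗ[ℝ] (EuclideanSpace ℝ (Fin n) →L[ℝ] ℝ)) := by
    rw [injective_iff_map_eq_zero]
    intro v hv
    apply nondeg
    intro w
    have : H v = 0 := hv
    rw [this]; rfl
  have hdim : Module.finrank ℝ (EuclideanSpace ℝ (Fin n)) =
      Module.finrank ℝ (EuclideanSpace ℝ (Fin n) →L[ℝ] ℝ) := by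
    rw [← (LinearMap.toContinuousLinearMap (𝕜 := ℝ) (E := EuclideanSpace ℝ (Fin n))
      (F' := ℝ)).finrank_eq]
    exact (Subspace.dual_finrank_eq (K := ℝ) (V := EuclideanSpace ℝ (Fin n))).symm
  let e := LinearEquiv.ofInjectiveOfFinrankEq _ hinj hdim
  refine ⟨e.toContinuousLinearEquiv, ?_⟩
  ext v w
  rfl

lemma near_data {f : EuclideanSpace ℝ (Fin n) → ℝ} {x₀ : EuclideanSpace ℝ (Fin n)}
    (hf : ContDiff ℝ ∞ f) (crit : fderiv ℝ f x₀ = 0)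
    (nondeg : ∀ v : EuclideanSpace ℝ (Fin n),
      (∀ w : EuclideanSpace ℝ (Fin n), fderiv ℝ (fderiv ℝ f) x₀ v w = 0) → v = 0) :
    ∃ T : EuclideanSpace ℝ (Fin n) → (EuclideanSpace ℝ (Fin n) →L[ℝ] ℝ) →L[ℝ]
      EuclideanSpace ℝ (Fin n), ∃ V ∈ 𝓝 x₀, (∀ x ∈ V, ContDiffAt ℝ ∞ T x) ∧
      ∀ x ∈ V, x - x₀ = T x (fderiv ℝ f x) := by
  have hD : ContDiff ℝ ∞ (fderiv ℝ f) := (contDiff_infty_iff_fderiv.1 hf).2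
  obtain ⟨T, hT, hT0, hTx⟩ := hadamard (fderiv ℝ f) hD x₀ crit
  have hinv := hess_invertible f x₀ nondeg
  obtain ⟨e, he⟩ := hinv
  have hopen : Set.range ((↑) : (EuclideanSpace ℝ (Fin n) ≃L[ℝ] (EuclideanSpace ℝ (Fin n) →L[ℝ] ℝ)) →
      _) ∈ 𝓝 (T x₀) := by
    rw [hT0, ← he]
    exact ContinuousLinearEquiv.nhds e
  refine ⟨fun x => (T x).inverse, T ⁻¹' _, hT.continuous.continuousAt hopen, ?_, ?_⟩
  · rintro x ⟨e', he'⟩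
    have h1 : ContinuousLinearMap.IsInvertible (T x) := ⟨e', he'⟩
    exact (h1.contDiffAt_map_inverse (n := ∞)).comp x hT.contDiffAt
  · rintro x ⟨e', he'⟩
    have h1 := hTx x
    simp only [← he'] at h1 ⊢
    rw [h1]
    simp

lemma isolated_crit {f : EuclideanSpace ℝ (Fin n) → ℝ} {x₀ : EuclideanSpace ℝ (Fin n)}
    (hf : ContDiff ℝ ∞ f) (crit : fderiv ℝ f x₀ = 0)
    (nondeg : ∀ v : EuclideanSpace ℝ (Fin n),
      (∀ w : EuclideanSpace ℝ (Fin n), fderiv ℝ (fderiv ℝ f) x₀ v w = 0) → v = 0) :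
    ∃ V ∈ 𝓝 x₀, ∀ x ∈ V, fderiv ℝ f x = 0 → x = x₀ := by
  obtain ⟨T, V, hV, _, h⟩ := near_data hf crit nondeg
  refine ⟨V, hV, fun x hx h0 => ?_⟩
  have := h x hx
  rw [h0, map_zero, sub_eq_zero] at this
  exact this

lemma contDiff_of_tsupp {F : Type} [NormedAddCommGroup F] [NormedSpace ℝ F] {E : Type} [NormedAddCommGroup E] [NormedSpace ℝ E] {g : E → F}
    (h : ∀ x ∈ tsupport g, ContDiffAt ℝ ∞ g x) : ContDiff ℝ ∞ g := by
  rw [contDiff_iff_contDiffAt]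
  intro x
  by_cases hx : x ∈ tsupport g
  · exact h x hx
  · exact contDiffAt_const.congr_of_eventuallyEq (notMem_tsupport_iff_eventuallyEq.1 hx)

variable {F : Type} [NormedAddCommGroup F] [NormedSpace ℝ F] [CompleteSpace F]

lemma division {f : EuclideanSpace ℝ (Fin n) → ℝ} {x₀ : EuclideanSpace ℝ (Fin n)}
    {K : Set (EuclideanSpace ℝ (Fin n))} (hP : Phase n f x₀ K)
    (u : EuclideanSpace ℝ (Fin n) → F) (hu : ContDiff ℝ ∞ u) (hsupp : tsupport u ⊆ K)
    (h0 : u x₀ = 0) :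
    ∃ a : Fin n → EuclideanSpace ℝ (Fin n) → F, (∀ j, ContDiff ℝ ∞ (a j)) ∧
      (∀ j, tsupport (a j) ⊆ K) ∧ ∀ x, u x = ∑ j, fderiv ℝ f x (bv j) • a j x := by
  obtain ⟨T, V, hV, hTs, hTx⟩ := near_data hP.smooth hP.crit hP.nondeg
  obtain ⟨S, hS, -, hSx⟩ := hadamard u hu x₀ h0
  have hD : ContDiff ℝ ∞ (fderiv ℝ f) := (contDiff_infty_iff_fderiv.1 hP.smooth).2
  obtain ⟨ε, hε, hεV⟩ := Metric.nhds_basis_closedBall.mem_iff.1 (Filter.inter_mem hV hP.nhd)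
  let χ : ContDiffBump x₀ := ⟨ε / 2, ε, by positivity, by linarith⟩
  have hχs : tsupport χ ⊆ V ∩ K := by
    rw [χ.tsupport_eq]; exact hεV
  have hχ : ContDiff ℝ ∞ χ := χ.contDiff
  let an : Fin n → EuclideanSpace ℝ (Fin n) → F :=
    fun j x => χ x • S x (T x (EuclideanSpace.proj j))
  let N : EuclideanSpace ℝ (Fin n) → ℝ := fun x => ∑ i, fderiv ℝ f x (bv i) ^ 2
  have hN : ContDiff ℝ ∞ N := by
    apply ContDiff.sum
    intro i _
    exact (hD.clm_apply contDiff_const).pow 2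
  have hN0 : ∀ x, N x = 0 → fderiv ℝ f x = 0 := by
    intro x hx
    rw [dual_expand (fderiv ℝ f x)]
    apply Finset.sum_eq_zero
    intro j _
    have := (Finset.sum_eq_zero_iff_of_nonneg (fun i _ => sq_nonneg _)).1 hx j (Finset.mem_univ j)
    rw [pow_eq_zero_iff two_ne_zero] at this
    rw [this, zero_smul]
  let af : Fin n → EuclideanSpace ℝ (Fin n) → F :=
    fun j x => ((1 - χ x) * (fderiv ℝ f x (bv j) / N x)) • u x
  have han_s : ∀ j, tsupport (an j) ⊆ V ∩ K := by
    intro j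
    refine (closure_mono ?_).trans hχs
    intro x hx h
    apply hx
    simp only [an]
    rw [h, zero_smul]
  have haf_s : ∀ j, tsupport (af j) ⊆ tsupport u := by
    intro j
    refine closure_mono ?_
    intro x hx h
    apply hx
    simp only [af]
    rw [h, smul_zero]
  have han : ∀ j, ContDiff ℝ ∞ (an j) := by
    intro j
    apply contDiff_of_tsupp
    intro x hx
    have hxV := (han_s j hx).1
    exact hχ.contDiffAt.smul (hS.contDiffAt.clm_apply ((hTs x hxV).clm_apply contDiffAt_const))
  have haf : ∀ j, ContDiff ℝ ∞ (af j) := by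
    intro j
    apply contDiff_of_tsupp
    intro x hx
    by_cases hx0 : x = x₀
    · have : af j =ᶠ[𝓝 x] fun _ => 0 := by
        rw [hx0]
        filter_upwards [χ.eventuallyEq_one] with y hy
        simp only [af]
        rw [hy]; simp
      exact contDiffAt_const.congr_of_eventuallyEq this
    · have hNx : N x ≠ 0 := fun h => hx0 (hP.uniq x (hsupp (haf_s j hx)) (hN0 x h))
      exact ((contDiffAt_const.sub hχ.contDiffAt).mul
        (((hD.contDiffAt).clm_apply contDiffAt_const).div hN.contDiffAt hNx)).smul hu.contDiffAt
  refine ⟨fun j x => an j x + af j x, fun j => (han j).add (haf j), fun j => ?_, fun x => ?_⟩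
  · exact (tsupport_add (an j) (af j)).trans (Set.union_subset ((han_s j).trans Set.inter_subset_right)
      ((haf_s j).trans hsupp))
  · simp only [smul_add, Finset.sum_add_distrib]
    have h1 : ∑ j, fderiv ℝ f x (bv j) • an j x = χ x • u x := by
      by_cases hc : χ x = 0
      · simp [an, hc]
      · have hxV : x ∈ V := (hχs (subset_tsupport _ hc)).1
        rw [hSx x, hTx x hxV]
        conv_rhs => rw [dual_expand (fderiv ℝ f x)]
        simp only [map_sum, map_smul, Finset.smul_sum, an]
        refine Finset.sum_congr rfl fun j _ => ?_
        rw [smul_comm]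
    have h2 : ∑ j, fderiv ℝ f x (bv j) • af j x = (1 - χ x) • u x := by
      by_cases hux : u x = 0
      · simp [af, hux]
      · have hxK : x ∈ K := hsupp (subset_tsupport _ hux)
        have hNx : N x ≠ 0 := fun h => hux (by rw [hP.uniq x hxK (hN0 x h), h0])
        simp only [af, smul_smul, ← Finset.sum_smul]
        congr 1
        have : ∀ j, fderiv ℝ f x (bv j) * ((1 - χ x) * (fderiv ℝ f x (bv j) / N x)) =
            (1 - χ x) * (fderiv ℝ f x (bv j) ^ 2 / N x) := fun j => by ring
        simp_rw [this, ← Finset.mul_sum, ← Finset.sum_div]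
        rw [div_self hNx, mul_one]
    rw [h1, h2]
    module

end Division
end SPH

namespace SPH
open scoped ContDiff Topology

section Osc
set_option linter.unusedSectionVars false
variable {n : ℕ} {F : Type} [NormedAddCommGroup F] [NormedSpace ℝ F] [NormedSpace ℂ F]
  [IsScalarTower ℝ ℂ F]

/-- the oscillatory integral -/
noncomputable def osc (f : EuclideanSpace ℝ (Fin n) → ℝ) (u : EuclideanSpace ℝ (Fin n) → F)
    (r : ℝ) : F := ∫ x, Complex.exp (Complex.I * r * f x) • u x

/-- divergence of a family of amplitudes, times `I` -/
noncomputable def divI (a : Fin n → EuclideanSpace ℝ (Fin n) → F) :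
    EuclideanSpace ℝ (Fin n) → F := fun x => Complex.I • ∑ j, fderiv ℝ (a j) x (bv j)

variable {f : EuclideanSpace ℝ (Fin n) → ℝ} {K : Set (EuclideanSpace ℝ (Fin n))}

lemma hcs_of_tsupp (hK : IsCompact K) {G : Type} [Zero G] {u : EuclideanSpace ℝ (Fin n) → G}
    (hs : tsupport u ⊆ K) : HasCompactSupport u :=
  HasCompactSupport.of_support_subset_isCompact hK ((subset_tsupport u).trans hs)

lemma exp_contDiff (hf : ContDiff ℝ ∞ f) (r : ℝ) :
    ContDiff ℝ ∞ (fun x => Complex.exp (Complex.I * r * f x)) := by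
  have : ContDiff ℝ ∞ (fun x => (f x : ℂ)) := Complex.ofRealCLM.contDiff.comp hf
  exact (contDiff_const.mul this).cexp

lemma osc_integrable (hf : Continuous f) (hK : IsCompact K)
    {u : EuclideanSpace ℝ (Fin n) → F} (hu : Continuous u) (hs : tsupport u ⊆ K) (r : ℝ) :
    Integrable (fun x => Complex.exp (Complex.I * r * f x) • u x) := by
  apply Continuous.integrable_of_hasCompactSupport
  · exact Continuous.smul (by fun_prop) hu
  · exact (hcs_of_tsupp hK hs).smul_left

lemma norm_exp_osc (r s : ℝ) : ‖Complex.exp (Complex.I * r * s)‖ = 1 := by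
  rw [mul_assoc, ← Complex.ofReal_mul, mul_comm, Complex.norm_exp_ofReal_mul_I]

lemma osc_bound (f : EuclideanSpace ℝ (Fin n) → ℝ) (u : EuclideanSpace ℝ (Fin n) → F) :
    ∀ r, ‖osc f u r‖ ≤ ∫ x, ‖u x‖ := by
  intro r
  refine (norm_integral_le_integral_norm _).trans (le_of_eq ?_)
  congr 1
  ext x
  rw [norm_smul, norm_exp_osc, one_mul]

lemma osc_add (hf : Continuous f) (hK : IsCompact K)
    {u v : EuclideanSpace ℝ (Fin n) → F} (hu : Continuous u) (hus : tsupport u ⊆ K)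
    (hv : Continuous v) (hvs : tsupport v ⊆ K) (r : ℝ) :
    osc f (fun x => u x + v x) r = osc f u r + osc f v r := by
  unfold osc
  rw [← integral_add (osc_integrable hf hK hu hus r) (osc_integrable hf hK hv hvs r)]
  simp only [smul_add]

lemma divI_contDiff {a : Fin n → EuclideanSpace ℝ (Fin n) → F} (ha : ∀ j, ContDiff ℝ ∞ (a j)) :
    ContDiff ℝ ∞ (divI a) := by
  unfold divI
  apply ContDiff.const_smul
  apply ContDiff.sum
  intro j _
  exact (contDiff_infty_iff_fderiv.1 (ha j)).2.clm_apply contDiff_const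

lemma tsupport_sum_subset {ι X G : Type} [TopologicalSpace X] [AddCommMonoid G] (s : Finset ι)
    (hK : IsClosed K) {w : ι → EuclideanSpace ℝ (Fin n) → G} (h : ∀ j, tsupport (w j) ⊆ K) :
    tsupport (fun x => ∑ j ∈ s, w j x) ⊆ K := by
  refine closure_minimal ?_ hK
  intro x hx
  by_contra hxK
  apply hx
  apply Finset.sum_eq_zero
  intro j _
  exact image_eq_zero_of_notMem_tsupport fun h' => hxK (h j h')

lemma divI_tsupport (hK : IsClosed K) {a : Fin n → EuclideanSpace ℝ (Fin n) → F}
    (has : ∀ j, tsupport (a j) ⊆ K) : tsupport (divI a) ⊆ K := by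
  unfold divI
  refine closure_minimal ?_ hK
  intro x hx
  by_contra hxK
  apply hx
  simp only
  rw [Finset.sum_eq_zero, smul_zero]
  intro j _
  have : x ∉ tsupport (fun x => fderiv ℝ (a j) x (bv j)) := fun h' =>
    hxK (has j (tsupport_fderiv_apply_subset ℝ _ h'))
  exact image_eq_zero_of_notMem_tsupport (f := fun x => fderiv ℝ (a j) x (bv j)) this

lemma ibp (hf : ContDiff ℝ ∞ f) (hK : IsCompact K)
    {a : Fin n → EuclideanSpace ℝ (Fin n) → F} (ha : ∀ j, ContDiff ℝ ∞ (a j))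
    (has : ∀ j, tsupport (a j) ⊆ K) (u : EuclideanSpace ℝ (Fin n) → F)
    (hu : ∀ x, u x = ∑ j, fderiv ℝ f x (bv j) • a j x) (r : ℝ) (hr : r ≠ 0) :
    osc f u r = (r : ℂ)⁻¹ • osc f (divI a) r := by
  have hfc := hf.continuous
  have hD : ContDiff ℝ ∞ (fderiv ℝ f) := (contDiff_infty_iff_fderiv.1 hf).2
  have hDa : ∀ j, ContDiff ℝ ∞ (fderiv ℝ (a j)) := fun j => (contDiff_infty_iff_fderiv.1 (ha j)).2
  have hrc : (r : ℂ) ≠ 0 := by exact_mod_cast hr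
  have hi1 : ∀ j, Integrable (fun x => Complex.exp (Complex.I * r * f x) •
      fderiv ℝ f x (bv j) • a j x) := fun j => by
    apply osc_integrable hfc hK
    · exact (hD.continuous.clm_apply continuous_const).smul (ha j).continuous
    · exact (tsupport_smul_subset_right _ _).trans (has j)
  have hi2 : ∀ j, Integrable (fun x => Complex.exp (Complex.I * r * f x) •
      fderiv ℝ (a j) x (bv j)) := fun j => by
    apply osc_integrable hfc hK
    · exact ((hDa j).continuous.clm_apply continuous_const)
    · exact (tsupport_fderiv_apply_subset ℝ _).trans (has j)
  have hi3 : ∀ j, Integrable (fun x => Complex.exp (Complex.I * r * f x) • a j x) := fun j =>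
    osc_integrable hfc hK (ha j).continuous (has j) r
  have hde : ∀ x v, fderiv ℝ (fun x => Complex.exp (Complex.I * r * f x)) x v =
      Complex.I * r * (Complex.exp (Complex.I * r * f x) * (fderiv ℝ f x v : ℝ)) := by
    intro x v
    have h1 : HasFDerivAt (fun x => (f x : ℂ)) (Complex.ofRealCLM.comp (fderiv ℝ f x)) x :=
      Complex.ofRealCLM.hasFDerivAt.comp x (hf.differentiable (by simp) x).hasFDerivAt
    have h2 := (h1.const_mul (Complex.I * r)).cexp
    rw [h2.fderiv]
    simp
    ring
  have hkey : ∀ j, ∫ x, Complex.exp (Complex.I * r * f x) • fderiv ℝ f x (bv j) • a j x =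
      (r : ℂ)⁻¹ • Complex.I • ∫ x, Complex.exp (Complex.I * r * f x) • fderiv ℝ (a j) x (bv j) := by
    intro j
    have heq : ∀ x, fderiv ℝ (fun x => Complex.exp (Complex.I * r * f x)) x (bv j) • a j x =
        (Complex.I * r) • (Complex.exp (Complex.I * r * f x) • fderiv ℝ f x (bv j) • a j x) := by
      intro x
      rw [hde, ← algebraMap_smul ℂ (fderiv ℝ f x (bv j)) (a j x), smul_smul, smul_smul]
      rw [Complex.coe_algebraMap, mul_assoc (Complex.I * (r : ℂ))]
    have := integral_smul_fderiv_eq_neg_fderiv_smul_of_integrable (μ := volume)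
      (f := fun x => Complex.exp (Complex.I * r * f x)) (g := a j) (v := bv j)
      (by simp_rw [heq]; exact (hi1 j).smul _) (hi2 j) (hi3 j)
      (fun x _ => (exp_contDiff hf r).differentiable (by simp) x)
      (fun x _ => (ha j).differentiable (by simp) x)
    rw [this]
    simp_rw [heq]
    rw [integral_smul, smul_neg, smul_neg, smul_smul, smul_smul, ← neg_smul]
    have : -((r : ℂ)⁻¹ * (Complex.I * (Complex.I * r))) = 1 := by
      rw [← mul_assoc Complex.I, Complex.I_mul_I]; field_simp
    rw [mul_assoc, this, one_smul]
  have e1 : osc f u r = ∑ j, ∫ x, Complex.exp (Complex.I * r * f x) • fderiv ℝ f x (bv j) • a j x := by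
    rw [← integral_finsetSum _ (fun j _ => hi1 j)]
    unfold osc
    congr 1; ext x
    rw [hu, Finset.smul_sum]
  have e2 : osc f (divI a) r =
      Complex.I • ∑ j, ∫ x, Complex.exp (Complex.I * r * f x) • fderiv ℝ (a j) x (bv j) := by
    rw [← integral_finsetSum _ (fun j _ => hi2 j), ← integral_smul]
    unfold osc divI
    congr 1; ext x
    rw [← Finset.smul_sum, smul_comm]
  rw [e1, e2, Finset.smul_sum, Finset.smul_sum]
  exact Finset.sum_congr rfl fun j _ => hkey j

variable [CompleteSpace F] {x₀ : EuclideanSpace ℝ (Fin n)}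

/-- one reduction step -/
lemma osc_step (hP : Phase n f x₀ K) (g : EuclideanSpace ℝ (Fin n) → ℂ) (hg : ContDiff ℝ ∞ g)
    (hgs : tsupport g ⊆ K) (hg0 : g x₀ = 1)
    (u : EuclideanSpace ℝ (Fin n) → F) (hu : ContDiff ℝ ∞ u) (hsupp : tsupport u ⊆ K) :
    ∃ u₁ : EuclideanSpace ℝ (Fin n) → F, ContDiff ℝ ∞ u₁ ∧ tsupport u₁ ⊆ K ∧
      ∀ r : ℝ, r ≠ 0 → osc f u r = osc f g r • u x₀ + (r : ℂ)⁻¹ • osc f u₁ r := by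
  have hgu : ContDiff ℝ ∞ (fun x => g x • u x₀) := hg.smul contDiff_const
  have hgus : tsupport (fun x => g x • u x₀) ⊆ K := (tsupport_smul_subset_left _ _).trans hgs
  have hvs : tsupport (fun x => u x - g x • u x₀) ⊆ K :=
    (tsupport_sub u (fun x => g x • u x₀)).trans (Set.union_subset hsupp hgus)
  obtain ⟨a, ha, has, hax⟩ := division hP (fun x => u x - g x • u x₀) (hu.sub hgu) hvs
    (by simp [hg0])
  refine ⟨divI a, divI_contDiff ha, divI_tsupport hP.cpt.isClosed has, fun r hr => ?_⟩
  rw [← ibp hP.smooth hP.cpt ha has _ hax r hr]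
  have h1 : osc f g r • u x₀ = osc f (fun x => g x • u x₀) r := by
    unfold osc
    rw [← integral_smul_const]
    simp only [smul_assoc]
  rw [h1, ← osc_add hP.smooth.continuous hP.cpt hgu.continuous hgus (hu.sub hgu).continuous hvs]
  simp

lemma osc_iter (hP : Phase n f x₀ K) (g : EuclideanSpace ℝ (Fin n) → ℂ) (hg : ContDiff ℝ ∞ g)
    (hgs : tsupport g ⊆ K) (hg0 : g x₀ = 1) (N : ℕ) :
    ∀ (u : EuclideanSpace ℝ (Fin n) → F) (_ : ContDiff ℝ ∞ u) (_ : tsupport u ⊆ K),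
    ∃ c : ℕ → F, c 0 = u x₀ ∧ ∃ C : ℝ, 0 ≤ C ∧ ∀ r : ℝ, 0 < r →
      ‖osc f u r - osc f g r • ∑ j ∈ Finset.range N, ((r : ℂ)⁻¹ ^ j) • c j‖ ≤ C * r⁻¹ ^ N := by
  induction N with
  | zero =>
    intro u hu hs
    refine ⟨fun _ => u x₀, rfl, ∫ x, ‖u x‖, integral_nonneg fun _ => norm_nonneg _, fun r _ => ?_⟩
    simpa using osc_bound f u r
  | succ N ih =>
    intro u hu hs
    obtain ⟨u₁, hu₁, hs₁, h⟩ := osc_step hP g hg hgs hg0 u hu hs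
    obtain ⟨c, hc0, C, hC, hc⟩ := ih u₁ hu₁ hs₁
    refine ⟨fun j => Nat.casesOn j (u x₀) c, rfl, C, hC, fun r hr => ?_⟩
    have h1 : osc f u r - osc f g r • ∑ j ∈ Finset.range (N + 1),
        ((r : ℂ)⁻¹ ^ j) • (Nat.casesOn j (u x₀) c : F) =
        (r : ℂ)⁻¹ • (osc f u₁ r - osc f g r • ∑ j ∈ Finset.range N, ((r : ℂ)⁻¹ ^ j) • c j) := by
      rw [h r hr.ne', Finset.sum_range_succ']
      simp only [pow_zero, one_smul, pow_succ', mul_smul]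
      rw [smul_add, smul_sub, ← Finset.smul_sum, smul_comm (r : ℂ)⁻¹ (osc f g r)]
      change _ - (_ + osc f g r • u x₀) = _
      abel
    rw [h1, norm_smul, norm_inv, Complex.norm_of_nonneg hr.le, pow_succ']
    have := hc r hr
    have hr' : 0 ≤ r⁻¹ := by positivity
    nlinarith [mul_le_mul_of_nonneg_left this hr']

end Osc
end SPH

namespace SPH
open scoped ContDiff Topology

section Trace
variable {n : ℕ} {f : EuclideanSpace ℝ (Fin n) → ℝ} {K : Set (EuclideanSpace ℝ (Fin n))}
   {x₀ : EuclideanSpace ℝ (Fin n)}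

lemma matrix_trace_half (H A : Matrix (Fin n) (Fin n) ℝ) (hsym : H.transpose = H)
    (hdet : IsUnit H.det) (h : H = H * A + (H * A).transpose) : A.trace = n / 2 := by
  have h1 : H⁻¹ * H = H⁻¹ * (H * A) + H⁻¹ * (A.transpose * H) := by
    rw [← mul_add]
    congr 1
    conv_lhs => rw [h]
    rw [Matrix.transpose_mul, hsym]
  rw [Matrix.nonsing_inv_mul _ hdet, ← Matrix.mul_assoc, Matrix.nonsing_inv_mul _ hdet,
    Matrix.one_mul] at h1
  have h2 := congrArg Matrix.trace h1
  rw [Matrix.trace_add, Matrix.trace_mul_comm, Matrix.mul_assoc, Matrix.mul_nonsing_inv _ hdet,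
    Matrix.mul_one, Matrix.trace_transpose, Matrix.trace_one, Fintype.card_fin] at h2
  linarith

lemma div_half (hP : Phase n f x₀ K) {a : Fin n → EuclideanSpace ℝ (Fin n) → ℝ}
    (ha : ∀ j, ContDiff ℝ ∞ (a j))
    (hax : ∀ᶠ x in 𝓝 x₀, f x = ∑ j, fderiv ℝ f x (bv j) * a j x) :
    ∑ j, fderiv ℝ (a j) x₀ (bv j) = n / 2 := by
  have hD : ContDiff ℝ ∞ (fderiv ℝ f) := (contDiff_infty_iff_fderiv.1 hP.smooth).2
  have hDD : ContDiff ℝ ∞ (fderiv ℝ (fderiv ℝ f)) := (contDiff_infty_iff_fderiv.1 hD).2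
  have hDa : ∀ j, ContDiff ℝ ∞ (fderiv ℝ (a j)) := fun j => (contDiff_infty_iff_fderiv.1 (ha j)).2
  have hh : ∀ j x, HasFDerivAt (fun x => fderiv ℝ f x (bv j))
      ((fderiv ℝ (fderiv ℝ f) x).flip (bv j)) x := by
    intro j x
    have := ((hD.differentiable (by simp) x).hasFDerivAt).clm_apply (hasFDerivAt_const (bv j) x)
    simpa using this
  have had : ∀ j x, HasFDerivAt (a j) (fderiv ℝ (a j) x) x := fun j x =>
    ((ha j).differentiable (by simp) x).hasFDerivAt
  -- first derivative
  have e1 : ∀ᶠ x in 𝓝 x₀, ∀ i, fderiv ℝ f x (bv i) = ∑ j, (fderiv ℝ f x (bv j) *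
      fderiv ℝ (a j) x (bv i) + a j x * fderiv ℝ (fderiv ℝ f) x (bv i) (bv j)) := by
    filter_upwards [hax.eventually_nhds] with x hx i
    have h1 : fderiv ℝ f x = fderiv ℝ (fun x => ∑ j, fderiv ℝ f x (bv j) * a j x) x :=
      Filter.EventuallyEq.fderiv_eq hx
    have h2 : HasFDerivAt (fun x => ∑ j, fderiv ℝ f x (bv j) * a j x) _ x :=
      HasFDerivAt.fun_sum (u := Finset.univ) fun j _ => (hh j x).mul (had j x)
    have h3 := congrArg (fun l : EuclideanSpace ℝ (Fin n) →L[ℝ] ℝ => l (bv i)) (h1.trans h2.fderiv)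
    simpa using h3
  let H : Matrix (Fin n) (Fin n) ℝ := fun i j => fderiv ℝ (fderiv ℝ f) x₀ (bv i) (bv j)
  let A : Matrix (Fin n) (Fin n) ℝ := fun j k => fderiv ℝ (a j) x₀ (bv k)
  have hsym : ∀ v w, fderiv ℝ (fderiv ℝ f) x₀ v w = fderiv ℝ (fderiv ℝ f) x₀ w v := by
    have : IsSymmSndFDerivAt ℝ f x₀ :=
      hP.smooth.contDiffAt.isSymmSndFDerivAt (by
        simp only [minSmoothness_of_isRCLikeNormedField]; exact WithTop.coe_le_coe.2 (le_top : (2 : ℕ∞) ≤ ⊤))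
    exact fun v w => this v w
  have hinj : ∀ v : Fin n → ℝ, H.mulVec v = 0 → v = 0 := by
    intro v hv
    let V : EuclideanSpace ℝ (Fin n) := ∑ j, v j • bv j
    have hV : V = 0 := by
      apply hP.nondeg
      intro w
      rw [hsym, dual_expand (fderiv ℝ (fderiv ℝ f) x₀ w)]
      have hw : w = ∑ i, w i • bv i := by
        have := (EuclideanSpace.basisFun (Fin n) ℝ).sum_repr w
        simpa [bv] using this.symm
      have : fderiv ℝ (fderiv ℝ f) x₀ w V = 0 := by
        rw [hw]
        simp only [V, map_sum, map_smul, FunLike.coe_sum, Finset.sum_apply,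
          FunLike.coe_smul, Pi.smul_apply, Finset.smul_sum]
        rw [Finset.sum_comm]
        apply Finset.sum_eq_zero
        intro i _
        have := congrFun hv i
        simp only [Matrix.mulVec, dotProduct, H, Pi.zero_apply] at this
        simp only [smul_eq_mul]
        have h2 : w i * ∑ j, fderiv ℝ (fderiv ℝ f) x₀ (bv i) (bv j) * v j = 0 := by
          rw [this, mul_zero]
        rw [Finset.mul_sum] at h2
        rw [← h2]
        exact Finset.sum_congr rfl fun j _ => by ring
      rw [← dual_expand]; exact this
    ext j
    have := congrArg (fun y : EuclideanSpace ℝ (Fin n) => y j) hV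
    simpa [V, bv, Pi.single_apply, Finset.sum_apply] using this
  have ha0 : ∀ j, a j x₀ = 0 := by
    have : (fun j => a j x₀) = 0 := by
      apply hinj
      ext i
      have := e1.self_of_nhds i
      simp only [hP.crit, zero_apply, zero_mul, zero_add] at this
      simp only [Matrix.mulVec, dotProduct, H, Pi.zero_apply]
      rw [this]
      exact Finset.sum_congr rfl fun j _ => by ring
    exact fun j => congrFun this j
  have e2 : H = H * A + (H * A).transpose := by
    ext k i
    have hda : ∀ j, DifferentiableAt ℝ (fun x => fderiv ℝ (a j) x (bv i)) x₀ := fun j =>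
      ((hDa j).clm_apply contDiff_const).differentiable (by simp) x₀
    have hdf : ∀ j, DifferentiableAt ℝ (fun x => fderiv ℝ (fderiv ℝ f) x (bv i) (bv j)) x₀ := fun j =>
      ((hDD.clm_apply contDiff_const).clm_apply contDiff_const).differentiable (by simp) x₀
    have h1 : fderiv ℝ (fun x => fderiv ℝ f x (bv i)) x₀ = _ :=
      Filter.EventuallyEq.fderiv_eq (e1.mono fun x hx => hx i)
    have h2 : HasFDerivAt (fun x => ∑ j, (fderiv ℝ f x (bv j) *
      fderiv ℝ (a j) x (bv i) + a j x * fderiv ℝ (fderiv ℝ f) x (bv i) (bv j))) _ x₀ :=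
      HasFDerivAt.fun_sum (u := Finset.univ) fun j _ =>
      ((hh j x₀).mul (hda j).hasFDerivAt).add ((had j x₀).mul (hdf j).hasFDerivAt)
    rw [(hh i x₀).fderiv, h2.fderiv] at h1
    have h3 := congrArg (fun l : EuclideanSpace ℝ (Fin n) →L[ℝ] ℝ => l (bv k)) h1
    simp only [hP.crit, ha0] at h3
    simp only [ContinuousLinearMap.flip_apply, FunLike.coe_sum, Finset.sum_apply,
      add_apply, FunLike.coe_smul, Pi.smul_apply, smul_eq_mul,
      zero_apply, zero_mul, zero_add] at h3
    simp only [Matrix.add_apply, Matrix.transpose_apply, Matrix.mul_apply]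
    rw [← Finset.sum_add_distrib]
    refine h3.trans (Finset.sum_congr rfl fun j _ => ?_)
    simp only [H, A]
    ring
  have := matrix_trace_half H A (by ext i j; exact hsym _ _) (by
    rw [isUnit_iff_ne_zero]
    intro h0
    obtain ⟨v, hv, hv0⟩ := Matrix.exists_mulVec_eq_zero_iff.2 h0
    exact hv (hinj v hv0)) e2
  exact this

end Trace
end SPH

namespace SPH
open scoped ContDiff Topology

section Expansions
variable {F : Type} [NormedAddCommGroup F] [NormedSpace ℂ F]

/-- `J` has the asymptotic expansion with coefficients `m` to order `k` as `s → 0+`. -/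
def IsExp (J : ℝ → F) (m : ℕ → F) (k : ℕ) : Prop :=
  ∃ C : ℝ, ∀ s ∈ Set.Ioc (0 : ℝ) 1,
    ‖J s - ∑ j ∈ Finset.range k, (s : ℂ) ^ j • m j‖ ≤ C * s ^ k

lemma isExp_of_long {J : ℝ → F} {m : ℕ → F} {k D : ℕ} (hD : k ≤ D) (C : ℝ)
    (h : ∀ s ∈ Set.Ioc (0 : ℝ) 1,
      ‖J s - ∑ j ∈ Finset.range D, (s : ℂ) ^ j • m j‖ ≤ C * s ^ k) : IsExp J m k := by
  refine ⟨C + ∑ j ∈ Finset.Ico k D, ‖m j‖, fun s hs => ?_⟩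
  have h1 := Finset.sum_range_add_sum_Ico (fun j => (s : ℂ) ^ j • m j) hD
  have h2 : J s - ∑ j ∈ Finset.range k, (s : ℂ) ^ j • m j =
      (J s - ∑ j ∈ Finset.range D, (s : ℂ) ^ j • m j) + ∑ j ∈ Finset.Ico k D, (s : ℂ) ^ j • m j := by
    rw [← h1]; abel
  rw [h2, add_mul, Finset.sum_mul]
  refine (norm_add_le _ _).trans (add_le_add (h s hs) ((norm_sum_le _ _).trans ?_))
  refine Finset.sum_le_sum fun j hj => ?_
  rw [norm_smul, norm_pow, Complex.norm_of_nonneg hs.1.le, mul_comm]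
  exact mul_le_mul_of_nonneg_left (pow_le_pow_of_le_one hs.1.le hs.2 (Finset.mem_Ico.1 hj).1)
    (norm_nonneg _)

lemma IsExp.mono {J : ℝ → F} {m : ℕ → F} {k l : ℕ} (h : IsExp J m k) (hl : l ≤ k) :
    IsExp J m l := by
  obtain ⟨C, hC⟩ := h
  have hC0 : 0 ≤ C := by
    have := (norm_nonneg _).trans (hC 1 ⟨one_pos, le_rfl⟩)
    simpa using this
  refine isExp_of_long hl C fun s hs => (hC s hs).trans ?_
  exact mul_le_mul_of_nonneg_left (pow_le_pow_of_le_one hs.1.le hs.2 hl) hC0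

lemma exists_isExp_of_len {J : ℝ → F} (k D : ℕ) (m : ℕ → F) (C : ℝ)
    (h : ∀ s ∈ Set.Ioc (0 : ℝ) 1,
      ‖J s - ∑ j ∈ Finset.range D, (s : ℂ) ^ j • m j‖ ≤ C * s ^ k) : ∃ m', IsExp J m' k := by
  refine ⟨fun j => if j < D then m j else 0,
    isExp_of_long (D := max k D) (le_max_left _ _) C fun s hs => ?_⟩
  have : ∑ j ∈ Finset.range (max k D), (s : ℂ) ^ j • (if j < D then m j else 0) =
      ∑ j ∈ Finset.range D, (s : ℂ) ^ j • m j := by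
    rw [← Finset.sum_subset (Finset.range_mono (le_max_right k D))]
    · exact Finset.sum_congr rfl fun j hj => by rw [if_pos (Finset.mem_range.1 hj)]
    · intro j _ hj
      rw [Finset.mem_range] at hj
      rw [if_neg hj, smul_zero]
  rw [this]
  exact h s hs

lemma poly_zero (k : ℕ) : ∀ (d : ℕ → F) (C : ℝ), (∀ s ∈ Set.Ioc (0 : ℝ) 1,
      ‖∑ j ∈ Finset.range k, (s : ℂ) ^ j • d j‖ ≤ C * s ^ k) → ∀ j < k, d j = 0 := by
  induction k with
  | zero => intro d C _ j hj; omega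
  | succ k ih =>
    intro d C h
    have hd0 : d 0 = 0 := by
      have hc : Continuous (fun s : ℝ => ‖∑ j ∈ Finset.range (k+1), (s : ℂ) ^ j • d j‖) := by
        fun_prop
      have t1 : Filter.Tendsto (fun s : ℝ => ‖∑ j ∈ Finset.range (k+1), (s : ℂ) ^ j • d j‖)
          (𝓝[>] 0) (𝓝 ‖d 0‖) := by
        have := (hc.tendsto 0).mono_left (nhdsWithin_le_nhds (s := Set.Ioi 0))
        simpa [Finset.sum_range_succ'] using this
      have t2 : Filter.Tendsto (fun s : ℝ => C * s ^ (k+1)) (𝓝[>] 0) (𝓝 0) := by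
        have hc2 : Continuous (fun s : ℝ => C * s ^ (k+1)) := by fun_prop
        have := (hc2.tendsto 0).mono_left (nhdsWithin_le_nhds (s := Set.Ioi 0))
        simpa using this
      have := le_of_tendsto_of_tendsto t1 t2 (by
        filter_upwards [Ioc_mem_nhdsGT (zero_lt_one' ℝ)] with s hs using h s hs)
      exact norm_le_zero_iff.1 this
    have hs := ih (fun j => d (j+1)) C (by
      intro s hs
      have h1 := h s hs
      rw [Finset.sum_range_succ', hd0, smul_zero, add_zero] at h1
      simp only [pow_succ', mul_smul, ← Finset.smul_sum] at h1
      rw [norm_smul, Complex.norm_of_nonneg hs.1.le] at h1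
      have hs0 := hs.1
      refine le_of_mul_le_mul_left (h1.trans (le_of_eq ?_)) hs0
      ring)
    intro j hj
    cases j with
    | zero => exact hd0
    | succ j => exact hs j (by omega)

lemma IsExp.unique {J : ℝ → F} {m m' : ℕ → F} {k : ℕ} (h : IsExp J m k) (h' : IsExp J m' k) :
    ∀ j < k, m j = m' j := by
  obtain ⟨C, hC⟩ := h
  obtain ⟨C', hC'⟩ := h'
  have := poly_zero k (fun j => m j - m' j) (C + C') (fun s hs => by
    have e : ∑ j ∈ Finset.range k, (s : ℂ) ^ j • (m j - m' j) =
        (J s - ∑ j ∈ Finset.range k, (s : ℂ) ^ j • m' j) -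
        (J s - ∑ j ∈ Finset.range k, (s : ℂ) ^ j • m j) := by
      simp only [smul_sub, Finset.sum_sub_distrib]; abel
    rw [e]
    refine (norm_sub_le _ _).trans ?_
    have := hC s hs
    have := hC' s hs
    linarith)
  exact fun j hj => sub_eq_zero.1 (this j hj)

lemma exists_all_isExp {J : ℝ → F} (h : ∀ k, ∃ m, IsExp J m k) : ∃ m, ∀ k, IsExp J m k := by
  choose m hm using h
  refine ⟨fun j => m (j+1) j, fun k => ?_⟩
  obtain ⟨C, hC⟩ := hm k
  refine ⟨C, fun s hs => ?_⟩
  have : ∑ j ∈ Finset.range k, (s : ℂ) ^ j • m (j+1) j =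
      ∑ j ∈ Finset.range k, (s : ℂ) ^ j • m k j := by
    refine Finset.sum_congr rfl fun j hj => ?_
    rw [(hm (j+1)).unique ((hm k).mono (Finset.mem_range.1 hj)) j (Nat.lt_succ_self j)]
  rw [this]
  exact hC s hs

/-- solutions of approximate first order linear ODEs have expansions -/
lemma ode_exp {φ φ' : ℝ → ℂ} (hd : ∀ s ∈ Set.Ioc (0 : ℝ) 1, HasDerivAt φ (φ' s) s) (k : ℕ)
    (R : ℝ → ℂ) (hR : ContDiff ℝ ∞ R) (C : ℝ)
    (h : ∀ s ∈ Set.Ioc (0 : ℝ) 1, ‖φ' s - deriv R s * φ s‖ ≤ C * s ^ k) :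
    ∃ m, IsExp φ m k := by
  have hRc := hR.continuous
  have hC0 : 0 ≤ C := by
    have := (norm_nonneg _).trans (h 1 ⟨one_pos, le_rfl⟩)
    simpa using this
  obtain ⟨B, hB⟩ := isCompact_Icc.exists_bound_of_continuousOn (s := Set.Icc (0:ℝ) 1)
    (f := fun s => Complex.exp (-R s)) (by fun_prop)
  obtain ⟨B', hB'⟩ := isCompact_Icc.exists_bound_of_continuousOn (s := Set.Icc (0:ℝ) 1)
    (f := fun s => Complex.exp (R s)) (by fun_prop)
  have hB0 : 0 ≤ B := (norm_nonneg _).trans (hB 0 (by simp))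
  have hB0' : 0 ≤ B' := (norm_nonneg _).trans (hB' 0 (by simp))
  let ψ : ℝ → ℂ := fun s => φ s * Complex.exp (-R s)
  have hψ : ∀ s ∈ Set.Ioc (0:ℝ) 1, HasDerivAt ψ ((φ' s - deriv R s * φ s) * Complex.exp (-R s)) s := by
    intro s hs
    have h1 : HasDerivAt R (deriv R s) s := (hR.differentiable (by simp) s).hasDerivAt
    have h2 := (hd s hs).mul h1.neg.cexp
    refine h2.congr_deriv ?_
    simp only [Pi.neg_apply]
    ring
  have hlip : ∀ s ∈ Set.Ioc (0:ℝ) 1, ∀ t ∈ Set.Ioc (0:ℝ) s, ‖ψ s - ψ t‖ ≤ C * B * s ^ (k + 1) := by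
    intro s hs t ht
    have := Convex.norm_image_sub_le_of_norm_hasDerivWithin_le (f := ψ) (s := Set.Icc t s)
      (C := C * s ^ k * B) (x := t) (y := s)
      (fun x hx => (hψ x ⟨ht.1.trans_le hx.1, hx.2.trans hs.2⟩).hasDerivWithinAt)
      (fun x hx => by
        have hx0 : 0 < x := ht.1.trans_le hx.1
        rw [norm_mul]
        refine mul_le_mul ((h x ⟨hx0, hx.2.trans hs.2⟩).trans ?_) (hB x ⟨hx0.le, hx.2.trans hs.2⟩)
          (norm_nonneg _) (mul_nonneg hC0 (pow_nonneg hs.1.le _))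
        exact mul_le_mul_of_nonneg_left (pow_le_pow_left₀ hx0.le hx.2 k) hC0)
      (convex_Icc t s) ⟨le_rfl, ht.2⟩ ⟨ht.2, le_rfl⟩
    refine this.trans ?_
    rw [Real.norm_of_nonneg (sub_nonneg.2 ht.2), pow_succ]
    have h1 : 0 ≤ C * s ^ k * B := mul_nonneg (mul_nonneg hC0 (pow_nonneg hs.1.le _)) hB0
    have h2 : s - t ≤ s := by linarith [ht.1]
    calc _ ≤ C * s ^ k * B * s := mul_le_mul_of_nonneg_left h2 h1
      _ = _ := by ring
  have hpos : ∀ N : ℕ, 1 / ((N : ℝ) + 1) ∈ Set.Ioc (0:ℝ) 1 := fun N =>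
    ⟨Nat.one_div_pos_of_nat, by
      rw [div_le_one (by positivity)]; linarith [Nat.cast_nonneg (α := ℝ) N]⟩
  have hcau : CauchySeq (fun N : ℕ => ψ (1 / ((N : ℝ) + 1))) := by
    refine cauchySeq_of_le_tendsto_0' (fun N : ℕ => C * B * (1 / ((N : ℝ) + 1)) ^ (k + 1)) ?_ ?_
    · intro N M hNM
      rw [dist_eq_norm]
      exact hlip _ (hpos N) _ ⟨(hpos M).1, Nat.one_div_le_one_div hNM⟩
    · have := ((tendsto_one_div_add_atTop_nhds_zero_nat (𝕜 := ℝ)).pow (k+1)).const_mul (C * B)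
      simpa using this
  obtain ⟨c, hc⟩ := cauchySeq_tendsto_of_complete hcau
  have hψc : ∀ s ∈ Set.Ioc (0:ℝ) 1, ‖ψ s - c‖ ≤ C * B * s ^ (k + 1) := by
    intro s hs
    refine le_of_tendsto ((tendsto_const_nhds.sub hc).norm) ?_
    have := (tendsto_one_div_add_atTop_nhds_zero_nat (𝕜 := ℝ)).eventually (Iio_mem_nhds hs.1)
    filter_upwards [this] with N hN
    exact hlip s hs _ ⟨(hpos N).1, hN.le⟩
  have hexp : ContDiff ℝ ∞ (fun s => c * Complex.exp (R s)) := contDiff_const.mul hR.cexp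
  obtain ⟨C₂, hC₂⟩ := exists_taylor_mean_remainder_bound (f := fun s => c * Complex.exp (R s))
    (a := 0) (b := 1) (n := k) zero_le_one (hexp.contDiffOn.of_le (by exact_mod_cast le_top))
  refine exists_isExp_of_len k (k+1) (fun j => (((j.factorial : ℝ)⁻¹ : ℝ) : ℂ) *
    iteratedDerivWithin j (fun s => c * Complex.exp (R s)) (Set.Icc 0 1) 0)
    (C * B * B' + |C₂|) (fun s hs => ?_)
  have ht := hC₂ s ⟨hs.1.le, hs.2⟩
  rw [taylor_within_apply] at ht
  have hsum : ∑ j ∈ Finset.range (k+1), (s : ℂ) ^ j • ((((j.factorial : ℝ)⁻¹ : ℝ) : ℂ) *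
      iteratedDerivWithin j (fun s => c * Complex.exp (R s)) (Set.Icc 0 1) 0) =
      ∑ j ∈ Finset.range (k+1), (((j.factorial : ℝ))⁻¹ * (s - 0) ^ j) •
      iteratedDerivWithin j (fun s => c * Complex.exp (R s)) (Set.Icc 0 1) 0 := by
    refine Finset.sum_congr rfl fun j _ => ?_
    rw [Complex.real_smul, smul_eq_mul, sub_zero]
    push_cast
    ring
  rw [hsum]
  have hsp : s ^ (k+1) ≤ s ^ k := pow_le_pow_of_le_one hs.1.le hs.2 (Nat.le_succ k)
  have hφ : φ s - c * Complex.exp (R s) = (ψ s - c) * Complex.exp (R s) := by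
    simp only [ψ]
    rw [sub_mul, mul_assoc, ← Complex.exp_add]; simp
  have e1 : ‖φ s - c * Complex.exp (R s)‖ ≤ C * B * B' * s ^ k := by
    rw [hφ, norm_mul]
    calc _ ≤ (C * B * s ^ (k+1)) * B' := mul_le_mul (hψc s hs) (hB' s ⟨hs.1.le, hs.2⟩)
            (norm_nonneg _) (mul_nonneg (mul_nonneg hC0 hB0) (pow_nonneg hs.1.le _))
      _ = C * B * B' * s ^ (k+1) := by ring
      _ ≤ _ := mul_le_mul_of_nonneg_left hsp (by positivity)
  have e2 : C₂ * (s - 0) ^ (k+1) ≤ |C₂| * s ^ k := by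
    rw [sub_zero]
    exact mul_le_mul (le_abs_self _) hsp (pow_nonneg hs.1.le _) (abs_nonneg _)
  rw [add_mul]
  refine le_trans ?_ (add_le_add e1 (ht.trans e2))
  refine le_trans (le_of_eq ?_) (norm_add_le _ _)
  congr 1
  ring

end Expansions
end SPH

namespace SPH
open scoped ContDiff Topology

section Scalar
variable {n : ℕ} {f : EuclideanSpace ℝ (Fin n) → ℝ} {K : Set (EuclideanSpace ℝ (Fin n))}
  {x₀ : EuclideanSpace ℝ (Fin n)}

lemma osc_hasDerivAt (hf : Continuous f) (hK : IsCompact K) {g : EuclideanSpace ℝ (Fin n) → ℂ}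
    (hg : Continuous g) (hgs : tsupport g ⊆ K) (r : ℝ) :
    HasDerivAt (osc f g) (Complex.I * osc f (fun x => (f x : ℂ) * g x) r) r := by
  have hfg : Continuous (fun x => (f x : ℂ) * g x) := by fun_prop
  have hfgs : tsupport (fun x => (f x : ℂ) * g x) ⊆ K :=
    (tsupport_mul_subset_right (f := fun x => (f x : ℂ)) (g := g)).trans hgs
  have hI := osc_integrable (f := f) hf hK hfg hfgs
  have h0 : Integrable (fun x => (f x : ℂ) * g x) :=
    hfg.integrable_of_hasCompactSupport (hcs_of_tsupp hK hfgs)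
  have := (hasDerivAt_integral_of_dominated_loc_of_deriv_le (μ := volume)
    (F := fun (r : ℝ) x => Complex.exp (Complex.I * r * f x) • g x)
    (F' := fun (r : ℝ) x => Complex.I * (Complex.exp (Complex.I * r * f x) • ((f x : ℂ) * g x)))
    (x₀ := r) (s := Set.univ) (bound := fun x => ‖(f x : ℂ) * g x‖) Filter.univ_mem
    (Filter.Eventually.of_forall fun s =>
      (osc_integrable hf hK hg hgs s).aestronglyMeasurable)
    (osc_integrable hf hK hg hgs r)
    ((hI r).const_mul _).aestronglyMeasurable
    (Filter.Eventually.of_forall fun x s _ => by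
      rw [norm_mul, norm_smul, norm_exp_osc, Complex.norm_I, one_mul, one_mul])
    h0.norm
    (Filter.Eventually.of_forall fun x s _ => by
      have h1 : HasDerivAt (fun s : ℝ => Complex.I * (s : ℂ) * f x) (Complex.I * 1 * f x) s :=
        ((Complex.ofRealCLM.hasDerivAt (x := s)).const_mul Complex.I).mul_const _
      refine (h1.cexp.smul_const (g x)).congr_deriv ?_
      simp only [smul_eq_mul]; ring)).2
  unfold osc
  rwa [integral_const_mul] at this

/-- the ODE for the scalar oscillatory integral -/
lemma scalar_ode (hP : Phase n f x₀ K) (hf0 : f x₀ = 0) {γ : EuclideanSpace ℝ (Fin n) → ℝ}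
    (hγ : ContDiff ℝ ∞ γ) (hγs : tsupport γ ⊆ K) (hγ1 : ∀ᶠ x in 𝓝 x₀, γ x = 1) (N : ℕ) :
    ∃ c : ℕ → ℂ, c 0 = Complex.I * (n / 2) ∧ ∃ C : ℝ, 0 ≤ C ∧ ∀ r : ℝ, 0 < r →
      ‖osc f (fun x => (f x : ℂ) * (γ x : ℂ)) r - (r : ℂ)⁻¹ * (osc f (fun x => (γ x : ℂ)) r *
        ∑ j ∈ Finset.range N, ((r : ℂ)⁻¹ ^ j) * c j)‖ ≤ C * r⁻¹ ^ (N + 1) := by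
  obtain ⟨a, ha, has, hax⟩ := division hP (fun x => f x * γ x) (hP.smooth.mul hγ)
    ((tsupport_mul_subset_right (f := f) (g := γ)).trans hγs) (by simp [hf0])
  have hhalf := div_half hP ha (by
    filter_upwards [hγ1] with x hx
    have := hax x
    simpa [hx] using this)
  let b : Fin n → EuclideanSpace ℝ (Fin n) → ℂ := fun j x => (a j x : ℂ)
  have hb : ∀ j, ContDiff ℝ ∞ (b j) := fun j => Complex.ofRealCLM.contDiff.comp (ha j)
  have hcts : ∀ (w : EuclideanSpace ℝ (Fin n) → ℝ), tsupport w ⊆ K →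
      tsupport (fun x => (w x : ℂ)) ⊆ K := fun w hw =>
    (tsupport_comp_subset (g := fun t : ℝ => (t : ℂ)) (by simp) w).trans hw
  have hbs : ∀ j, tsupport (b j) ⊆ K := fun j => hcts _ (has j)
  have hdb : ∀ j, fderiv ℝ (b j) x₀ (bv j) = (fderiv ℝ (a j) x₀ (bv j) : ℝ) := by
    intro j
    have h1 : HasFDerivAt (b j) (Complex.ofRealCLM.comp (fderiv ℝ (a j) x₀)) x₀ :=
      Complex.ofRealCLM.hasFDerivAt.comp x₀ ((ha j).differentiable (by simp) x₀).hasFDerivAt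
    rw [h1.fderiv]; simp
  have hγc : ContDiff ℝ ∞ (fun x => (γ x : ℂ)) := Complex.ofRealCLM.contDiff.comp hγ
  obtain ⟨c, hc0, C, hC, h⟩ := osc_iter hP (fun x => (γ x : ℂ)) hγc (hcts _ hγs)
    (by simp [hγ1.self_of_nhds]) N (divI b) (divI_contDiff hb) (divI_tsupport hP.cpt.isClosed hbs)
  refine ⟨c, ?_, C, hC, fun r hr => ?_⟩
  · rw [hc0]
    simp only [divI, hdb, smul_eq_mul]
    rw [← Complex.ofReal_sum, hhalf]
    push_cast; rfl
  · rw [ibp hP.smooth hP.cpt hb hbs (fun x => (f x : ℂ) * (γ x : ℂ)) (fun x => by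
      rw [← Complex.ofReal_mul, hax x]; simp [b]) r hr.ne', smul_eq_mul, ← mul_sub, norm_mul,
      norm_inv, Complex.norm_of_nonneg hr.le, pow_succ']
    have := h r hr
    simp only [smul_eq_mul] at this
    have hr' : 0 ≤ r⁻¹ := by positivity
    nlinarith [mul_le_mul_of_nonneg_left this hr']

/-- the normalised oscillatory integral in the variable `s = 1/r` -/
noncomputable def nosc {F : Type} [NormedAddCommGroup F] [NormedSpace ℝ F] [NormedSpace ℂ F]
    (f : EuclideanSpace ℝ (Fin n) → ℝ) (u : EuclideanSpace ℝ (Fin n) → F) (s : ℝ) : F :=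
  ((s ^ (-(n : ℝ) / 2) : ℝ) : ℂ) • osc f u s⁻¹

lemma rpow_bound {s : ℝ} (hs : s ∈ Set.Ioc (0:ℝ) 1) : s ^ (-(n : ℝ) / 2) * s ^ n ≤ 1 := by
  rw [← Real.rpow_natCast, ← Real.rpow_add hs.1]
  apply Real.rpow_le_one hs.1.le hs.2
  have : (0:ℝ) ≤ n := Nat.cast_nonneg n
  linarith

lemma scalar_exp (hP : Phase n f x₀ K) (hf0 : f x₀ = 0) {γ : EuclideanSpace ℝ (Fin n) → ℝ}
    (hγ : ContDiff ℝ ∞ γ) (hγs : tsupport γ ⊆ K) (hγ1 : ∀ᶠ x in 𝓝 x₀, γ x = 1) (k : ℕ) :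
    ∃ m, IsExp (nosc f (fun x => (γ x : ℂ))) m k := by
  obtain ⟨c, hc0, C, hC, h⟩ := scalar_ode hP hf0 hγ hγs hγ1 (k + n + 1)
  have hγc : ContDiff ℝ ∞ (fun x => (γ x : ℂ)) := Complex.ofRealCLM.contDiff.comp hγ
  have hγcs : tsupport (fun x => (γ x : ℂ)) ⊆ K :=
    (tsupport_comp_subset (g := fun t : ℝ => (t : ℂ)) (by simp) γ).trans hγs
  let G := osc f (fun x => (γ x : ℂ))
  let H := osc f (fun x => (f x : ℂ) * (γ x : ℂ))
  let R : ℝ → ℂ := fun s => ∑ j ∈ Finset.range (k + n), (-Complex.I * c (j+1) / (j + 1)) * (s : ℂ) ^ (j + 1)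
  have hR : ContDiff ℝ ∞ R := by
    apply ContDiff.sum
    intro j _
    exact contDiff_const.mul (Complex.ofRealCLM.contDiff.pow _)
  have hRd : ∀ s, deriv R s = ∑ j ∈ Finset.range (k + n), (-Complex.I * c (j+1)) * (s : ℂ) ^ j := by
    intro s
    have : HasDerivAt R (∑ j ∈ Finset.range (k + n), (-Complex.I * c (j+1)) * (s : ℂ) ^ j) s := by
      apply HasDerivAt.fun_sum
      intro j _
      have := ((Complex.ofRealCLM.hasDerivAt (x := s)).pow (j+1)).const_mul
        (-Complex.I * c (j+1) / (j + 1))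
      refine this.congr_deriv ?_
      have hj : (j : ℂ) + 1 ≠ 0 := Nat.cast_add_one_ne_zero j
      simp
      field_simp
    exact this.deriv
  refine ode_exp (φ' := fun s => (((-(n:ℝ)/2) * s ^ (-(n : ℝ) / 2 - 1) : ℝ) : ℂ) * G s⁻¹ +
    ((s ^ (-(n : ℝ) / 2) : ℝ) : ℂ) * (-((s^2)⁻¹ : ℝ) * (Complex.I * H s⁻¹))) ?_ k R hR C ?_
  · intro s hs
    have h1 : HasDerivAt (fun s : ℝ => s ^ (-(n : ℝ) / 2)) ((-(n:ℝ)/2) * s ^ (-(n : ℝ) / 2 - 1)) s :=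
      Real.hasDerivAt_rpow_const (Or.inl hs.1.ne')
    have h2 := (osc_hasDerivAt hP.smooth.continuous hP.cpt hγc.continuous hγcs s⁻¹).scomp s
      (hasDerivAt_inv hs.1.ne')
    refine (h1.ofReal_comp.mul h2).congr_deriv ?_
    simp [G, H]
  · intro s hs
    have hs0 : (s : ℂ) ≠ 0 := by exact_mod_cast hs.1.ne'
    have h1 := h s⁻¹ (inv_pos.2 hs.1)
    rw [Finset.sum_range_succ', hc0] at h1
    simp only [Complex.ofReal_inv, inv_inv] at h1
    rw [Real.rpow_sub_one hs.1.ne', hRd]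
    set w := s ^ (-(n : ℝ) / 2) with hw
    have hw0 : 0 ≤ w := Real.rpow_nonneg hs.1.le _
    have hwn : w * s ^ n ≤ 1 := rpow_bound hs
    change ‖H s⁻¹ - s * (G s⁻¹ * _)‖ ≤ _ at h1
    have e : (((-(n:ℝ)/2) * (w / s) : ℝ) : ℂ) * G s⁻¹ + (w : ℂ) * (-((s^2)⁻¹ : ℝ) *
        (Complex.I * H s⁻¹)) - (∑ j ∈ Finset.range (k + n), (-Complex.I * c (j+1)) * (s : ℂ) ^ j) *
        nosc f (fun x => (γ x : ℂ)) s = (-Complex.I * w * ((s:ℂ)^2)⁻¹) * (H s⁻¹ - s * (G s⁻¹ *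
          (∑ j ∈ Finset.range (k + n), (s : ℂ) ^ (j + 1) * c (j + 1) +
            (s : ℂ) ^ 0 * (Complex.I * (n / 2))))) := by
      have e1 : ∑ j ∈ Finset.range (k + n), (s : ℂ) ^ (j + 1) * c (j + 1) =
          s * ∑ j ∈ Finset.range (k + n), c (j + 1) * (s : ℂ) ^ j := by
        rw [Finset.mul_sum]
        exact Finset.sum_congr rfl fun j _ => by ring
      have e2 : ∑ j ∈ Finset.range (k + n), (-Complex.I * c (j+1)) * (s : ℂ) ^ j =
          -Complex.I * ∑ j ∈ Finset.range (k + n), c (j + 1) * (s : ℂ) ^ j := by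
        rw [Finset.mul_sum]
        exact Finset.sum_congr rfl fun j _ => by ring
      rw [e1, e2]
      change _ - _ * ((w : ℂ) * G s⁻¹) = _
      push_cast
      field_simp
      ring_nf
      rw [Complex.I_sq]
      ring
    rw [e, norm_mul]
    have hn : ‖-Complex.I * (w : ℂ) * ((s:ℂ)^2)⁻¹‖ = w * (s^2)⁻¹ := by
      simp [abs_of_nonneg hw0]
    rw [hn]
    have hs' := hs.1
    calc w * (s^2)⁻¹ * _ ≤ w * (s^2)⁻¹ * (C * s ^ (k + n + 1 + 1)) :=
          mul_le_mul_of_nonneg_left h1 (by positivity)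
      _ = (w * s ^ n) * (C * s ^ k) := by field_simp; ring
      _ ≤ 1 * (C * s ^ k) := mul_le_mul_of_nonneg_right hwn (by positivity)
      _ = _ := one_mul _

end Scalar
end SPH

namespace SPH
open scoped ContDiff Topology

section Vec
variable {F : Type} [NormedAddCommGroup F] [NormedSpace ℂ F]

lemma hasExp_add {J J' : ℝ → F} {k : ℕ} (h : ∃ m, IsExp J m k) (h' : ∃ m, IsExp J' m k) :
    ∃ m, IsExp (fun s => J s + J' s) m k := by
  obtain ⟨m, C, hC⟩ := h
  obtain ⟨m', C', hC'⟩ := h'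
  refine ⟨fun j => m j + m' j, C + C', fun s hs => ?_⟩
  have e : J s + J' s - ∑ j ∈ Finset.range k, (s : ℂ) ^ j • (m j + m' j) =
      (J s - ∑ j ∈ Finset.range k, (s : ℂ) ^ j • m j) +
      (J' s - ∑ j ∈ Finset.range k, (s : ℂ) ^ j • m' j) := by
    simp only [smul_add, Finset.sum_add_distrib]; abel
  rw [e, add_mul]
  exact (norm_add_le _ _).trans (add_le_add (hC s hs) (hC' s hs))

lemma hasExp_small {J : ℝ → F} {k : ℕ} (C : ℝ) (h : ∀ s ∈ Set.Ioc (0:ℝ) 1, ‖J s‖ ≤ C * s ^ k) :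
    ∃ m, IsExp J m k := ⟨fun _ => 0, C, fun s hs => by simpa using h s hs⟩

lemma hasExp_monomial (k d : ℕ) (v : F) : ∃ m, IsExp (fun s => (s : ℂ) ^ d • v) m k := by
  refine exists_isExp_of_len k (d + 1) (fun j => if j = d then v else 0) 0 fun s hs => ?_
  rw [Finset.sum_eq_single d]
  · simp
  · intro j _ hj; simp [hj]
  · simp

lemma hasExp_sum {ι : Type} (t : Finset ι) {J : ι → ℝ → F} {k : ℕ} (h : ∀ i, ∃ m, IsExp (J i) m k) :
    ∃ m, IsExp (fun s => ∑ i ∈ t, J i s) m k := by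
  classical
  induction t using Finset.induction_on with
  | empty => exact hasExp_small 0 fun s _ => by simp
  | insert i t hi ih =>
    simp only [Finset.sum_insert hi]
    exact hasExp_add (h i) ih

variable [NormedSpace ℝ F] [IsScalarTower ℝ ℂ F] [CompleteSpace F]
variable {n : ℕ} {f : EuclideanSpace ℝ (Fin n) → ℝ} {K : Set (EuclideanSpace ℝ (Fin n))}
  {x₀ : EuclideanSpace ℝ (Fin n)}

lemma vec_exp (hP : Phase n f x₀ K) (hf0 : f x₀ = 0) {u : EuclideanSpace ℝ (Fin n) → F}
    (hu : ContDiff ℝ ∞ u) (hus : tsupport u ⊆ K) : ∃ m, ∀ k, IsExp (nosc f u) m k := by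
  obtain ⟨γ, hγs, hγc, hγ, -, hγ1⟩ : ∃ γ : EuclideanSpace ℝ (Fin n) → ℝ, tsupport γ ⊆ K ∧
      HasCompactSupport γ ∧ ContDiff ℝ ∞ γ ∧ True ∧ ∀ᶠ x in 𝓝 x₀, γ x = 1 := by
    obtain ⟨ε, hε, hεK⟩ := Metric.nhds_basis_closedBall.mem_iff.1 hP.nhd
    let b : ContDiffBump x₀ := ⟨ε / 2, ε, by positivity, by linarith⟩
    exact ⟨b, by rw [b.tsupport_eq]; exact hεK, b.hasCompactSupport, b.contDiff, trivial,
      b.eventuallyEq_one⟩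
  have hγcc : ContDiff ℝ ∞ (fun x => (γ x : ℂ)) := Complex.ofRealCLM.contDiff.comp hγ
  have hγcs : tsupport (fun x => (γ x : ℂ)) ⊆ K :=
    (tsupport_comp_subset (g := fun t : ℝ => (t : ℂ)) (by simp) γ).trans hγs
  apply exists_all_isExp
  intro k
  obtain ⟨m, C', hm⟩ := scalar_exp hP hf0 hγ hγs hγ1 k
  obtain ⟨c, -, C, hC, hc⟩ := osc_iter hP (fun x => (γ x : ℂ)) hγcc hγcs
    (by simp [hγ1.self_of_nhds]) (k + n) u hu hus
  set φ := nosc f (fun x => (γ x : ℂ)) with hφ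
  let P : ℝ → F := fun s => ∑ j ∈ Finset.range (k + n), (s : ℂ) ^ j • c j
  have hP1 : ∀ s ∈ Set.Ioc (0:ℝ) 1, ‖P s‖ ≤ ∑ j ∈ Finset.range (k + n), ‖c j‖ := by
    intro s hs
    refine (norm_sum_le _ _).trans (Finset.sum_le_sum fun j _ => ?_)
    rw [norm_smul, norm_pow, Complex.norm_of_nonneg hs.1.le]
    exact mul_le_of_le_one_left (norm_nonneg _) (pow_le_one₀ hs.1.le hs.2)
  have h1 : ∃ m, IsExp (fun s => nosc f u s - φ s • P s) m k := by
    refine hasExp_small C fun s hs => ?_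
    have h1 := hc s⁻¹ (inv_pos.2 hs.1)
    simp only [Complex.ofReal_inv, inv_inv] at h1
    have e : nosc f u s - φ s • P s = ((s ^ (-(n : ℝ) / 2) : ℝ) : ℂ) •
        (osc f u s⁻¹ - osc f (fun x => (γ x : ℂ)) s⁻¹ • P s) := by
      simp only [hφ, nosc, smul_sub, smul_assoc]
    have hw0 : 0 ≤ s ^ (-(n : ℝ) / 2) := Real.rpow_nonneg hs.1.le _
    have hwn : s ^ (-(n : ℝ) / 2) * s ^ n ≤ 1 := rpow_bound hs
    rw [e, norm_smul, Complex.norm_of_nonneg hw0]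
    have hs' := hs.1
    calc _ ≤ s ^ (-(n : ℝ) / 2) * (C * s ^ (k + n)) := mul_le_mul_of_nonneg_left h1 hw0
      _ = (s ^ (-(n : ℝ) / 2) * s ^ n) * (C * s ^ k) := by rw [pow_add]; ring
      _ ≤ 1 * (C * s ^ k) := mul_le_mul_of_nonneg_right hwn (by positivity)
      _ = _ := one_mul _
  have h2 : ∃ m', IsExp (fun s => (φ s - ∑ i ∈ Finset.range k, (s : ℂ) ^ i • m i) • P s) m' k := by
    refine hasExp_small (C' * ∑ j ∈ Finset.range (k + n), ‖c j‖) fun s hs => ?_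
    rw [norm_smul]
    calc _ ≤ (C' * s ^ k) * ∑ j ∈ Finset.range (k + n), ‖c j‖ :=
          mul_le_mul (hm s hs) (hP1 s hs) (norm_nonneg _) ((norm_nonneg _).trans (hm s hs))
      _ = _ := by ring
  have h3 : ∃ m', IsExp (fun s : ℝ => ∑ i ∈ Finset.range k, ∑ j ∈ Finset.range (k + n),
      (s : ℂ) ^ (i + j) • (m i • c j)) m' k :=
    hasExp_sum _ fun i => hasExp_sum _ fun j => hasExp_monomial k (i + j) _
  obtain ⟨m', hm'⟩ := hasExp_add h1 (hasExp_add h2 h3)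
  refine ⟨m', ?_⟩
  convert hm' using 1
  ext s
  have e : ∑ i ∈ Finset.range k, ∑ j ∈ Finset.range (k + n), (s : ℂ) ^ (i + j) • (m i • c j) =
      (∑ i ∈ Finset.range k, (s : ℂ) ^ i • m i) • P s := by
    simp only [P]
    rw [Finset.sum_smul]
    refine Finset.sum_congr rfl fun i _ => ?_
    rw [Finset.smul_sum]
    refine Finset.sum_congr rfl fun j _ => ?_
    rw [smul_smul, smul_smul, pow_add, smul_eq_mul]
    congr 1; ring
  rw [e, sub_smul]
  abel

end Vec
end SPH

namespace SPH
open scoped ContDiff Topology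

section Family
variable {n : ℕ} {f : EuclideanSpace ℝ (Fin n) → ℝ} {K : Set (EuclideanSpace ℝ (Fin n))}
  {x₀ : EuclideanSpace ℝ (Fin n)}

lemma osc_entire (hf : Continuous f) (hK : IsCompact K) (u : ℂ → EuclideanSpace ℝ (Fin n) → ℂ)
    (hus : ∀ z, tsupport (u z) ⊆ K) (huc : Continuous (fun p : ℂ × EuclideanSpace ℝ (Fin n) => u p.1 p.2))
    (huh : ∀ x, Differentiable ℂ (fun z => u z x)) (r : ℝ) :
    Differentiable ℂ (fun z => osc f (u z) r) := by
  intro z₀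
  have huz : ∀ z, Continuous (u z) := fun z => huc.comp (by fun_prop : Continuous fun x => (z, x))
  obtain ⟨B, hB⟩ := ((isCompact_closedBall z₀ 2).prod hK).exists_bound_of_continuousOn
    (f := fun p : ℂ × EuclideanSpace ℝ (Fin n) => u p.1 p.2) huc.continuousOn
  have hz0 : ∀ x ∉ K, ∀ z, u z x = 0 := fun x hx z =>
    image_eq_zero_of_notMem_tsupport fun h => hx (hus z h)
  have hmeas : Measurable (fun x => deriv (fun z => u z x) z₀) := by
    have h1 := measurable_deriv_with_param (𝕜 := ℂ) (f := fun (x : EuclideanSpace ℝ (Fin n)) z => u z x)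
      (huc.comp continuous_swap)
    exact h1.comp (by fun_prop : Measurable fun x : EuclideanSpace ℝ (Fin n) => (x, z₀))
  have hexp : Continuous (fun x => Complex.exp (Complex.I * r * f x)) := by fun_prop
  have := (hasDerivAt_integral_of_dominated_loc_of_deriv_le (μ := volume) (𝕜 := ℂ)
    (F := fun z x => Complex.exp (Complex.I * r * f x) • u z x)
    (F' := fun z x => Complex.exp (Complex.I * r * f x) • deriv (fun z => u z x) z)
    (x₀ := z₀) (s := Metric.ball z₀ 1) (bound := K.indicator fun _ => B)
    (Metric.ball_mem_nhds _ one_pos)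
    (Filter.Eventually.of_forall fun z =>
      (osc_integrable hf hK (huz z) (hus z) r).aestronglyMeasurable)
    (osc_integrable hf hK (huz z₀) (hus z₀) r)
    (hexp.measurable.smul hmeas).aestronglyMeasurable
    (Filter.Eventually.of_forall fun x z hz => by
      rw [norm_smul, norm_exp_osc, one_mul]
      by_cases hx : x ∈ K
      · rw [Set.indicator_of_mem hx]
        have := Complex.norm_deriv_le_of_forall_mem_sphere_norm_le (f := fun z => u z x) (c := z)
          (R := 1) (C := B) one_pos (huh x).diffContOnCl (fun w hw => hB (w, x) ⟨?_, hx⟩)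
        · simpa using this
        · rw [Metric.mem_closedBall]
          have h1 := dist_triangle w z z₀
          rw [Metric.mem_sphere.1 hw] at h1
          have h2 := Metric.mem_ball.1 hz
          simp only
          linarith
      · rw [Set.indicator_of_notMem hx]
        have : (fun z => u z x) = fun _ => 0 := funext fun z => hz0 x hx z
        rw [this]; simp)
    ((integrable_indicator_iff hK.measurableSet).2
      (integrableOn_const (hK.measure_lt_top.ne)))
    (Filter.Eventually.of_forall fun x z _ =>
      ((huh x z).hasDerivAt).const_smul (Complex.exp (Complex.I * r * f x)))).2
  exact this.differentiableAt

lemma family (hP : Phase n f x₀ K) (hf0 : f x₀ = 0) (u : ℂ → EuclideanSpace ℝ (Fin n) → ℂ)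
    (hu : ∀ z, ContDiff ℝ ∞ (u z)) (hus : ∀ z, tsupport (u z) ⊆ K)
    (huh : ∀ x, Differentiable ℂ (fun z => u z x))
    (hud : ∀ m : ℕ, Continuous (fun p : ℂ × EuclideanSpace ℝ (Fin n) =>
      iteratedFDeriv ℝ m (u p.1) p.2)) :
    ∃ M : ℕ → ℂ → ℂ, (∀ j, Differentiable ℂ (M j)) ∧ ∀ L : Set ℂ, IsCompact L → ∀ k : ℕ,
      ∃ C : ℝ, ∀ z ∈ L, ∀ s ∈ Set.Ioc (0:ℝ) 1,
        ‖nosc f (u z) s - ∑ j ∈ Finset.range k, (s : ℂ) ^ j * M j z‖ ≤ C * s ^ k := by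
  have huc : Continuous (fun p : ℂ × EuclideanSpace ℝ (Fin n) => u p.1 p.2) := by
    have h0 := hud 0
    have := (continuousMultilinearCurryFin0 ℝ (EuclideanSpace ℝ (Fin n)) ℂ).continuous.comp h0
    refine this.congr fun p => ?_
    simp
  have hpt : ∀ z, ∃ m : ℕ → ℂ, ∀ k, IsExp (nosc f (u z)) m k := fun z =>
    vec_exp hP hf0 (hu z) (hus z)
  choose m hm using hpt
  have hunif : ∀ L : Set ℂ, IsCompact L → ∀ k : ℕ,
      ∃ C : ℝ, ∀ z ∈ L, ∀ s ∈ Set.Ioc (0:ℝ) 1,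
        ‖nosc f (u z) s - ∑ j ∈ Finset.range k, (s : ℂ) ^ j * m z j‖ ≤ C * s ^ k := by
    intro L hL
    have : CompactSpace L := isCompact_iff_compactSpace.1 hL
    let W : EuclideanSpace ℝ (Fin n) → C(L, ℂ) := fun x =>
      ⟨fun z => u z x, huc.comp (by fun_prop : Continuous fun z : L => ((z : ℂ), x))⟩
    have hW : ContDiff ℝ ∞ W := by
      refine curry_contDiff (fun (z : L) x => u z x) (fun z => hu z) (fun i => ?_) W (fun x z => rfl)
      exact (hud i).comp (by fun_prop :
        Continuous fun p : L × EuclideanSpace ℝ (Fin n) => ((p.1 : ℂ), p.2))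
    have hWs : tsupport W ⊆ K := by
      refine closure_minimal ?_ hP.cpt.isClosed
      intro x hx
      by_contra hxK
      apply hx
      ext z
      exact image_eq_zero_of_notMem_tsupport (f := u z) fun h => hxK (hus z h)
    obtain ⟨μ, hμ⟩ := vec_exp hP hf0 hW hWs
    have hev : ∀ s (z : L), (nosc f W s) z = nosc f (u z) s := by
      intro s z
      have h1 := (ContinuousMap.evalCLM ℂ z : C(L, ℂ) →L[ℂ] ℂ).integral_comp_comm
        (osc_integrable hP.smooth.continuous hP.cpt hW.continuous hWs s⁻¹)
      simp only [nosc, ContinuousMap.coe_smul, Pi.smul_apply]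
      congr 1
      exact h1.symm
    have hdiff : ∀ k s (z : L), (nosc f W s - ∑ j ∈ Finset.range k, (s : ℂ) ^ j • μ j) z =
        nosc f (u z) s - ∑ j ∈ Finset.range k, (s : ℂ) ^ j • μ j z := by
      intro k s z
      rw [ContinuousMap.sub_apply, hev, ContinuousMap.sum_apply]
      simp
    have hexp : ∀ k (z : L), IsExp (nosc f (u z)) (fun j => μ j z) k := by
      intro k z
      obtain ⟨C, hC⟩ := hμ k
      refine ⟨C, fun s hs => ?_⟩
      rw [← hdiff]
      exact (ContinuousMap.norm_coe_le_norm _ z).trans (hC s hs)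
    have heq : ∀ j (z : L), μ j z = m z j := fun j z =>
      (hexp (j+1) z).unique (hm z (j+1)) j (Nat.lt_succ_self j)
    intro k
    obtain ⟨C, hC⟩ := hμ k
    refine ⟨C, fun z hz s hs => ?_⟩
    have h1 := (ContinuousMap.norm_coe_le_norm _ (⟨z, hz⟩ : L)).trans (hC s hs)
    rw [hdiff] at h1
    simpa only [heq, smul_eq_mul] using h1
  refine ⟨fun j z => m z j, ?_, hunif⟩
  intro j
  induction j using Nat.strong_induction_on with
  | _ j ih =>
    have hs : ∀ N : ℕ, 1 / ((N : ℝ) + 1) ∈ Set.Ioc (0:ℝ) 1 := fun N =>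
      ⟨Nat.one_div_pos_of_nat, by
        rw [div_le_one (by positivity)]; linarith [Nat.cast_nonneg (α := ℝ) N]⟩
    let A : ℕ → ℂ → ℂ := fun N z => ((((1 / ((N : ℝ) + 1)) : ℝ) : ℂ) ^ j)⁻¹ *
      (nosc f (u z) (1 / ((N : ℝ) + 1)) -
        ∑ i ∈ Finset.range j, (((1 / ((N : ℝ) + 1)) : ℝ) : ℂ) ^ i * m z i)
    have hA : ∀ N, Differentiable ℂ (A N) := by
      intro N
      refine Differentiable.const_mul (Differentiable.sub ?_ ?_) _
      · exact (osc_entire hP.smooth.continuous hP.cpt u hus huc huh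
          (1 / ((N : ℝ) + 1))⁻¹).fun_const_smul
          ((((1 / ((N : ℝ) + 1)) ^ (-(n : ℝ) / 2) : ℝ) : ℂ))
      · refine Differentiable.fun_sum fun i hi => ?_
        exact (ih i (Finset.mem_range.1 hi)).const_mul _
    have hlim : TendstoLocallyUniformlyOn A (fun z => m z j) Filter.atTop Set.univ := by
      rw [tendstoLocallyUniformlyOn_iff_forall_isCompact isOpen_univ]
      intro L _ hL
      obtain ⟨C, hC⟩ := hunif L hL (j+1)
      rw [Metric.tendstoUniformlyOn_iff]
      intro ε hε
      have ht : Filter.Tendsto (fun N : ℕ => C * (1 / ((N : ℝ) + 1))) Filter.atTop (𝓝 0) := by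
        simpa using (tendsto_one_div_add_atTop_nhds_zero_nat (𝕜 := ℝ)).const_mul C
      filter_upwards [ht.eventually (Iio_mem_nhds hε)] with N hN z hz
      refine lt_of_le_of_lt ?_ hN
      have h1 := hC z hz _ (hs N)
      set s := 1 / ((N : ℝ) + 1) with hsdef
      have hs0 : 0 < s := (hs N).1
      have hsc : (s : ℂ) ≠ 0 := by exact_mod_cast hs0.ne'
      rw [dist_comm, dist_eq_norm]
      have e : A N z - m z j = ((s : ℂ) ^ j)⁻¹ *
          (nosc f (u z) s - ∑ i ∈ Finset.range (j+1), (s : ℂ) ^ i * m z i) := by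
        simp only [A, Finset.sum_range_succ, ← hsdef]
        field_simp
        ring
      rw [e, norm_mul, norm_inv, norm_pow, Complex.norm_of_nonneg hs0.le]
      calc _ ≤ (s ^ j)⁻¹ * (C * s ^ (j+1)) := mul_le_mul_of_nonneg_left h1 (by positivity)
        _ = C * s := by field_simp; ring
    have := hlim.differentiableOn (Filter.Eventually.of_forall fun N => (hA N).differentiableOn) isOpen_univ
    exact differentiableOn_univ.1 this

end Family
end SPH

namespace SPH
open scoped ContDiff Topology Manifold

lemma globalize {n : ℕ} {U : Set (EuclideanSpace ℝ (Fin n))} (hU : IsOpen U)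
    {f : EuclideanSpace ℝ (Fin n) → ℝ} (hf : ContDiffOn ℝ ∞ f U)
    {K : Set (EuclideanSpace ℝ (Fin n))} (hK : IsCompact K) (hKU : K ⊆ U)
    {x₀ : EuclideanSpace ℝ (Fin n)} (hx₀U : x₀ ∈ U) (hcrit : fderiv ℝ f x₀ = 0)
    (huniq : ∀ x ∈ K, fderiv ℝ f x = 0 → x = x₀)
    (hnondeg : ∀ v : EuclideanSpace ℝ (Fin n),
      (∀ w : EuclideanSpace ℝ (Fin n), fderiv ℝ (fderiv ℝ f) x₀ v w = 0) → v = 0) :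
    ∃ (h : EuclideanSpace ℝ (Fin n) → ℝ) (K' : Set (EuclideanSpace ℝ (Fin n))),
      Phase n h x₀ K' ∧ h x₀ = 0 ∧ K ⊆ K' ∧ ∀ x ∈ K, f x = f x₀ + h x := by
  obtain ⟨K₁, hK₁, h01, hK₁U⟩ := exists_compact_between (hK.insert x₀) hU
    (Set.insert_subset hx₀U hKU)
  obtain ⟨K₂, hK₂, h12, hK₂U⟩ := exists_compact_between hK₁ hU hK₁U
  obtain ⟨χ, hχ, -, hχs, hχ1⟩ := exists_contMDiff_support_eq_eq_one_iff
    (n := (⊤ : ℕ∞)) 𝓘(ℝ, EuclideanSpace ℝ (Fin n)) isOpen_interior hK₁.isClosed h12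
  have hχ' : ContDiff ℝ ∞ χ := hχ.contDiff
  have hχt : tsupport χ ⊆ U := by
    refine (closure_minimal ?_ hK₂.isClosed).trans hK₂U
    rw [hχs]
    exact interior_subset
  have hsm : ContDiff ℝ ∞ (fun x => χ x * f x) := by
    apply contDiff_of_tsupp
    intro x hx
    have hxU : x ∈ U := hχt (tsupport_mul_subset_left hx)
    exact hχ'.contDiffAt.mul (hf.contDiffAt (hU.mem_nhds hxU))
  let h : EuclideanSpace ℝ (Fin n) → ℝ := fun x => χ x * f x - f x₀
  have hh : ContDiff ℝ ∞ h := hsm.sub contDiff_const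
  have heq : ∀ x ∈ interior K₁, h =ᶠ[𝓝 x] fun y => f y - f x₀ := by
    intro x hx
    filter_upwards [mem_interior_iff_mem_nhds.1 hx] with y hy
    simp only [h]
    rw [(hχ1 y).1 hy, one_mul]
  have hfd : ∀ x ∈ interior K₁, fderiv ℝ h x = fderiv ℝ f x := by
    intro x hx
    rw [(heq x hx).fderiv_eq, fderiv_sub_const]
  have hx₀1 : x₀ ∈ interior K₁ := h01 (Set.mem_insert _ _)
  have hfdd : fderiv ℝ (fderiv ℝ h) x₀ = fderiv ℝ (fderiv ℝ f) x₀ := by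
    apply Filter.EventuallyEq.fderiv_eq
    filter_upwards [isOpen_interior.mem_nhds hx₀1] with x hx using hfd x hx
  have hc : fderiv ℝ h x₀ = 0 := by rw [hfd _ hx₀1, hcrit]
  have hnd : ∀ v : EuclideanSpace ℝ (Fin n),
      (∀ w : EuclideanSpace ℝ (Fin n), fderiv ℝ (fderiv ℝ h) x₀ v w = 0) → v = 0 := by
    rw [hfdd]; exact hnondeg
  obtain ⟨V, hV, hVu⟩ := isolated_crit hh hc hnd
  obtain ⟨ε, hε, hεV⟩ := Metric.nhds_basis_closedBall.mem_iff.1 hV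
  refine ⟨h, K ∪ Metric.closedBall x₀ ε, ⟨hh, hK.union (isCompact_closedBall _ _), ?_, hc, ?_, hnd⟩,
    ?_, Set.subset_union_left, ?_⟩
  · exact Filter.mem_of_superset (Metric.closedBall_mem_nhds x₀ hε) Set.subset_union_right
  · rintro x (hx | hx) h0
    · exact huniq x hx (by rw [← hfd x (h01 (Set.mem_insert_of_mem _ hx)), h0])
    · exact hVu x (hεV hx) h0
  · rw [(heq x₀ hx₀1).eq_of_nhds, sub_self]
  · intro x hx
    rw [(heq x (h01 (Set.mem_insert_of_mem _ hx))).eq_of_nhds]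
    ring

lemma cpow_eq (n j : ℕ) {r : ℝ} (hr : 0 < r) : (r : ℂ) ^ (-(n:ℂ)/2 - j) =
    (((r⁻¹ ^ (-(n : ℝ) / 2) : ℝ) : ℂ))⁻¹ * ((r⁻¹ : ℝ) : ℂ) ^ j := by
  have e : -(n:ℂ)/2 - j = ((-(n:ℝ)/2 - j : ℝ) : ℂ) := by push_cast; rfl
  rw [e, ← Complex.ofReal_cpow hr.le, ← Complex.ofReal_inv, ← Complex.ofReal_pow,
    ← Complex.ofReal_mul]
  congr 1
  rw [Real.rpow_sub hr, Real.inv_rpow hr.le, inv_inv, Real.rpow_natCast, inv_pow]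
  rfl

end SPH

/-- Stationary phase principle for a holomorphic family of amplitudes: the
coefficients of the asymptotic expansion are entire functions of the parameter
`z`, and the remainder estimates are uniform for `z` in compact sets. -/
theorem stationary_phase_holomorphic_family
    (n : ℕ) (U : Set (EuclideanSpace ℝ (Fin n))) (hU : IsOpen U)
    (f : EuclideanSpace ℝ (Fin n) → ℝ) (hf : ContDiffOn ℝ (⊤ : ℕ∞) f U)
    (K : Set (EuclideanSpace ℝ (Fin n))) (hK : IsCompact K) (hKU : K ⊆ U)
    (u : ℂ × EuclideanSpace ℝ (Fin n) → ℂ)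
    (husmooth : ∀ z : ℂ, ContDiff ℝ (⊤ : ℕ∞) (fun x => u (z, x)))
    (husupp : ∀ z : ℂ, tsupport (fun x => u (z, x)) ⊆ K)
    (huholo : ∀ x, Differentiable ℂ (fun z => u (z, x)))
    (huderiv_cont : ∀ m : ℕ, Continuous (fun p : ℂ × EuclideanSpace ℝ (Fin n) =>
      iteratedFDeriv ℝ m (fun x => u (p.1, x)) p.2))
    (huderiv_holo : ∀ (m : ℕ) (x : EuclideanSpace ℝ (Fin n))
        (v : Fin m → EuclideanSpace ℝ (Fin n)),
      Differentiable ℂ (fun z => iteratedFDeriv ℝ m (fun x' => u (z, x')) x v))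
    (x₀ : EuclideanSpace ℝ (Fin n)) (hx₀U : x₀ ∈ U)
    (hcrit : fderiv ℝ f x₀ = 0)
    (huniq : ∀ x ∈ K, fderiv ℝ f x = 0 → x = x₀)
    (hnondeg : ∀ v : EuclideanSpace ℝ (Fin n),
      (∀ w : EuclideanSpace ℝ (Fin n), fderiv ℝ (fderiv ℝ f) x₀ v w = 0) → v = 0) :
    ∃ M : ℕ → ℂ → ℂ, (∀ j : ℕ, Differentiable ℂ (M j)) ∧
      ∀ L : Set ℂ, IsCompact L → ∀ k : ℕ, ∃ C > (0:ℝ), ∃ R ≥ (1:ℝ),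
        ∀ z ∈ L, ∀ r : ℝ, R ≤ r →
          ‖(∫ x, Complex.exp (Complex.I * r * f x) * u (z, x)) -
            ∑ j ∈ Finset.range k,
              Complex.exp (Complex.I * r * f x₀) * M j z * (r:ℂ) ^ (-(n:ℂ)/2 - j)‖
            ≤ C * r ^ (-(k:ℝ)) := by
  obtain ⟨h, K', hP, hh0, hKK', hfh⟩ := SPH.globalize hU hf hK hKU hx₀U hcrit huniq hnondeg
  obtain ⟨M, hM, hexp⟩ := SPH.family hP hh0 (fun z x => u (z, x)) husmooth
    (fun z => (husupp z).trans hKK') huholo huderiv_cont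
  refine ⟨M, hM, fun L hL k => ?_⟩
  obtain ⟨C, hC⟩ := hexp L hL k
  refine ⟨|C| + 1, by positivity, 1, le_rfl, fun z hz r hr => ?_⟩
  have hr0 : 0 < r := lt_of_lt_of_le one_pos hr
  have hs : r⁻¹ ∈ Set.Ioc (0:ℝ) 1 := ⟨inv_pos.2 hr0, inv_le_one_of_one_le₀ hr⟩
  have h1 := hC z hz r⁻¹ hs
  have hIntegr : (∫ x, Complex.exp (Complex.I * r * f x) * u (z, x)) =
      Complex.exp (Complex.I * r * f x₀) * SPH.osc h (fun x => u (z, x)) r := by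
    unfold SPH.osc
    rw [← integral_const_mul]
    congr 1
    ext x
    by_cases hx : x ∈ K
    · rw [hfh x hx, smul_eq_mul, ← mul_assoc, ← Complex.exp_add]
      congr 2
      push_cast
      ring
    · have : u (z, x) = 0 :=
        image_eq_zero_of_notMem_tsupport (f := fun x => u (z, x)) fun h' => hx (husupp z h')
      simp [this]
  set w : ℝ := r⁻¹ ^ (-(n : ℝ) / 2) with hw
  have hw1 : 1 ≤ w := by
    rw [hw]
    apply Real.one_le_rpow_of_pos_of_le_one_of_nonpos hs.1 hs.2
    have : (0:ℝ) ≤ n := Nat.cast_nonneg n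
    linarith
  have hw0 : (w : ℂ) ≠ 0 := by
    exact_mod_cast (lt_of_lt_of_le one_pos hw1).ne'
  have e : (∫ x, Complex.exp (Complex.I * r * f x) * u (z, x)) -
      ∑ j ∈ Finset.range k, Complex.exp (Complex.I * r * f x₀) * M j z * (r:ℂ) ^ (-(n:ℂ)/2 - j) =
      Complex.exp (Complex.I * r * f x₀) * ((w : ℂ)⁻¹ *
        (SPH.nosc h (fun x => u (z, x)) r⁻¹ - ∑ j ∈ Finset.range k, ((r⁻¹ : ℝ) : ℂ) ^ j * M j z)) := by
    rw [hIntegr, SPH.nosc, inv_inv, ← hw, smul_eq_mul, mul_sub ((w : ℂ)⁻¹), inv_mul_cancel_left₀ hw0,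
      mul_sub, Finset.mul_sum, Finset.mul_sum]
    congr 1
    refine Finset.sum_congr rfl fun j _ => ?_
    rw [SPH.cpow_eq n j hr0]
    ring
  rw [e, norm_mul, norm_mul, SPH.norm_exp_osc, one_mul, norm_inv,
    Complex.norm_of_nonneg (zero_le_one.trans hw1)]
  have hk : r ^ (-(k:ℝ)) = r⁻¹ ^ k := by
    rw [Real.rpow_neg hr0.le, Real.rpow_natCast, inv_pow]
  rw [hk]
  calc _ ≤ 1 * (C * r⁻¹ ^ k) :=
        mul_le_mul (inv_le_one_of_one_le₀ hw1) h1 (norm_nonneg _) zero_le_one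
    _ ≤ (|C| + 1) * r⁻¹ ^ k := by
        rw [one_mul]
        exact mul_le_mul_of_nonneg_right (by linarith [le_abs_self C]) (pow_nonneg hs.1.le _)
end

section
/- Let (a_k)_{k≥1} be a nonincreasing sequence of positive real numbers with a_k → 0. Suppose that for every real s > 1 the series Σ_k a_k^s converges, and that (s−1)·Σ_k a_k^s → 1 as s → 1 from the right. Then the partial sums satisfy Σ_{k=1}^{N} a_k ∼ log N, i.e., (Σ_{k=1}^{N} a_k)/log N → 1 as N → ∞. -/
open Filter Real

lemma D_summable (a : ℕ → ℝ) (hpos : ∀ k, 0 < a k) 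
    (hsum : ∀ s : ℝ, 1 < s → Summable (fun k => a k ^ s))
    (p : Polynomial ℝ) (u : ℝ) (hu : 0 < u) :
    Summable (fun k => a k ^ (1 + u) * p.eval (a k ^ u)) := by
  induction p using Polynomial.induction_on' with
  | add p q hp hq => simpa [mul_add] using hp.add hq
  | monomial m c =>
    have h := (hsum (1 + (m+1) * u) (by have : 0 < (m+1)*u := by positivity
                                        linarith)).mul_left c
    refine h.congr fun k => ?_
    rw [Polynomial.eval_monomial, ← Real.rpow_natCast, ← Real.rpow_mul (hpos k).le,
      mul_left_comm, ← Real.rpow_add (hpos k)]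
    congr 2; ring

lemma D_poly (a : ℕ → ℝ) (hpos : ∀ k, 0 < a k) 
    (hsum : ∀ s : ℝ, 1 < s → Summable (fun k => a k ^ s))
    (hzeta : Tendsto (fun s : ℝ => (s - 1) * ∑' k, a k ^ s)
      (nhdsWithin 1 (Set.Ioi 1)) (nhds 1))
    (p : Polynomial ℝ) :
    Tendsto (fun u : ℝ => u * ∑' k, a k ^ (1 + u) * p.eval (a k ^ u))
      (nhdsWithin 0 (Set.Ioi 0)) (nhds (∫ y in (0:ℝ)..1, p.eval y)) := by
  induction p using Polynomial.induction_on' with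
  | add p q hp hq =>
    have h := hp.add hq
    rw [← intervalIntegral.integral_add (p.continuous.intervalIntegrable _ _)
      (q.continuous.intervalIntegrable _ _)] at h
    simp only [Polynomial.eval_add]
    refine h.congr' ?_
    filter_upwards [self_mem_nhdsWithin] with u hu
    simp only [mul_add]
    rw [(D_summable a hpos hsum p u hu).tsum_add (D_summable a hpos hsum q u hu), mul_add]
  | monomial m c =>
    have hint : (∫ y in (0:ℝ)..1, (Polynomial.monomial m c).eval y) = c / (m+1) * 1 := by
      simp [Polynomial.eval_monomial, integral_pow]; ring
    rw [hint]
    have ht : Tendsto (fun u : ℝ => 1 + (m+1) * u) (nhdsWithin 0 (Set.Ioi 0))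
        (nhdsWithin 1 (Set.Ioi 1)) := by
      refine tendsto_nhdsWithin_iff.2 ⟨?_, ?_⟩
      · have : Continuous (fun u : ℝ => 1 + ((m:ℝ)+1) * u) := by fun_prop
        have := this.tendsto 0
        simp only [mul_zero, add_zero] at this
        exact this.mono_left nhdsWithin_le_nhds
      · filter_upwards [self_mem_nhdsWithin] with u hu
        have : 0 < (m+1)*u := mul_pos (by positivity) hu
        simp only [Set.mem_Ioi]; linarith
    refine ((hzeta.comp ht).const_mul (c / (m+1))).congr fun u => ?_
    have : ∀ k, a k ^ (1 + u) * (Polynomial.monomial m c).eval (a k ^ u)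
        = c * a k ^ (1 + (m+1) * u) := by
      intro k
      rw [Polynomial.eval_monomial, ← Real.rpow_natCast, ← Real.rpow_mul (hpos k).le,
        mul_left_comm, ← Real.rpow_add (hpos k)]
      congr 2; ring
    simp only [this, tsum_mul_left, Function.comp]
    have : (m:ℝ)+1 ≠ 0 := by positivity
    field_simp
    ring

lemma ev_le_two (a : ℕ → ℝ) (hpos : ∀ k, 0 < a k) (hanti : Antitone a) :
    ∀ᶠ u in nhdsWithin (0:ℝ) (Set.Ioi 0), ∀ k, a k ^ u ∈ Set.Icc (0:ℝ) 2 := by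
  have h : Tendsto (fun u : ℝ => a 0 ^ u) (nhdsWithin (0:ℝ) (Set.Ioi 0)) (nhds 1) := by
    have : Continuous (fun u : ℝ => a 0 ^ u) :=
      Real.continuous_const_rpow (hpos 0).ne'
    have := this.tendsto 0
    rw [Real.rpow_zero] at this
    exact this.mono_left nhdsWithin_le_nhds
  filter_upwards [h.eventually (gt_mem_nhds (by norm_num : (1:ℝ) < 2)), self_mem_nhdsWithin]
    with u hu hu0 k
  exact ⟨Real.rpow_nonneg (hpos k).le _,
    (Real.rpow_le_rpow (hpos k).le (hanti (Nat.zero_le k)) (le_of_lt hu0)).trans hu.le⟩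

lemma D_cont_summable (a : ℕ → ℝ) (hpos : ∀ k, 0 < a k)
    (hsum : ∀ s : ℝ, 1 < s → Summable (fun k => a k ^ s))
    (f : ℝ → ℝ) (hf : Continuous f) (u : ℝ) (hu : 0 < u)
    (h2 : ∀ k, a k ^ u ∈ Set.Icc (0:ℝ) 2) :
    Summable (fun k => a k ^ (1 + u) * f (a k ^ u)) := by
  obtain ⟨C, hC⟩ := isCompact_Icc.exists_bound_of_continuousOn (s := Set.Icc (0:ℝ) 2) hf.continuousOn
  refine Summable.of_norm_bounded ((hsum (1+u) (by linarith)).mul_right C) fun k => ?_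
  rw [norm_mul, Real.norm_of_nonneg (Real.rpow_nonneg (hpos k).le _)]
  exact mul_le_mul_of_nonneg_left (hC _ (h2 k)) (Real.rpow_nonneg (hpos k).le _)

lemma D_cont (a : ℕ → ℝ) (hpos : ∀ k, 0 < a k) (hanti : Antitone a)
    (hsum : ∀ s : ℝ, 1 < s → Summable (fun k => a k ^ s))
    (hzeta : Tendsto (fun s : ℝ => (s - 1) * ∑' k, a k ^ s)
      (nhdsWithin 1 (Set.Ioi 1)) (nhds 1))
    (f : ℝ → ℝ) (hf : Continuous f) :
    Tendsto (fun u : ℝ => u * ∑' k, a k ^ (1 + u) * f (a k ^ u))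
      (nhdsWithin 0 (Set.Ioi 0)) (nhds (∫ y in (0:ℝ)..1, f y)) := by
  rw [Metric.tendsto_nhds]
  intro ε hε
  obtain ⟨p, hp⟩ := exists_polynomial_near_of_continuousOn 0 2 f hf.continuousOn (ε/4) (by positivity)
  have h1 := D_poly a hpos hsum hzeta 1
  simp only [Polynomial.eval_one, mul_one, intervalIntegral.integral_const, sub_zero, smul_eq_mul] at h1
  have hI : |(∫ y in (0:ℝ)..1, p.eval y) - ∫ y in (0:ℝ)..1, f y| ≤ ε/4 := by
    rw [← intervalIntegral.integral_sub (p.continuous.intervalIntegrable _ _)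
      (hf.intervalIntegrable _ _)]
    have := intervalIntegral.norm_integral_le_of_norm_le_const (a := (0:ℝ)) (b := 1) (C := ε/4)
      (f := fun y => p.eval y - f y) (fun y hy => by
        rw [Set.uIoc_of_le zero_le_one] at hy
        exact (hp y ⟨hy.1.le, hy.2.trans (by norm_num)⟩).le)
    simpa using this
  filter_upwards [ev_le_two a hpos hanti, self_mem_nhdsWithin,
    h1.eventually (gt_mem_nhds (by norm_num : (1:ℝ) < 3/2)),
    (Metric.tendsto_nhds.1 (D_poly a hpos hsum hzeta p)) (ε/4) (by positivity)] with u h2 hu h3 h4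
  have hu : 0 < u := hu
  have sf := D_cont_summable a hpos hsum f hf u hu h2
  have sp := D_summable a hpos hsum p u hu
  have s1 := hsum (1+u) (by linarith)
  have key : |u * ∑' k, a k ^ (1 + u) * f (a k ^ u) - u * ∑' k, a k ^ (1 + u) * p.eval (a k ^ u)|
      ≤ ε/4 * (3/2) := by
    rw [← mul_sub, ← sf.tsum_sub sp, abs_mul, abs_of_pos hu]
    have : ‖∑' k, (a k ^ (1 + u) * f (a k ^ u) - a k ^ (1 + u) * p.eval (a k ^ u))‖ ≤
        ∑' k, a k ^ (1+u) * (ε/4) := by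
      refine tsum_of_norm_bounded (s1.mul_right _).hasSum fun k => ?_
      rw [← mul_sub, norm_mul, Real.norm_of_nonneg (Real.rpow_nonneg (hpos k).le _)]
      refine mul_le_mul_of_nonneg_left ?_ (Real.rpow_nonneg (hpos k).le _)
      rw [Real.norm_eq_abs, abs_sub_comm]
      exact (hp _ (h2 k)).le
    rw [tsum_mul_right, Real.norm_eq_abs] at this
    nlinarith
  rw [Real.dist_eq] at *
  rw [abs_le] at key hI
  rw [abs_lt] at *
  constructor <;> linarith [h4.1, h4.2, key.1, key.2, hI.1, hI.2]

noncomputable def tf (α β y : ℝ) : ℝ := (max y α)⁻¹ * max 0 (min 1 ((y - α) / (β - α)))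

lemma tf_cont {α β : ℝ} (h : 0 < α) : Continuous (tf α β) := by
  unfold tf
  refine Continuous.mul (Continuous.inv₀ (by fun_prop) fun y => ?_) (by fun_prop)
  exact (lt_of_lt_of_le h (le_max_right _ _)).ne'

lemma tf_nonneg {α β : ℝ} (h : 0 < α) (y : ℝ) : 0 ≤ tf α β y :=
  mul_nonneg (inv_nonneg.2 (h.le.trans (le_max_right _ _))) (le_max_left _ _)

lemma tf_le {α β : ℝ} {y : ℝ} (hy : 0 < y) : tf α β y ≤ y⁻¹ := by
  unfold tf
  have h1 : (max y α)⁻¹ ≤ y⁻¹ := by gcongr; exact le_max_left _ _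
  have h2 : max 0 (min 1 ((y - α) / (β - α))) ≤ 1 := max_le zero_le_one (min_le_left _ _)
  calc _ ≤ y⁻¹ * 1 := mul_le_mul h1 h2 (le_max_left _ _) (by positivity)
    _ = _ := mul_one _

lemma tf_zero {α β : ℝ} (hab : α < β) {y : ℝ} (hy : y ≤ α) : tf α β y = 0 := by
  unfold tf
  have : (y - α) / (β - α) ≤ 0 := div_nonpos_of_nonpos_of_nonneg (by linarith) (by linarith)
  rw [max_eq_left ((min_le_right _ _).trans this), mul_zero]

lemma tf_eq {α β : ℝ} (hab : α < β) {y : ℝ} (hy : β ≤ y) : tf α β y = y⁻¹ := by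
  unfold tf
  have : 1 ≤ (y - α) / (β - α) := by rw [le_div_iff₀ (by linarith)]; linarith
  rw [min_eq_left this, max_eq_left (by linarith : α ≤ y), max_eq_right zero_le_one, mul_one]

lemma tf_int_le {α β : ℝ} (h : 0 < α) (hab : α < β) (h1 : α < 1) :
    ∫ y in (0:ℝ)..1, tf α β y ≤ - Real.log α := by
  have hi := fun x y => (tf_cont (β := β) h).intervalIntegrable (μ := MeasureTheory.volume) x y
  rw [← intervalIntegral.integral_add_adjacent_intervals (hi 0 α) (hi α 1)]
  have e1 : ∫ y in (0:ℝ)..α, tf α β y = 0 := by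
    rw [intervalIntegral.integral_congr (g := fun _ => 0), intervalIntegral.integral_zero]
    intro y hy
    rw [Set.uIcc_of_le h.le] at hy
    exact tf_zero hab hy.2
  have e2 : ∫ y in α..1, tf α β y ≤ ∫ y in α..1, y⁻¹ := by
    refine intervalIntegral.integral_mono_on h1.le (hi _ _) ?_ fun y hy => tf_le (h.trans_le hy.1)
    rw [intervalIntegrable_inv_iff]
    right; rw [Set.uIcc_of_le h1.le]; exact fun hh => absurd hh.1 (not_le.2 h)
  rw [integral_inv_of_pos h one_pos, one_div, Real.log_inv] at e2
  linarith

lemma le_tf_int {α β : ℝ} (h : 0 < α) (hab : α < β) (h1 : β < 1) :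
    - Real.log β ≤ ∫ y in (0:ℝ)..1, tf α β y := by
  have hi := fun x y => (tf_cont (β := β) h).intervalIntegrable (μ := MeasureTheory.volume) x y
  have hb := h.trans hab
  rw [← intervalIntegral.integral_add_adjacent_intervals (hi 0 β) (hi β 1)]
  have e1 : 0 ≤ ∫ y in (0:ℝ)..β, tf α β y :=
    intervalIntegral.integral_nonneg hb.le fun y _ => tf_nonneg h y
  have e2 : ∫ y in β..1, tf α β y = ∫ y in β..1, y⁻¹ := by
    refine intervalIntegral.integral_congr fun y hy => ?_
    rw [Set.uIcc_of_le h1.le] at hy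
    exact tf_eq hab hy.1
  rw [integral_inv_of_pos hb one_pos, one_div, Real.log_inv] at e2
  linarith

lemma u_tendsto : Tendsto (fun N : ℕ => (Real.log N)⁻¹) atTop (nhdsWithin (0:ℝ) (Set.Ioi 0)) :=
  tendsto_inv_atTop_nhdsGT_zero.comp (Real.tendsto_log_atTop.comp tendsto_natCast_atTop_atTop)

lemma upper_bd (a : ℕ → ℝ) (hpos : ∀ k, 0 < a k) (hanti : Antitone a)
    (hsum : ∀ s : ℝ, 1 < s → Summable (fun k => a k ^ s))
    (hzeta : Tendsto (fun s : ℝ => (s - 1) * ∑' k, a k ^ s)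
      (nhdsWithin 1 (Set.Ioi 1)) (nhds 1)) (ε : ℝ) (hε : 0 < ε) :
    ∀ᶠ N : ℕ in atTop, (∑ k ∈ Finset.range N, a k) / Real.log N < 1 + 2 * ε := by
  set α := Real.exp (-1 - ε)
  set β := Real.exp (-1)
  have hα : 0 < α := Real.exp_pos _
  have hab : α < β := Real.exp_lt_exp.2 (by linarith)
  have hα1 : α < 1 := Real.exp_lt_one_iff.2 (by linarith)
  have hI := tf_int_le hα hab hα1
  rw [Real.log_exp] at hI
  have hT := ((D_cont a hpos hanti hsum hzeta (tf α β) (tf_cont hα)).comp u_tendsto).add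
    (u_tendsto.mono_right nhdsWithin_le_nhds)
  filter_upwards [hT.eventually (gt_mem_nhds (by linarith : _ < 1 + 2 * ε)),
    u_tendsto.eventually (ev_le_two a hpos hanti), u_tendsto.eventually self_mem_nhdsWithin,
    eventually_gt_atTop 0] with N h1 h2 hu hN
  have hu : 0 < (Real.log N)⁻¹ := hu
  have hl : 0 < Real.log N := inv_pos.1 hu
  have hN' : (0:ℝ) < N := by exact_mod_cast hN
  refine lt_of_le_of_lt ?_ h1
  simp only [Function.comp]
  set u := (Real.log N)⁻¹ with hu_def
  have sf := D_cont_summable a hpos hsum _ (tf_cont (β := β) hα) u hu h2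
  have hnn : ∀ k, 0 ≤ a k ^ (1 + u) * tf α β (a k ^ u) := fun k =>
    mul_nonneg (Real.rpow_nonneg (hpos k).le _) (tf_nonneg hα _)
  have hk : ∀ k, a k ≤ (N:ℝ)⁻¹ + a k ^ (1 + u) * tf α β (a k ^ u) := by
    intro k
    have hp := Real.rpow_pos_of_pos (hpos k) u
    rcases le_total β (a k ^ u) with hc | hc
    · rw [tf_eq hab hc, Real.rpow_add (hpos k), Real.rpow_one, mul_inv_cancel_right₀ hp.ne']
      have : (0:ℝ) < (N:ℝ)⁻¹ := by positivity
      linarith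
    · have : a k ≤ (N:ℝ)⁻¹ := by
        have h3 := Real.rpow_le_rpow hp.le hc hl.le
        rw [← Real.rpow_mul (hpos k).le, hu_def, inv_mul_cancel₀ hl.ne', Real.rpow_one,
          ← Real.exp_mul, neg_one_mul, Real.exp_neg, Real.exp_log hN'] at h3
        exact h3
      linarith [hnn k]
  have hS : ∑ k ∈ Finset.range N, a k ≤ 1 + ∑' k, a k ^ (1 + u) * tf α β (a k ^ u) := by
    calc _ ≤ ∑ k ∈ Finset.range N, ((N:ℝ)⁻¹ + a k ^ (1 + u) * tf α β (a k ^ u)) :=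
          Finset.sum_le_sum fun k _ => hk k
      _ = 1 + ∑ k ∈ Finset.range N, a k ^ (1 + u) * tf α β (a k ^ u) := by
          rw [Finset.sum_add_distrib]; simp [hN'.ne']
      _ ≤ _ := by
          gcongr
          exact sf.sum_le_tsum _ fun k _ => hnn k
  rw [div_eq_mul_inv, ← hu_def]
  nlinarith

lemma a_small (a : ℕ → ℝ) (hpos : ∀ k, 0 < a k) (hanti : Antitone a)
    (hsum : ∀ s : ℝ, 1 < s → Summable (fun k => a k ^ s)) (ε : ℝ) (hε : 0 < ε) (hε1 : ε < 1) :
    ∀ᶠ N : ℕ in atTop, a N ^ (Real.log N)⁻¹ ≤ Real.exp (-1 + ε) := by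
  set s : ℝ := (1 - ε/2)⁻¹ with hs
  have hs1 : 1 < s := (one_lt_inv₀ (by linarith)).2 (by linarith)
  set C := ∑' k, a k ^ s
  have hb : ∀ N : ℕ, N * a N ^ s ≤ C := by
    intro N
    calc (N:ℝ) * a N ^ s = ∑ k ∈ Finset.range N, a N ^ s := by simp
      _ ≤ ∑ k ∈ Finset.range N, a k ^ s := Finset.sum_le_sum fun k hk =>
          Real.rpow_le_rpow (hpos N).le (hanti (Finset.mem_range.1 hk).le) (by linarith)
      _ ≤ C := (hsum s hs1).sum_le_tsum _ fun k _ => Real.rpow_nonneg (hpos k).le _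
  have hlog : Tendsto (fun N : ℕ => Real.log N) atTop atTop :=
    Real.tendsto_log_atTop.comp tendsto_natCast_atTop_atTop
  filter_upwards [hlog.eventually_ge_atTop (Real.log C * (1 - ε/2) / (ε / 2)),
    hlog.eventually_gt_atTop 0, eventually_gt_atTop 0] with N h1 hl hN
  have hN' : (0:ℝ) < N := by exact_mod_cast hN
  have hp := Real.rpow_pos_of_pos (hpos N) s
  have h2 := Real.log_le_log (by positivity) (hb N)
  rw [Real.log_mul hN'.ne' hp.ne', Real.log_rpow (hpos N)] at h2
  rw [div_le_iff₀ (by positivity)] at h1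
  rw [Real.rpow_def_of_pos (hpos N), Real.exp_le_exp, ← div_eq_mul_inv, div_le_iff₀ hl]
  have hs2 : s * (1 - ε/2) = 1 := inv_mul_cancel₀ (by linarith)
  have h3 := mul_le_mul_of_nonneg_right h2 (by linarith : 0 ≤ 1 - ε/2)
  have h4 : (Real.log N + s * Real.log (a N)) * (1 - ε/2)
     = Real.log N * (1-ε/2) + Real.log (a N) := by linear_combination Real.log (a N) * hs2
  nlinarith

lemma lower_bd (a : ℕ → ℝ) (hpos : ∀ k, 0 < a k) (hanti : Antitone a)
    (hsum : ∀ s : ℝ, 1 < s → Summable (fun k => a k ^ s))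
    (hzeta : Tendsto (fun s : ℝ => (s - 1) * ∑' k, a k ^ s)
      (nhdsWithin 1 (Set.Ioi 1)) (nhds 1)) (ε : ℝ) (hε : 0 < ε) (hε1 : ε < 1 / 2) :
    ∀ᶠ N : ℕ in atTop, 1 - 3 * ε < (∑ k ∈ Finset.range N, a k) / Real.log N := by
  set α := Real.exp (-1 + ε) with hαd
  set β := Real.exp (-1 + 2 * ε)
  have hα : 0 < α := Real.exp_pos _
  have hab : α < β := Real.exp_lt_exp.2 (by linarith)
  have hβ1 : β < 1 := Real.exp_lt_one_iff.2 (by linarith)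
  have hI := le_tf_int hα hab hβ1
  rw [Real.log_exp] at hI
  have hT := (D_cont a hpos hanti hsum hzeta (tf α β) (tf_cont hα)).comp u_tendsto
  filter_upwards [hT.eventually (lt_mem_nhds (by linarith : 1 - 3 * ε < _)),
    a_small a hpos hanti hsum ε hε (by linarith), u_tendsto.eventually self_mem_nhdsWithin]
    with N h1 h2 hu
  have hu : 0 < (Real.log N)⁻¹ := hu
  refine lt_of_lt_of_le h1 ?_
  simp only [Function.comp]
  set u := (Real.log N)⁻¹ with hu_def
  rw [tsum_eq_sum (s := Finset.range N), div_eq_mul_inv, mul_comm]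
  · refine mul_le_mul_of_nonneg_right (Finset.sum_le_sum fun k _ => ?_) hu.le
    have hp := Real.rpow_pos_of_pos (hpos k) u
    calc _ ≤ a k ^ (1 + u) * (a k ^ u)⁻¹ :=
          mul_le_mul_of_nonneg_left (tf_le hp) (Real.rpow_nonneg (hpos k).le _)
      _ = a k := by rw [Real.rpow_add (hpos k), Real.rpow_one, mul_inv_cancel_right₀ hp.ne']
  · intro k hk
    rw [Finset.mem_range, not_lt] at hk
    rw [tf_zero hab, mul_zero]
    exact (Real.rpow_le_rpow (hpos k).le (hanti hk) hu.le).trans h2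

theorem partial_sums_log_asymptotics
    (a : ℕ → ℝ) (hpos : ∀ k, 0 < a k) (hanti : Antitone a)
    (hlim : Tendsto a atTop (nhds 0))
    (hsum : ∀ s : ℝ, 1 < s → Summable (fun k => a k ^ s))
    (hzeta : Tendsto (fun s : ℝ => (s - 1) * ∑' k, a k ^ s)
      (nhdsWithin 1 (Set.Ioi 1)) (nhds 1)) :
    Tendsto (fun N : ℕ => (∑ k ∈ Finset.range N, a k) / Real.log N)
      atTop (nhds 1) := by
  rw [tendsto_order]
  constructor
  · intro b hb
    have h0 : 0 < min ((1 - b) / 3) (1/4) := lt_min (by linarith) (by norm_num)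
    filter_upwards [lower_bd a hpos hanti hsum hzeta _ h0
      ((min_le_right _ _).trans_lt (by norm_num))] with N hN
    have := min_le_left ((1 - b) / 3) (1/4)
    linarith
  · intro b hb
    filter_upwards [upper_bd a hpos hanti hsum hzeta ((b - 1)/2) (by linarith)] with N hN
    linarith
end

section
/- Equivariant stationary phase expansion: Let g be a linear isometry of ℝ^d such that 1 − g is invertible (g has no nonzero fixed vector), and let u : ℝ^d × ℝ^d → ℂ be smooth and compactly supported. Then the phase f(x,η) = ⟨x − g x, η⟩ has (0,0) as its unique critical point, with nondegenerate Hessian, and there exists a sequence of complex numbers (M_j)_{j∈ℕ} such that for every k ∈ ℕ there exist C > 0 and R ≥ 1 with: for all real r ≥ R, ‖∫_{ℝ^d × ℝ^d} e^{i r ⟨x − g x, η⟩} u(x,η) dx dη − Σ_{j<k} M_j r^{-d-j}‖ ≤ C · r^{-k}. -/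
open MeasureTheory Complex
open scoped RealInnerProductSpace

open scoped FourierTransform SchwartzMap

section Helpers

variable {E : Type*} [NormedAddCommGroup E] [InnerProductSpace ℝ E] [FiniteDimensional ℝ E]
  [MeasurableSpace E] [BorelSpace E]

instance esp_volume_temperate : (volume : Measure (E × E)).HasTemperateGrowth := by
  rw [Measure.volume_eq_prod]
  infer_instance

/-- Taylor remainder of `exp (i t)` with some constant. -/
lemma esp_exp_bound (k : ℕ) : ∃ C : ℝ, 0 ≤ C ∧ ∀ t : ℝ,
    ‖Complex.exp (Complex.I * t) - ∑ j ∈ Finset.range k, (Complex.I * t) ^ j / (j.factorial : ℂ)‖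
      ≤ C * |t| ^ k := by
  have hn : ∀ t : ℝ, ‖Complex.I * (t : ℂ)‖ = |t| := by
    intro t
    rw [norm_mul, Complex.norm_I, one_mul, Complex.norm_real, Real.norm_eq_abs]
  have he : ∀ t : ℝ, ‖Complex.exp (Complex.I * t)‖ = 1 := by
    intro t
    rw [mul_comm, Complex.norm_exp_ofReal_mul_I]
  rcases Nat.eq_zero_or_pos k with rfl | hk
  · exact ⟨1, zero_le_one, fun t => by simp [he t]⟩
  · refine ⟨max ((k.succ : ℝ) * (k.factorial * k : ℝ)⁻¹)
      (1 + ∑ j ∈ Finset.range k, 1 / (j.factorial : ℝ)), ?_, fun t => ?_⟩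
    · exact le_max_of_le_left (by positivity)
    · rcases le_total |t| 1 with h | h
      · have := Complex.exp_bound (x := Complex.I * t) (by rw [hn]; exact h) hk
        rw [hn] at this
        refine this.trans ?_
        rw [mul_comm]
        gcongr
        exact le_max_left _ _
      · refine (norm_sub_le _ _).trans ?_
        rw [he]
        have h1 : ‖∑ j ∈ Finset.range k, (Complex.I * t) ^ j / (j.factorial : ℂ)‖ ≤
            ∑ j ∈ Finset.range k, 1 / (j.factorial : ℝ) * |t| ^ k := by
          refine (norm_sum_le _ _).trans (Finset.sum_le_sum fun j hj => ?_)
          rw [norm_div, norm_pow, hn, Complex.norm_natCast, div_eq_inv_mul, one_div]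
          gcongr
          exact (Finset.mem_range.1 hj).le
        rw [← Finset.sum_mul] at h1
        have h2 : (1 : ℝ) ≤ |t| ^ k := one_le_pow₀ h
        calc _ ≤ (1 + ∑ j ∈ Finset.range k, 1 / (j.factorial : ℝ)) * |t| ^ k := by
                rw [add_mul]; linarith
          _ ≤ _ := by gcongr; exact le_max_right _ _

/-- Expansion of an oscillatory integral with small phase against a Schwartz function. -/
lemma esp_asymp {X : Type*} [NormedAddCommGroup X] [NormedSpace ℝ X] [MeasurableSpace X]
    [BorelSpace X] [SecondCountableTopology X] (μ : Measure X) [μ.HasTemperateGrowth]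
    (W : 𝓢(X, ℂ)) (q : X → ℝ) (hq : Continuous q) (K : ℝ) (hK : ∀ p, |q p| ≤ K * ‖p‖ ^ 2)
    (k : ℕ) : ∃ C : ℝ, 0 < C ∧ ∀ s : ℝ, 0 ≤ s →
      ‖(∫ p, Complex.exp (Complex.I * (s * q p : ℝ)) * W p ∂μ) -
        ∑ j ∈ Finset.range k, (∫ p, (Complex.I * q p) ^ j / (j.factorial : ℂ) * W p ∂μ) * (s : ℂ) ^ j‖
        ≤ C * s ^ k := by
  obtain ⟨C₀, hC₀, hb⟩ := esp_exp_bound k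
  have hqi : ∀ j : ℕ, Integrable (fun p => |q p| ^ j * ‖W p‖) μ := by
    intro j
    refine ((W.integrable_pow_mul μ (2 * j)).const_mul (K ^ j)).mono'
      (by have := W.continuous; fun_prop) (Filter.Eventually.of_forall fun p => ?_)
    rw [Real.norm_of_nonneg (by positivity), ← mul_assoc, pow_mul, ← mul_pow]
    gcongr
    exact hK p
  have hji : ∀ j : ℕ, Integrable (fun p => (Complex.I * q p) ^ j / (j.factorial : ℂ) * W p) μ := by
    intro j
    refine ((hqi j).const_mul (1 / (j.factorial : ℝ))).mono'
      (by have := W.continuous; fun_prop) (Filter.Eventually.of_forall fun p => ?_)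
    rw [norm_mul, norm_div, norm_pow, norm_mul, Complex.norm_I, one_mul, Complex.norm_real,
      Complex.norm_natCast, Real.norm_eq_abs]
    exact le_of_eq (by ring)
  have hei : ∀ s : ℝ, Integrable (fun p => Complex.exp (Complex.I * (s * q p : ℝ)) * W p) μ := by
    intro s
    refine (W.integrable (μ := μ)).norm.mono'
      (by have := W.continuous; fun_prop) (Filter.Eventually.of_forall fun p => ?_)
    rw [norm_mul, mul_comm Complex.I, Complex.norm_exp_ofReal_mul_I, one_mul]
  refine ⟨C₀ * (∫ p, |q p| ^ k * ‖W p‖ ∂μ) + 1, ?_, fun s hs => ?_⟩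
  · have : 0 ≤ ∫ p, |q p| ^ k * ‖W p‖ ∂μ := integral_nonneg fun p => by positivity
    positivity
  · have h1 : ∑ j ∈ Finset.range k,
        (∫ p, (Complex.I * q p) ^ j / (j.factorial : ℂ) * W p ∂μ) * (s : ℂ) ^ j =
        ∫ p, ∑ j ∈ Finset.range k,
          ((Complex.I * q p) ^ j / (j.factorial : ℂ) * W p) * (s : ℂ) ^ j ∂μ := by
      rw [integral_finsetSum _ fun j _ => (hji j).mul_const _]
      exact Finset.sum_congr rfl fun j _ => (integral_mul_const _ _).symm
    rw [h1, ← integral_sub (hei s) (integrable_finsetSum _ fun j _ => (hji j).mul_const _)]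
    have h2 : ‖∫ p, (Complex.exp (Complex.I * (s * q p : ℝ)) * W p - ∑ j ∈ Finset.range k,
          ((Complex.I * q p) ^ j / (j.factorial : ℂ) * W p) * (s : ℂ) ^ j) ∂μ‖ ≤
        ∫ p, C₀ * s ^ k * (|q p| ^ k * ‖W p‖) ∂μ := by
      refine norm_integral_le_of_norm_le ((hqi k).const_mul _)
        (Filter.Eventually.of_forall fun p => ?_)
      have h3 : Complex.exp (Complex.I * (s * q p : ℝ)) * W p - ∑ j ∈ Finset.range k,
          ((Complex.I * q p) ^ j / (j.factorial : ℂ) * W p) * (s : ℂ) ^ j =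
          (Complex.exp (Complex.I * (s * q p : ℝ)) - ∑ j ∈ Finset.range k,
            (Complex.I * (s * q p : ℝ)) ^ j / (j.factorial : ℂ)) * W p := by
        rw [sub_mul, Finset.sum_mul]
        congr 1
        refine Finset.sum_congr rfl fun j _ => ?_
        push_cast
        ring
      rw [h3, norm_mul]
      calc _ ≤ C₀ * |s * q p| ^ k * ‖W p‖ := by gcongr; exact hb _
        _ = _ := by rw [abs_mul, abs_of_nonneg hs]; ring
    refine h2.trans ?_
    rw [integral_const_mul]
    have : 0 ≤ s ^ k := by positivity
    nlinarith

/-- The full Fourier transform of a test function on a product, as a Schwartz function. -/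
lemma esp_fourier (u : E × E → ℂ) (hu : ContDiff ℝ (⊤ : ℕ∞) u) (hucs : HasCompactSupport u) :
    ∃ W : 𝓢(E × E, ℂ), ∀ ξ z : E,
      W (ξ, z) = 𝓕 (fun y : E => 𝓕 (fun η : E => u (y, η)) z) ξ := by
  let e := WithLp.prodContinuousLinearEquiv 2 ℝ E E
  let V : 𝓢(WithLp 2 (E × E), ℂ) :=
    SchwartzMap.compCLMOfContinuousLinearEquiv ℝ e (hucs.toSchwartzMap hu)
  refine ⟨SchwartzMap.compCLMOfContinuousLinearEquiv ℝ e.symm (𝓕 V), fun ξ z => ?_⟩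
  have hui : Integrable u := hu.continuous.integrable_of_hasCompactSupport hucs
  have hV : ∀ p : E × E, V (WithLp.toLp 2 p) = u p := fun p => rfl
  change (𝓕 V) (WithLp.toLp 2 (ξ, z)) = _
  rw [SchwartzMap.fourier_coe, Real.fourier_eq,
    ← (WithLp.volume_preserving_toLp E E).integral_comp
      (MeasurableEquiv.toLp 2 (E × E)).measurableEmbedding]
  simp only [hV]
  rw [Measure.volume_eq_prod, integral_prod]
  · rw [Real.fourier_eq]
    congr 1
    ext y
    rw [Real.fourier_eq, Circle.smul_def, ← integral_smul]
    congr 1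
    ext η
    rw [← Circle.smul_def, smul_smul, ← AddChar.map_add_eq_mul]
    simp only [WithLp.prod_inner_apply]
    congr 2
    ring
  · rw [← Measure.volume_eq_prod]
    refine hui.norm.mono' ?_ (Filter.Eventually.of_forall fun p => ?_)
    · have := hu.continuous
      refine Continuous.aestronglyMeasurable ?_
      have hc : Continuous fun p : E × E =>
          𝐞 (-⟪WithLp.toLp 2 p, WithLp.toLp 2 (ξ, z)⟫) := by
        refine Real.continuous_fourierChar.comp ?_
        simp only [WithLp.prod_inner_apply]
        fun_prop
      exact hc.smul this
    · rw [Circle.norm_smul]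

lemma esp_slice_integrable (W : 𝓢(E × E, ℂ)) (z : E) : Integrable (fun ξ : E => W (ξ, z)) := by
  have hc : Continuous (fun ξ : E => W (ξ, z)) := W.continuous.comp (by fun_prop)
  obtain ⟨C₁, -, h₁⟩ := W.decay 0 0
  obtain ⟨C₂, -, h₂⟩ := W.decay (0 + (volume : Measure E).integrablePower) 0
  have := integrable_of_le_of_pow_mul_le (μ := (volume : Measure E)) (k := 0)
    (f := fun ξ : E => W (ξ, z)) (C₁ := C₁) (C₂ := C₂)
    (fun ξ => by simpa using h₁ (ξ, z))
    (fun ξ => by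
      refine le_trans ?_ (h₂ (ξ, z))
      rw [norm_iteratedFDeriv_zero]
      gcongr
      exact le_max_left _ _) hc.aestronglyMeasurable
  refine this.mono' hc.aestronglyMeasurable (Filter.Eventually.of_forall fun ξ => by simp)

lemma esp_inv (u : E × E → ℂ) (hu : ContDiff ℝ (⊤ : ℕ∞) u) (hucs : HasCompactSupport u)
    (W : 𝓢(E × E, ℂ))
    (hW : ∀ ξ z : E, W (ξ, z) = 𝓕 (fun y : E => 𝓕 (fun η : E => u (y, η)) z) ξ) (y z : E) :
    𝓕 (fun η : E => u (y, η)) z = ∫ ξ : E, 𝐞 ⟪ξ, y⟫ • W (ξ, z) := by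
  have huc := hu.continuous
  have hui : Integrable u := huc.integrable_of_hasCompactSupport hucs
  have hcont : Continuous (fun p : E × E => 𝐞 (-⟪p.2, z⟫) • u p) :=
    (Real.continuous_fourierChar.comp (by fun_prop)).smul huc
  have hint : Integrable (fun p : E × E => 𝐞 (-⟪p.2, z⟫) • u p) :=
    hui.norm.mono' hcont.aestronglyMeasurable
      (Filter.Eventually.of_forall fun p => by rw [Circle.norm_smul])
  have hK : IsCompact (Prod.snd '' tsupport u) := hucs.isCompact.image continuous_snd
  have h1 : Continuous (fun y : E => 𝓕 (fun η : E => u (y, η)) z) := by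
    have := continuous_parametric_integral_of_continuous (μ := (volume : Measure E))
      (f := fun y η : E => 𝐞 (-⟪η, z⟫) • u (y, η)) hcont hK
    convert this using 2 with y
    rw [Real.fourier_eq, setIntegral_eq_integral_of_forall_compl_eq_zero]
    intro η hη
    rw [image_eq_zero_of_notMem_tsupport (f := u), smul_zero]
    exact fun h => hη ⟨_, h, rfl⟩
  have h2 : Integrable (fun y : E => 𝓕 (fun η : E => u (y, η)) z) := by
    rw [Measure.volume_eq_prod] at hint
    exact hint.integral_prod_left
  have h3 : 𝓕 (fun y : E => 𝓕 (fun η : E => u (y, η)) z) = fun ξ => W (ξ, z) := by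
    ext ξ; exact (hW ξ z).symm
  have h4 := h1.fourierInv_fourier_eq h2 (by rw [h3]; exact esp_slice_integrable W z)
  rw [h3] at h4
  rw [← Real.fourierInv_eq, h4]

/-- The stationary phase integral, rewritten on the Fourier side. -/
lemma esp_main (u : E × E → ℂ) (hu : ContDiff ℝ (⊤ : ℕ∞) u) (hucs : HasCompactSupport u)
    (A : E ≃L[ℝ] E) : ∃ W : 𝓢(E × E, ℂ), ∀ r : ℝ, 0 < r →
      (∫ p : E × E, Complex.exp (Complex.I * r * (⟪A p.1, p.2⟫ : ℝ)) * u p) =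
        ((r : ℂ) ^ Module.finrank ℝ E)⁻¹ *
          ∫ p : E × E, Complex.exp (Complex.I * (r⁻¹ * (2 * Real.pi * ⟪p.1, p.2⟫) : ℝ)) * W p := by
  obtain ⟨W, hW⟩ := esp_fourier u hu hucs
  have huc := hu.continuous
  have hui : Integrable u := huc.integrable_of_hasCompactSupport hucs
  have hpi : (2 * Real.pi) ≠ 0 := by positivity
  let c : ℝˣ := Units.mk0 (-(2 * Real.pi)⁻¹) (by simp)
  let L : E ≃L[ℝ] E := A.trans (ContinuousLinearEquiv.smulLeft c)
  have hL : ∀ x, L x = (-(2 * Real.pi)⁻¹) • A x := fun x => rfl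
  refine ⟨SchwartzMap.compCLMOfContinuousLinearEquiv ℝ
    ((ContinuousLinearEquiv.refl ℝ E).prodCongr L) W, fun r hr => ?_⟩
  have hW' : ∀ p : E × E, SchwartzMap.compCLMOfContinuousLinearEquiv ℝ
    ((ContinuousLinearEquiv.refl ℝ E).prodCongr L) W p = W (p.1, L p.2) := fun p => rfl
  set W' := SchwartzMap.compCLMOfContinuousLinearEquiv ℝ
    ((ContinuousLinearEquiv.refl ℝ E).prodCongr L) W with hW'def
  have h1 : (∫ p : E × E, Complex.exp (Complex.I * r * (⟪A p.1, p.2⟫ : ℝ)) * u p) =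
      ∫ x : E, 𝓕 (fun η : E => u (x, η)) (r • L x) := by
    rw [Measure.volume_eq_prod, integral_prod]
    · congr 1
      ext x
      rw [Real.fourier_eq']
      congr 1
      ext η
      rw [smul_eq_mul, hL, smul_smul, inner_smul_right, real_inner_comm (A x) η]
      congr 2
      have : -2 * Real.pi * (r * -(2 * Real.pi)⁻¹ * ⟪A x, η⟫) = r * ⟪A x, η⟫ := by
        field_simp
      rw [this]
      push_cast
      ring
    · rw [← Measure.volume_eq_prod]
      refine hui.norm.mono' (Continuous.aestronglyMeasurable (by fun_prop))
        (Filter.Eventually.of_forall fun p => ?_)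
      rw [norm_mul, mul_assoc, ← Complex.ofReal_mul, mul_comm Complex.I,
        Complex.norm_exp_ofReal_mul_I, one_mul]
  have h2 : (∫ x : E, 𝓕 (fun η : E => u (x, η)) (r • L x)) =
      |(r ^ Module.finrank ℝ E)⁻¹| • ∫ w : E, 𝓕 (fun η : E => u (r⁻¹ • w, η)) (L w) := by
    rw [← Measure.integral_comp_smul]
    congr 1
    ext x
    rw [smul_smul, inv_mul_cancel₀ hr.ne', one_smul, map_smul]
  have h3 : (∫ w : E, 𝓕 (fun η : E => u (r⁻¹ • w, η)) (L w)) =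
      ∫ p : E × E, Complex.exp (Complex.I * (r⁻¹ * (2 * Real.pi * ⟪p.1, p.2⟫) : ℝ)) * W' p := by
    rw [Measure.volume_eq_prod, integral_prod_symm]
    · congr 1
      ext w
      rw [esp_inv u hu hucs W hW]
      congr 1
      ext ξ
      rw [hW', Circle.smul_def, Real.fourierChar_apply, inner_smul_right, smul_eq_mul]
      congr 2
      push_cast
      ring
    · rw [← Measure.volume_eq_prod]
      refine (W'.integrable (μ := volume)).norm.mono'
        (Continuous.aestronglyMeasurable (by have := W'.continuous; fun_prop))
        (Filter.Eventually.of_forall fun p => ?_)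
      rw [norm_mul, mul_comm Complex.I, Complex.norm_exp_ofReal_mul_I, one_mul]
  rw [h1, h2, h3, abs_of_pos (by positivity), Complex.real_smul]
  push_cast
  rfl

end Helpers

/-- Equivariant stationary phase expansion: if `g` is an orthogonal map of
`ℝ^d` with no nonzero fixed vector, then the phase `f(x,η) = ⟨x - gx, η⟩` on
`ℝ^d × ℝ^d` has `(0,0)` as its unique, nondegenerate critical point, and the
oscillatory integral has an asymptotic expansion in powers `r^{-d-j}`. -/
theorem equivariant_stationary_phase
    (d : ℕ) (g : EuclideanSpace ℝ (Fin d) ≃ₗᵢ[ℝ] EuclideanSpace ℝ (Fin d))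
    (hg : ∀ x : EuclideanSpace ℝ (Fin d), g x = x → x = 0)
    (u : EuclideanSpace ℝ (Fin d) × EuclideanSpace ℝ (Fin d) → ℂ)
    (hu : ContDiff ℝ (⊤ : ℕ∞) u) (hucs : HasCompactSupport u)
    (f : EuclideanSpace ℝ (Fin d) × EuclideanSpace ℝ (Fin d) → ℝ)
    (hf : ∀ x η : EuclideanSpace ℝ (Fin d), f (x, η) = ⟪x - g x, η⟫) :
    (fderiv ℝ f (0, 0) = 0) ∧
    (∀ p : EuclideanSpace ℝ (Fin d) × EuclideanSpace ℝ (Fin d),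
        fderiv ℝ f p = 0 → p = 0) ∧
    (∀ v : EuclideanSpace ℝ (Fin d) × EuclideanSpace ℝ (Fin d),
        (∀ w : EuclideanSpace ℝ (Fin d) × EuclideanSpace ℝ (Fin d),
          fderiv ℝ (fderiv ℝ f) (0, 0) v w = 0) → v = 0) ∧
    ∃ M : ℕ → ℂ, ∀ k : ℕ, ∃ C > (0:ℝ), ∃ R ≥ (1:ℝ), ∀ r : ℝ, R ≤ r →
      ‖(∫ p : EuclideanSpace ℝ (Fin d) × EuclideanSpace ℝ (Fin d),
            Complex.exp (Complex.I * r * (⟪p.1 - g p.1, p.2⟫ : ℝ)) * u p) -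
          ∑ j ∈ Finset.range k, M j * (r:ℂ) ^ (-(d:ℂ) - j)‖
        ≤ C * r ^ (-(k:ℝ)) := by
  let E := EuclideanSpace ℝ (Fin d)
  let A₀ : E →ₗ[ℝ] E := LinearMap.id - g.toLinearEquiv.toLinearMap
  have hA₀ : ∀ x, A₀ x = x - g x := fun x => rfl
  have hinj : Function.Injective A₀ := by
    rw [← LinearMap.ker_eq_bot, LinearMap.ker_eq_bot']
    intro x hx
    rw [hA₀, sub_eq_zero] at hx
    exact hg x hx.symm
  let A : E ≃L[ℝ] E := (LinearEquiv.ofInjectiveEndo A₀ hinj).toContinuousLinearEquiv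
  have hA : ∀ x, A x = x - g x := fun x => rfl
  -- the polarised bilinear form
  let B : E →L[ℝ] E →L[ℝ] ℝ :=
    (isBoundedBilinearMap_inner (𝕜 := ℝ) (E := E)).toContinuousLinearMap
  let B2 : (E × E) →L[ℝ] (E × E) →L[ℝ] ℝ := B.bilinearComp
    ((A : E →L[ℝ] E).comp (ContinuousLinearMap.fst ℝ E E)) (ContinuousLinearMap.snd ℝ E E)
  let D : (E × E) →L[ℝ] (E × E) →L[ℝ] ℝ := B2 + B2.flip
  have hD : ∀ v w, D v w = ⟪A v.1, w.2⟫ + ⟪A w.1, v.2⟫ := fun v w => rfl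
  have hfd : ∀ p, HasFDerivAt f (D p) p := by
    intro p
    have hf' : f = fun p : E × E => ⟪A p.1, p.2⟫ := by
      ext ⟨x, η⟩; exact hf x η
    rw [hf']
    have h1 : HasFDerivAt (fun p : E × E => A p.1)
        ((A : E →L[ℝ] E).comp (ContinuousLinearMap.fst ℝ E E)) p :=
      ((A : E →L[ℝ] E).comp (ContinuousLinearMap.fst ℝ E E)).hasFDerivAt
    have h2 : HasFDerivAt (fun p : E × E => p.2) (ContinuousLinearMap.snd ℝ E E) p :=
      hasFDerivAt_snd
    refine (h1.inner ℝ h2).congr_fderiv ?_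
    refine ContinuousLinearMap.ext fun w => ?_
    rw [hD]
    simp [fderivInnerCLM_apply]
  have hfd' : fderiv ℝ f = D := by
    ext1 p; exact (hfd p).fderiv
  have hnd : ∀ v, (∀ w, D v w = 0) → v = 0 := by
    intro v hv
    have h1 : A v.1 = 0 := by
      have := hv (0, A v.1)
      rw [hD] at this
      simp at this
      exact norm_eq_zero.1 this
    have h2 : v.2 = 0 := by
      have := hv (A.symm v.2, 0)
      rw [hD] at this
      simp at this
      exact this
    have h3 : v.1 = 0 := by simpa using h1
    exact Prod.ext h3 h2
  refine ⟨?_, ?_, ?_, ?_⟩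
  · rw [hfd']
    exact map_zero D
  · intro p hp
    rw [hfd'] at hp
    exact hnd p fun w => by rw [hp]; rfl
  · intro v hv
    rw [hfd', ContinuousLinearMap.fderiv] at hv
    exact hnd v hv
  · obtain ⟨W, hW⟩ := esp_main u hu hucs A
    let q : E × E → ℝ := fun p => 2 * Real.pi * ⟪p.1, p.2⟫
    have hq : Continuous q := by fun_prop
    have hK : ∀ p, |q p| ≤ (2 * Real.pi) * ‖p‖ ^ 2 := by
      intro p
      have h1 : |⟪p.1, p.2⟫| ≤ ‖p‖ * ‖p‖ :=
        (abs_real_inner_le_norm _ _).trans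
          (mul_le_mul (norm_fst_le p) (norm_snd_le p) (norm_nonneg _) (norm_nonneg _))
      change |2 * Real.pi * ⟪p.1, p.2⟫| ≤ _
      rw [abs_mul, abs_of_pos (by positivity : 0 < 2 * Real.pi), sq]
      gcongr
    refine ⟨fun j => ∫ p, (Complex.I * q p) ^ j / (j.factorial : ℂ) * W p, fun k => ?_⟩
    obtain ⟨C, hC, hb⟩ := esp_asymp volume W q hq _ hK k
    refine ⟨C, hC, 1, le_rfl, fun r hr => ?_⟩
    have hr0 : 0 < r := by linarith
    have hrc : (r : ℂ) ≠ 0 := by exact_mod_cast hr0.ne'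
    have hI := hW r hr0
    rw [finrank_euclideanSpace_fin] at hI
    simp only [hA] at hI
    have hs : ∑ j ∈ Finset.range k, (∫ p, (Complex.I * q p) ^ j / (j.factorial : ℂ) * W p) *
        (r : ℂ) ^ (-(d : ℂ) - j) = ((r : ℂ) ^ d)⁻¹ * ∑ j ∈ Finset.range k,
        (∫ p, (Complex.I * q p) ^ j / (j.factorial : ℂ) * W p) * ((r⁻¹ : ℝ) : ℂ) ^ j := by
      rw [Finset.mul_sum]
      refine Finset.sum_congr rfl fun j _ => ?_
      rw [Complex.cpow_sub _ _ hrc, Complex.cpow_neg, Complex.cpow_natCast, Complex.cpow_natCast]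
      push_cast
      rw [inv_pow]
      ring
    have hb' := hb r⁻¹ (by positivity)
    refine le_trans (le_of_eq ?_) (le_trans (mul_le_of_le_one_left (a := ‖((r : ℂ) ^ d)⁻¹‖)
      (norm_nonneg _) ?_) (hb'.trans ?_))
    · rw [← norm_mul, mul_sub, ← hs, ← hI]
    · rw [norm_inv, norm_pow, Complex.norm_real, Real.norm_of_nonneg hr0.le]
      exact inv_le_one_of_one_le₀ (one_le_pow₀ hr)
    · rw [Real.rpow_neg hr0.le, Real.rpow_natCast, inv_pow]
end

section
/- Tauberian theorem for Dirichlet series with pole at c (the form used for the equivariant Weyl asymptotics): Let c > 0, let (λ_i)_{i∈ℕ} be a nondecreasing sequence of positive reals tending to ∞, and let (m_i)_{i∈ℕ} be nonnegative reals. Suppose the Dirichlet series f(s) := Σ_i m_i λ_i^{-s} converges for every real s > c, extends analytically to {z ∈ ℂ : Re z > c}, and there exist K ∈ ℝ and a function G continuous on {z : Re z ≥ c} with G(z) = f(z) − K/(z−c) for Re z > c. Then the counting function N(λ) := Σ_{i : λ_i ≤ λ} m_i satisfies N(λ)/λ^{c} → K/c as λ → ∞. -/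
open MeasureTheory Filter

noncomputable def tri (t : ℝ) : ℝ := max 0 (1 - |t|)

lemma tri_cont : Continuous tri := by unfold tri; fun_prop

lemma tri_supp : HasCompactSupport tri := by
  refine HasCompactSupport.intro (isCompact_Icc (a := (-1:ℝ)) (b := 1)) fun x hx => ?_
  unfold tri
  have : 1 < |x| := by
    by_contra! h
    exact hx (abs_le.1 h)
  rw [max_eq_left]; linarith

lemma tri_int : Integrable tri := tri_cont.integrable_of_hasCompactSupport tri_supp

lemma tri_nonneg (t : ℝ) : 0 ≤ tri t := le_max_left _ _

lemma tri_zero {t : ℝ} (h : 1 < |t|) : tri t = 0 := by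
  unfold tri; rw [max_eq_left]; linarith

noncomputable def fej (v : ℝ) : ℝ := ∫ t, tri t * Real.cos (t * v)

lemma tricos_int (v : ℝ) : Integrable (fun t => tri t * Real.cos (t * v)) := by
  refine (tri_cont.mul (by fun_prop)).integrable_of_hasCompactSupport tri_supp.mul_right

lemma trisin_int (v : ℝ) : Integrable (fun t => tri t * Real.sin (t * v)) := by
  refine (tri_cont.mul (by fun_prop)).integrable_of_hasCompactSupport tri_supp.mul_right

lemma trisin_zero (v : ℝ) : ∫ t, tri t * Real.sin (t * v) = 0 := by
  have h := integral_neg_eq_self (fun t => tri t * Real.sin (t * v)) volume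
  have h2 : ∀ t : ℝ, tri (-t) * Real.sin (-t * v) = - (tri t * Real.sin (t * v)) := by
    intro t; simp [tri]
  simp only [h2, integral_neg] at h
  linarith

lemma fej_exp (v : ℝ) : ∫ t : ℝ, (tri t : ℂ) * Complex.exp (Complex.I * t * v) = fej v := by
  have h : ∀ t : ℝ, (tri t : ℂ) * Complex.exp (Complex.I * t * v) =
      ((tri t * Real.cos (t * v) : ℝ) : ℂ) + ((tri t * Real.sin (t * v) : ℝ) : ℂ) * Complex.I := by
    intro t
    rw [show Complex.I * t * v = ((t * v : ℝ) : ℂ) * Complex.I by push_cast; ring,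
      Complex.exp_mul_I]
    push_cast; ring
  simp_rw [h]
  rw [integral_add (tricos_int v).ofReal ((trisin_int v).ofReal.mul_const _),
    integral_mul_const, integral_complex_ofReal, integral_complex_ofReal, trisin_zero]
  simp [fej]

lemma fej_sq (v : ℝ) : v ^ 2 * fej v = 2 * (1 - Real.cos v) := by
  have h1 : fej v = 2 * ∫ t in Set.Ioi (0:ℝ), max 0 (1 - t) * Real.cos (t * v) := by
    rw [← integral_comp_abs (f := fun t => max 0 (1 - t) * Real.cos (t * v))]
    unfold fej tri
    congr 1; ext t
    congr 1
    rcases abs_cases t with ⟨h, _⟩ | ⟨h, _⟩ <;> rw [h] <;> simp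
  have h2 : ∫ t in Set.Ioi (0:ℝ), max 0 (1 - t) * Real.cos (t * v)
      = ∫ t in (0:ℝ)..1, (1 - t) * Real.cos (t * v) := by
    rw [intervalIntegral.integral_of_le zero_le_one]
    have : ∫ t in Set.Ioc (0:ℝ) 1, (1 - t) * Real.cos (t * v)
      = ∫ t in Set.Ioc (0:ℝ) 1, max 0 (1 - t) * Real.cos (t * v) := by
      apply setIntegral_congr_fun measurableSet_Ioc
      intro t ht
      simp only
      rw [max_eq_right]; linarith [ht.2]
    rw [this]
    apply setIntegral_eq_of_subset_of_forall_sdiff_eq_zero measurableSet_Ioi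
    · intro t ht; exact ht.1
    · intro t ht
      have : 1 < t := by
        by_contra! h; exact ht.2 ⟨ht.1, h⟩
      rw [max_eq_left (by linarith)]; simp
  have h3 : ∫ t in (0:ℝ)..1, v ^ 2 * ((1 - t) * Real.cos (t * v)) = 1 - Real.cos v := by
    rw [intervalIntegral.integral_eq_sub_of_hasDerivAt
      (f := fun t => (1 - t) * (v * Real.sin (t * v)) - Real.cos (t * v))]
    · simp; ring
    · intro t _
      have a : HasDerivAt (fun t : ℝ => t * v) v t := by simpa using (hasDerivAt_id t).mul_const v
      have b := (((hasDerivAt_id t).const_sub 1).mul (a.sin.const_mul v)).sub a.cos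
      refine b.congr_deriv ?_
      simp only [id]
      ring
    · apply Continuous.intervalIntegrable; fun_prop
  rw [intervalIntegral.integral_const_mul] at h3
  rw [h1, h2]; linear_combination 2 * h3

lemma fej_le (v : ℝ) : |fej v| ≤ ∫ t, tri t := by
  unfold fej
  rw [← Real.norm_eq_abs]
  apply norm_integral_le_of_norm_le tri_int
  filter_upwards with t
  rw [norm_mul, Real.norm_eq_abs, abs_of_nonneg (tri_nonneg t)]
  exact mul_le_of_le_one_right (tri_nonneg t) (Real.abs_cos_le_one _)

lemma fej_cont : Continuous fej := by
  unfold fej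
  apply continuous_of_dominated (bound := tri)
  · intro v; exact (tricos_int v).1
  · intro v; filter_upwards with t
    rw [norm_mul, Real.norm_eq_abs, abs_of_nonneg (tri_nonneg t)]
    exact mul_le_of_le_one_right (tri_nonneg t) (Real.abs_cos_le_one _)
  · exact tri_int
  · filter_upwards with t; fun_prop

lemma tri_pos : 0 < ∫ t, tri t := by
  apply tri_cont.integral_pos_of_hasCompactSupport_nonneg_nonzero tri_supp tri_nonneg (x := 0)
  simp [tri]

lemma fej_nonneg (v : ℝ) : 0 ≤ fej v := by
  by_cases hv : v = 0
  · subst hv; simp [fej]; exact tri_pos.le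
  · have h := fej_sq v
    have h2 : 0 ≤ v ^ 2 * fej v := by rw [h]; linarith [Real.cos_le_one v]
    exact nonneg_of_mul_nonneg_right h2 (by positivity)

lemma fej_int : Integrable fej := by
  refine Integrable.mono' (integrable_inv_one_add_sq.const_mul ((∫ t, tri t) + 4))
    fej_cont.aestronglyMeasurable ?_
  filter_upwards with v
  rw [← div_eq_mul_inv, le_div_iff₀ (by positivity), Real.norm_eq_abs,
    abs_of_nonneg (fej_nonneg v)]
  have := (abs_le.1 (fej_le v)).2
  nlinarith [fej_sq v, Real.neg_one_le_cos v]

lemma fej_pos : 0 < ∫ v, fej v := by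
  apply integral_pos_of_integrable_nonneg_nonzero fej_cont fej_int fej_nonneg (x := 0)
  simp [fej]; exact tri_pos.ne'

lemma taub_step (B F : ℝ → ℝ) (c A : ℝ) (hc : 0 < c) (hB : ∀ x, 0 ≤ B x)
    (hmon : Monotone (fun x => Real.exp (c * x) * B x))
    (x0 : ℝ) (hx0 : ∀ x < x0, B x = 0)
    (hF : ∀ v, 0 ≤ F v) (hFi : Integrable F) (hFp : 0 < ∫ v, F v)
    (hi : ∀ l > 0, ∀ y, Integrable (fun v => B ((y - v) / l) * F v))
    (ht : ∀ l > 0, Tendsto (fun y => ∫ v, B ((y - v) / l) * F v) atTop (nhds (A * ∫ v, F v))) :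
    Tendsto B atTop (nhds A) := by
  have comp : ∀ q p d, q ≤ p → p - q ≤ d → B q * Real.exp (-(c * d)) ≤ B p := by
    intro q p d h1 h2
    have h := hmon h1
    simp only at h
    have e1 : Real.exp (-(c * d)) ≤ Real.exp (c * q) * Real.exp (- (c * p)) := by
      rw [← Real.exp_add, Real.exp_le_exp]; nlinarith
    calc B q * Real.exp (-(c * d)) ≤ B q * (Real.exp (c * q) * Real.exp (- (c * p))) :=
          mul_le_mul_of_nonneg_left e1 (hB q)
      _ = (Real.exp (c * q) * B q) * Real.exp (- (c * p)) := by ring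
      _ ≤ (Real.exp (c * p) * B p) * Real.exp (- (c * p)) := by gcongr
      _ = B p * (Real.exp (c * p) * Real.exp (- (c * p))) := by ring
      _ = B p := by rw [← Real.exp_add]; simp
  set C := ∫ v, F v with hC
  let CR : ℝ → ℝ := fun R => ∫ v in Set.Icc (-R) R, F v
  have hCR : Tendsto CR atTop (nhds C) :=
    (aecover_Icc tendsto_neg_atTop_atBot tendsto_id).integral_tendsto_of_countably_generated hFi
  have hexp : ∀ R : ℝ, Tendsto (fun l : ℝ => Real.exp (-(c * (2 * R / l)))) atTop (nhds 1) := by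
    intro R
    have : Tendsto (fun l : ℝ => -(c * (2 * R / l))) atTop (nhds (-(c * 0))) :=
      ((tendsto_const_nhds.div_atTop tendsto_id).const_mul c).neg
    have h := (Real.continuous_exp.tendsto _).comp this
    simpa [Function.comp_def] using h
  -- upper bound
  have upper : ∀ b, A < b → ∀ᶠ x in atTop, B x < b := by
    intro b hb
    have h1 : ∀ᶠ R in atTop, A * C < b * CR R := by
      apply (hCR.const_mul b).eventually_const_lt
      exact mul_lt_mul_of_pos_right hb hFp
    obtain ⟨R, hR, hRp⟩ := (h1.and (eventually_gt_atTop 0)).exists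
    have h2 : ∀ᶠ l in atTop, A * C < b * CR R * Real.exp (-(c * (2 * R / l))) := by
      apply ((hexp R).const_mul (b * CR R)).eventually_const_lt
      simpa using hR
    obtain ⟨l, hl, hlp⟩ := (h2.and (eventually_gt_atTop 0)).exists
    have h3 := (ht l hlp).eventually_lt_const hl
    have h4 : Tendsto (fun x : ℝ => l * x + R) atTop atTop :=
      tendsto_atTop_add_const_right _ _ (tendsto_id.const_mul_atTop hlp)
    filter_upwards [h4.eventually h3] with x hx
    have h5 : B x * Real.exp (-(c * (2 * R / l))) * CR R
        ≤ ∫ v, B ((l * x + R - v) / l) * F v := by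
      calc B x * Real.exp (-(c * (2 * R / l))) * CR R
          = ∫ v in Set.Icc (-R) R, B x * Real.exp (-(c * (2 * R / l))) * F v := by
            rw [integral_const_mul]
        _ ≤ ∫ v in Set.Icc (-R) R, B ((l * x + R - v) / l) * F v := by
            apply setIntegral_mono_on (hFi.integrableOn.const_mul _) (hi l hlp _).integrableOn
              measurableSet_Icc
            intro v hv
            apply mul_le_mul_of_nonneg_right _ (hF v)
            apply comp
            · rw [le_div_iff₀ hlp]; linarith [hv.2]
            · rw [sub_le_iff_le_add, div_le_iff₀ hlp]
              have : 2 * R / l * l = 2 * R := by field_simp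
              nlinarith [hv.1]
        _ ≤ _ := setIntegral_le_integral (hi l hlp _)
            (by filter_upwards with v; exact mul_nonneg (hB _) (hF v))
    have hCp : 0 ≤ CR R := setIntegral_nonneg measurableSet_Icc (fun v _ => hF v)
    by_contra! hbx
    have : b * Real.exp (-(c * (2 * R / l))) * CR R ≤ B x * Real.exp (-(c * (2 * R / l))) * CR R := by
      gcongr
    nlinarith
  -- boundedness
  obtain ⟨M, hM⟩ : ∃ M, ∀ x, B x ≤ M := by
    obtain ⟨X, hX⟩ := eventually_atTop.1 (upper (A + 1) (by linarith))
    refine ⟨max (A + 1) (B X * Real.exp (c * (X - x0))), fun x => ?_⟩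
    rcases le_or_gt X x with h | h
    · exact (hX x h).le.trans (le_max_left _ _)
    · refine le_trans ?_ (le_max_right _ _)
      rcases lt_or_ge x x0 with h' | h'
      · rw [hx0 x h']; exact mul_nonneg (hB _) (Real.exp_pos _).le
      · have := comp x X (X - x0) h.le (by linarith)
        rw [Real.exp_neg, ← div_eq_mul_inv, div_le_iff₀ (Real.exp_pos _)] at this
        exact this
  have lower : ∀ b, b < A → ∀ᶠ x in atTop, b < B x := by
    intro b hb
    have h1 : ∀ᶠ R in atTop, b * CR R + M * (C - CR R) < A * C := by
      have : Tendsto (fun R => b * CR R + M * (C - CR R)) atTop (nhds (b * C + M * (C - C))) :=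
        (hCR.const_mul b).add ((hCR.const_sub C).const_mul M)
      apply this.eventually_lt_const
      simpa using mul_lt_mul_of_pos_right hb hFp
    obtain ⟨R, hR, hRp⟩ := (h1.and (eventually_gt_atTop 0)).exists
    have h2 : ∀ᶠ l in atTop, b * (Real.exp (-(c * (2 * R / l))))⁻¹ * CR R + M * (C - CR R) < A * C := by
      have : Tendsto (fun l => b * (Real.exp (-(c * (2 * R / l))))⁻¹ * CR R + M * (C - CR R)) atTop
          (nhds (b * 1⁻¹ * CR R + M * (C - CR R))) :=
        (((((hexp R).inv₀ one_ne_zero).const_mul b)).mul_const _).add_const _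
      apply this.eventually_lt_const
      simpa using hR
    obtain ⟨l, hl, hlp⟩ := (h2.and (eventually_gt_atTop 0)).exists
    have h3 := (ht l hlp).eventually_const_lt hl
    have h4 : Tendsto (fun x : ℝ => l * x - R) atTop atTop :=
      tendsto_atTop_add_const_right _ _ (tendsto_id.const_mul_atTop hlp)
    filter_upwards [h4.eventually h3] with x hx
    have h5 : ∫ v, B ((l * x - R - v) / l) * F v
        ≤ B x * (Real.exp (-(c * (2 * R / l))))⁻¹ * CR R + M * (C - CR R) := by
      rw [← integral_add_compl (measurableSet_Icc (a := -R) (b := R)) (hi l hlp _)]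
      apply add_le_add
      · calc _ ≤ ∫ v in Set.Icc (-R) R, B x * (Real.exp (-(c * (2 * R / l))))⁻¹ * F v := by
              apply setIntegral_mono_on (hi l hlp _).integrableOn (hFi.integrableOn.const_mul _)
                measurableSet_Icc
              intro v hv
              apply mul_le_mul_of_nonneg_right _ (hF v)
              rw [← div_eq_mul_inv, le_div_iff₀ (Real.exp_pos _)]
              apply comp
              · rw [div_le_iff₀ hlp]; linarith [hv.1]
              · rw [sub_le_comm, le_div_iff₀ hlp]
                have : 2 * R / l * l = 2 * R := by field_simp
                nlinarith [hv.2]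
          _ = _ := by rw [integral_const_mul]
      · calc _ ≤ ∫ v in (Set.Icc (-R) R)ᶜ, M * F v := by
              apply setIntegral_mono_on (hi l hlp _).integrableOn (hFi.integrableOn.const_mul _)
                measurableSet_Icc.compl
              intro v hv
              exact mul_le_mul_of_nonneg_right (hM _) (hF v)
          _ = _ := by
            rw [integral_const_mul, setIntegral_compl measurableSet_Icc hFi]
    have hCp : 0 ≤ CR R := setIntegral_nonneg measurableSet_Icc (fun v _ => hF v)
    by_contra! hbx
    have : B x * (Real.exp (-(c * (2 * R / l))))⁻¹ * CR R ≤ b * (Real.exp (-(c * (2 * R / l))))⁻¹ * CR R := by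
      gcongr
    linarith
  exact tendsto_order.2 ⟨lower, upper⟩

lemma fubini_fej (h : ℝ → ℝ) (hh : Integrable h) (y : ℝ) :
    ∫ t : ℝ, (tri t : ℂ) * Complex.exp (Complex.I * t * y) *
      (∫ x : ℝ, (h x : ℂ) * Complex.exp (-(Complex.I * t * x)))
      = ((∫ x, h x * fej (y - x) : ℝ) : ℂ) := by
  have e1 : ∀ t : ℝ, (tri t : ℂ) * Complex.exp (Complex.I * t * y) *
      (∫ x : ℝ, (h x : ℂ) * Complex.exp (-(Complex.I * t * x)))
      = ∫ x : ℝ, ((tri t : ℂ) * (h x : ℂ)) * Complex.exp (Complex.I * t * ((y - x : ℝ) : ℂ)) := by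
    intro t
    rw [← integral_const_mul]
    congr 1; ext x
    rw [show Complex.I * t * ((y - x : ℝ) : ℂ) = Complex.I * t * y + (-(Complex.I * t * x)) by
      push_cast; ring, Complex.exp_add]
    ring
  simp_rw [e1]
  rw [integral_integral_swap]
  · rw [← integral_complex_ofReal]
    congr 1; ext x
    push_cast
    rw [← Complex.ofReal_sub, ← fej_exp, ← integral_const_mul]
    congr 1; ext t; ring
  · have : Integrable (fun p : ℝ × ℝ => (tri p.1 : ℂ) * (h p.2 : ℂ)) (volume.prod volume) :=
      tri_int.ofReal.mul_prod hh.ofReal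
    refine this.mul_bdd (c := 1) ?_ ?_
    · apply Continuous.aestronglyMeasurable; fun_prop
    · filter_upwards with p
      rw [show Complex.I * (p.1 : ℂ) * ((y - p.2 : ℝ) : ℂ) = ((p.1 * (y - p.2) : ℝ) : ℂ) * Complex.I by
        push_cast; ring, Complex.norm_exp_ofReal_mul_I]

lemma key (B : ℝ → ℝ) (hB : ∀ x, 0 ≤ B x) (hBm : Measurable B)
    (x0 : ℝ) (hx0 : ∀ x < x0, B x = 0)
    (hBexp : ∀ s : ℝ, 0 < s → Integrable (fun x => B x * Real.exp (-(s * x))))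
    (A : ℝ) (g : ℂ → ℂ) (hg : ContinuousOn g {z : ℂ | 0 ≤ z.re})
    (hgB : ∀ z : ℂ, 0 < z.re → ∫ x : ℝ, (B x : ℂ) * Complex.exp (-(z * x)) = A / z + g z) :
    (∀ y, Integrable (fun x => B x * fej (y - x))) ∧
    Tendsto (fun y => ∫ x, B x * fej (y - x)) atTop (nhds (A * ∫ v, fej v)) := by
  -- Heaviside
  let H : ℝ → ℝ := Set.indicator (Set.Ioi 0) 1
  have H0 : ∀ x, 0 ≤ H x := fun x => Set.indicator_nonneg (by simp) x
  have H1 : ∀ x, H x ≤ 1 := by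
    intro x
    by_cases hx : x ∈ Set.Ioi (0:ℝ)
    · simp [H, Set.indicator_of_mem hx]
    · simp [H, Set.indicator_of_notMem hx]
  have Hm : Measurable H := measurable_one.indicator measurableSet_Ioi
  have hHexp : ∀ s : ℝ, 0 < s → Integrable (fun x => H x * Real.exp (-(s * x))) := by
    intro s hs
    have := integrableOn_exp_mul_Ioi (a := -s) (by linarith) 0
    rw [← integrable_indicator_iff measurableSet_Ioi] at this
    refine this.congr ?_
    filter_upwards with x
    by_cases hx : x ∈ Set.Ioi (0:ℝ)
    · simp [H, Set.indicator_of_mem hx]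
    · simp [H, Set.indicator_of_notMem hx]
  have HL : ∀ z : ℂ, 0 < z.re → ∫ x : ℝ, (H x : ℂ) * Complex.exp (-(z * x)) = 1 / z := by
    intro z hz
    have := integral_exp_mul_complex_Ioi (a := -z) (by simpa using hz) 0
    rw [← integral_indicator measurableSet_Ioi] at this
    have h2 : (fun x : ℝ => (H x : ℂ) * Complex.exp (-(z * x)))
        = (Set.Ioi (0:ℝ)).indicator (fun x : ℝ => Complex.exp (-z * x)) := by
      ext x
      by_cases hx : x ∈ Set.Ioi (0:ℝ)
      · simp [H, Set.indicator_of_mem hx]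
      · simp [H, Set.indicator_of_notMem hx]
    rw [h2, this]; simp
  -- identity for s > 0
  have hident : ∀ s : ℝ, 0 < s → ∀ y : ℝ,
      ∫ t : ℝ, (tri t : ℂ) * Complex.exp (Complex.I * t * y) * g (s + Complex.I * t)
      = (((∫ x, B x * Real.exp (-(s * x)) * fej (y - x))
        - A * ∫ x, H x * Real.exp (-(s * x)) * fej (y - x) : ℝ) : ℂ) := by
    intro s hs y
    have hi := (hBexp s hs).sub ((hHexp s hs).const_mul A)
    have f1 := fubini_fej _ hi y
    have e2 : ∀ t : ℝ, ∫ x : ℝ, ((((fun x => B x * Real.exp (-(s * x))) -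
        (fun x => A * (H x * Real.exp (-(s * x))))) x : ℝ) : ℂ) *
        Complex.exp (-(Complex.I * t * x)) = g (s + Complex.I * t) := by
      intro t
      have hz : 0 < ((s : ℂ) + Complex.I * t).re := by simpa using hs
      have a1 := hgB _ hz
      have a2 := HL _ hz
      have unim : ∀ x : ℝ, ‖Complex.exp (-(Complex.I * t * x))‖ ≤ 1 := by
        intro x
        rw [show -(Complex.I * (t : ℂ) * x) = ((-(t * x) : ℝ) : ℂ) * Complex.I by
          push_cast; ring, Complex.norm_exp_ofReal_mul_I]
      have b1 : ∀ u : ℝ → ℝ, Integrable (fun x => u x * Real.exp (-(s * x))) →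
          Integrable (fun x : ℝ => (u x : ℂ) * Complex.exp (-((s + Complex.I * t) * x))) := by
        intro u hu
        have := (hu.ofReal (𝕜 := ℂ)).mul_bdd (c := 1) (g := fun x : ℝ => Complex.exp (-(Complex.I * t * x)))
          (by apply Continuous.aestronglyMeasurable; fun_prop)
          (by filter_upwards with x; exact unim x)
        refine this.congr ?_
        filter_upwards with x
        rw [show -((s + Complex.I * t) * (x : ℂ)) = -(s * x) + -(Complex.I * t * x) by ring,
          Complex.exp_add]
        simp only [Complex.coe_algebraMap]
        push_cast
        ring
      have : g (s + Complex.I * t) = (∫ x : ℝ, (B x : ℂ) * Complex.exp (-((s + Complex.I * t) * x)))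
        - A * ∫ x : ℝ, (H x : ℂ) * Complex.exp (-((s + Complex.I * t) * x)) := by
        rw [a1, a2]; ring
      rw [this, ← integral_const_mul, ← integral_sub (b1 B (hBexp s hs)) ((b1 H (hHexp s hs)).const_mul _)]
      congr 1; ext x
      rw [show -((s + Complex.I * t) * (x : ℂ)) = -(s * x) + -(Complex.I * t * x) by ring,
          Complex.exp_add]
      simp only [Pi.sub_apply]
      push_cast
      ring
    simp_rw [e2] at f1
    rw [f1]
    congr 1
    have bdd : ∀ u : ℝ → ℝ, Integrable u → Integrable (fun x => u x * fej (y - x)) := by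
      intro u hu
      refine hu.mul_bdd (c := ∫ t, tri t) ?_ ?_
      · exact (fej_cont.comp (by fun_prop)).aestronglyMeasurable
      · filter_upwards with x; exact fej_le _
    rw [← integral_const_mul, ← integral_sub (bdd _ (hBexp s hs)) ((bdd _ (hHexp s hs)).const_mul A)]
    congr 1; ext x
    simp only [Pi.sub_apply]; ring
  let σ : ℕ → ℝ := fun n => 1 / ((n : ℝ) + 1)
  have σpos : ∀ n, 0 < σ n := fun n => by positivity
  have σle : ∀ n, σ n ≤ 1 := fun n => by
    simp only [σ]; rw [div_le_one (by positivity)]; linarith [n.cast_nonneg (α := ℝ)]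
  have σlim : Tendsto σ atTop (nhds 0) := tendsto_one_div_add_atTop_nhds_zero_nat
  have explim : ∀ x : ℝ, Tendsto (fun n => Real.exp (-(σ n * x))) atTop (nhds 1) := by
    intro x
    have : Tendsto (fun n => -(σ n * x)) atTop (nhds (-(0 * x))) := (σlim.mul_const x).neg
    simpa [Function.comp_def] using (Real.continuous_exp.tendsto _).comp this
  have fi : ∀ y, Integrable (fun x => fej (y - x)) := fun y => fej_int.comp_sub_left y
  -- limits
  have limL : ∀ y : ℝ, Tendsto (fun n => ∫ t : ℝ, (tri t : ℂ) * Complex.exp (Complex.I * t * y) *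
      g (σ n + Complex.I * t)) atTop
      (nhds (∫ t : ℝ, (tri t : ℂ) * Complex.exp (Complex.I * t * y) * g (Complex.I * t))) := by
    intro y
    obtain ⟨M, hM⟩ : ∃ M, ∀ z ∈ (Set.Icc (0:ℝ) 1 ×ℂ Set.Icc (-1:ℝ) 1), ‖g z‖ ≤ M := by
      apply (isCompact_Icc.reProdIm isCompact_Icc).exists_bound_of_continuousOn
      apply hg.mono
      intro z hz
      exact hz.1.1
    apply tendsto_integral_of_dominated_convergence (fun t => tri t * M)
    · intro n
      have gc : Continuous (fun t : ℝ => g (σ n + Complex.I * t)) := by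
        apply hg.comp_continuous (by fun_prop)
        intro t; simpa using (σpos n).le
      have tc := tri_cont
      exact (((Complex.continuous_ofReal.comp tc).mul (by fun_prop)).mul gc).aestronglyMeasurable
    · exact tri_int.mul_const M
    · intro n
      filter_upwards with t
      rw [norm_mul, norm_mul, show Complex.I * (t : ℂ) * y = ((t * y : ℝ) : ℂ) * Complex.I by
          push_cast; ring, Complex.norm_exp_ofReal_mul_I, mul_one, Complex.norm_real,
          Real.norm_eq_abs, abs_of_nonneg (tri_nonneg t)]
      by_cases ht : 1 < |t|
      · rw [tri_zero ht]; simp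
      · apply mul_le_mul_of_nonneg_left _ (tri_nonneg t)
        apply hM
        have := abs_le.1 (not_lt.1 ht)
        rw [Complex.mem_reProdIm]
        simp only [Complex.add_re, Complex.ofReal_re, Complex.mul_re, Complex.I_re, Complex.I_im,
          Complex.ofReal_im, Complex.add_im, Complex.mul_im]
        simp
        exact ⟨⟨(σpos n).le, σle n⟩, this⟩
    · filter_upwards with t
      apply Tendsto.const_mul
      have h1 : ContinuousWithinAt g {z : ℂ | 0 ≤ z.re} (Complex.I * t) := hg _ (by simp)
      apply h1.tendsto.comp
      apply tendsto_nhdsWithin_iff.2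
      constructor
      · have h2 : Tendsto (fun n => ((σ n : ℝ) : ℂ) + Complex.I * t) atTop
            (nhds (((0 : ℝ) : ℂ) + Complex.I * t)) :=
          ((Complex.continuous_ofReal.tendsto 0).comp σlim).add_const _
        simpa using h2
      · filter_upwards with n
        simpa using (σpos n).le
  have limH : ∀ y : ℝ, Tendsto (fun n => ∫ x, H x * Real.exp (-(σ n * x)) * fej (y - x)) atTop
      (nhds (∫ x, H x * fej (y - x))) := by
    intro y
    apply tendsto_integral_of_dominated_convergence (fun x => fej (y - x))
    · intro n
      have := fej_cont.measurable
      apply Measurable.aestronglyMeasurable; fun_prop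
    · exact fi y
    · intro n
      filter_upwards with x
      rw [norm_mul, Real.norm_eq_abs, Real.norm_eq_abs, abs_of_nonneg (fej_nonneg _), abs_of_nonneg
        (mul_nonneg (H0 x) (Real.exp_pos _).le)]
      apply mul_le_of_le_one_left (fej_nonneg _)
      by_cases hx : x ∈ Set.Ioi (0:ℝ)
      · apply mul_le_one₀ (H1 x) (Real.exp_pos _).le
        rw [Real.exp_le_one_iff]
        have := mul_pos (σpos n) hx
        linarith
      · simp [H, Set.indicator_of_notMem hx]
    · filter_upwards with x
      have := ((explim x).const_mul (H x)).mul_const (fej (y - x))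
      simpa using this
  have limB : ∀ y : ℝ, Tendsto (fun n => ∫ x, B x * Real.exp (-(σ n * x)) * fej (y - x)) atTop
      (nhds ((∫ t : ℝ, (tri t : ℂ) * Complex.exp (Complex.I * t * y) * g (Complex.I * t)).re
        + A * ∫ x, H x * fej (y - x))) := by
    intro y
    have h1 := (Complex.continuous_re.tendsto _).comp (limL y)
    have h2 := h1.add ((limH y).const_mul A)
    refine h2.congr fun n => ?_
    simp only [Function.comp]
    rw [hident _ (σpos n) y, Complex.ofReal_re]
    ring
  have bdd : ∀ y, ∀ u : ℝ → ℝ, Integrable u → Integrable (fun x => u x * fej (y - x)) := by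
    intro y u hu
    refine hu.mul_bdd (c := ∫ t, tri t) ?_ ?_
    · exact (fej_cont.comp (by fun_prop)).aestronglyMeasurable
    · filter_upwards with x; exact fej_le _
  have Bint : ∀ y, Integrable (fun x => B x * fej (y - x)) := by
    intro y
    apply integrable_of_tendsto (G := fun n x => B x * Real.exp (-(σ n * x)) * fej (y - x))
    · filter_upwards with x
      have := ((explim x).const_mul (B x)).mul_const (fej (y - x))
      simpa using this
    · intro n; exact (bdd y _ (hBexp _ (σpos n))).1
    · have e : ∀ n, ∫⁻ x, ‖B x * Real.exp (-(σ n * x)) * fej (y - x)‖ₑ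
          = ENNReal.ofReal (∫ x, B x * Real.exp (-(σ n * x)) * fej (y - x)) := by
        intro n
        rw [ofReal_integral_eq_lintegral_ofReal (bdd y _ (hBexp _ (σpos n)))]
        · congr 1; ext x
          rw [Real.enorm_of_nonneg]
          exact mul_nonneg (mul_nonneg (hB x) (Real.exp_pos _).le) (fej_nonneg _)
        · filter_upwards with x
          exact mul_nonneg (mul_nonneg (hB x) (Real.exp_pos _).le) (fej_nonneg _)
      simp_rw [e]
      rw [(ENNReal.tendsto_ofReal (limB y)).liminf_eq]
      exact ENNReal.ofReal_ne_top
  have limB' : ∀ y : ℝ, Tendsto (fun n => ∫ x, B x * Real.exp (-(σ n * x)) * fej (y - x)) atTop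
      (nhds (∫ x, B x * fej (y - x))) := by
    intro y
    apply tendsto_integral_of_dominated_convergence (fun x => Real.exp |x0| * (B x * fej (y - x)))
    · intro n; exact (bdd y _ (hBexp _ (σpos n))).1
    · exact (Bint y).const_mul _
    · intro n
      filter_upwards with x
      rw [Real.norm_eq_abs, abs_of_nonneg
        (mul_nonneg (mul_nonneg (hB x) (Real.exp_pos _).le) (fej_nonneg _))]
      rcases lt_or_ge x x0 with h | h
      · rw [hx0 x h]; simp
      · have : Real.exp (-(σ n * x)) ≤ Real.exp |x0| := by
          rw [Real.exp_le_exp]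
          have a1 : -x ≤ |x0| := by linarith [neg_abs_le x0]
          nlinarith [σpos n, σle n, abs_nonneg x0]
        calc B x * Real.exp (-(σ n * x)) * fej (y - x)
            = Real.exp (-(σ n * x)) * (B x * fej (y - x)) := by ring
          _ ≤ _ := mul_le_mul_of_nonneg_right this (mul_nonneg (hB x) (fej_nonneg _))
    · filter_upwards with x
      have := ((explim x).const_mul (B x)).mul_const (fej (y - x))
      simpa using this
  have hfinal : ∀ y, ∫ x, B x * fej (y - x) =
      (∫ t : ℝ, (tri t : ℂ) * Complex.exp (Complex.I * t * y) * g (Complex.I * t)).re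
        + A * ∫ x, H x * fej (y - x) := fun y => tendsto_nhds_unique (limB' y) (limB y)
  refine ⟨Bint, ?_⟩
  simp_rw [hfinal]
  rw [← zero_add (A * _)]
  apply Tendsto.add
  · have rl := Real.tendsto_integral_exp_smul_cocompact
      (fun t : ℝ => (tri t : ℂ) * g (Complex.I * t))
    have sc : Tendsto (fun y : ℝ => -(1 / (2 * Real.pi)) * y) atTop (cocompact ℝ) := by
      refine Tendsto.mono_right ?_ atBot_le_cocompact
      apply tendsto_id.const_mul_atTop_of_neg
      have := Real.pi_pos
      have : 0 < 1 / (2 * Real.pi) := by positivity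
      linarith
    have h := (Complex.continuous_re.tendsto _).comp (rl.comp sc)
    simp only [Complex.zero_re] at h
    refine h.congr fun y => ?_
    simp only [Function.comp]
    congr 2; ext t
    rw [Circle.smul_def, Real.fourierChar_apply, smul_eq_mul]
    have : ((2 * Real.pi * -(t * (-(1 / (2 * Real.pi)) * y)) : ℝ) : ℂ) * Complex.I
        = Complex.I * t * y := by
      rw [show 2 * Real.pi * -(t * (-(1 / (2 * Real.pi)) * y)) = t * y by
        have := Real.pi_pos
        field_simp]
      push_cast; ring
    rw [this]; ring
  · apply Tendsto.const_mul
    have := (aecover_Iio (μ := (volume : Measure ℝ)) (tendsto_id (α := ℝ) (x := atTop))).integral_tendsto_of_countably_generated fej_int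
    refine this.congr fun y => ?_
    rw [← integral_indicator measurableSet_Iio, ← integral_sub_left_eq_self _ volume y]
    congr 1; ext x
    by_cases hx : x ∈ Set.Ioi (0:ℝ)
    · rw [Set.indicator_of_mem (by simpa using hx)]
      simp [H, Set.indicator_of_mem hx]
    · rw [Set.indicator_of_notMem (by simpa using hx)]
      simp [H, Set.indicator_of_notMem hx]

lemma key_scaled (B : ℝ → ℝ) (hB : ∀ x, 0 ≤ B x) (hBm : Measurable B)
    (x0 : ℝ) (hx0 : ∀ x < x0, B x = 0)
    (hBexp : ∀ s : ℝ, 0 < s → Integrable (fun x => B x * Real.exp (-(s * x))))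
    (A : ℝ) (g : ℂ → ℂ) (hg : ContinuousOn g {z : ℂ | 0 ≤ z.re})
    (hgB : ∀ z : ℂ, 0 < z.re → ∫ x : ℝ, (B x : ℂ) * Complex.exp (-(z * x)) = A / z + g z)
    (l : ℝ) (hl : 0 < l) :
    (∀ y, Integrable (fun v => B ((y - v) / l) * fej v)) ∧
    Tendsto (fun y => ∫ v, B ((y - v) / l) * fej v) atTop (nhds (A * ∫ v, fej v)) := by
  have hlC : (l : ℂ) ≠ 0 := by exact_mod_cast hl.ne'
  have := key (fun x => B (x / l)) (fun x => hB _) (hBm.comp (by fun_prop)) (l * x0)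
    (fun x hx => hx0 _ (by rw [div_lt_iff₀ hl]; linarith))
    (by
      intro s hs
      refine ((hBexp (l * s) (by positivity)).comp_div hl.ne').congr ?_
      filter_upwards with x
      congr 3
      field_simp)
    A (fun z => l * g (l * z))
    (by
      apply ContinuousOn.mul continuousOn_const
      apply hg.comp (by fun_prop)
      intro z hz
      simp only [Set.mem_setOf_eq, Complex.mul_re, Complex.ofReal_re, Complex.ofReal_im] at hz ⊢
      have := mul_nonneg hl.le hz
      linarith)
    (by
      intro z hz
      have h1 := Measure.integral_comp_div (fun x : ℝ => (B x : ℂ) * Complex.exp (-(l * z * x))) l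
      rw [hgB (l * z) (by simpa using mul_pos hl hz), abs_of_pos hl] at h1
      have hz0 : z ≠ 0 := by rintro rfl; simp at hz
      calc _ = ∫ x : ℝ, ((B (x / l) : ℝ) : ℂ) * Complex.exp (-(l * z * ((x / l : ℝ) : ℂ))) := by
            congr 1; ext x
            congr 3
            push_cast
            field_simp
        _ = _ := by
            rw [h1, Complex.real_smul]
            field_simp)
  constructor
  · intro y
    have h := (this.1 y).comp_sub_left y
    simpa using h
  · refine this.2.congr fun y => ?_
    rw [← integral_sub_left_eq_self _ volume y]
    simp

section Main

variable (c : ℝ) (lam m : ℕ → ℝ)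

noncomputable def cnt (x : ℝ) : ℝ := ∑' i, if lam i ≤ x then m i else 0

lemma cnt_summable (htop : Tendsto lam atTop atTop) (x : ℝ) :
    Summable (fun i => if lam i ≤ x then m i else 0) := by
  have hfin : {i | lam i ≤ x}.Finite := by
    obtain ⟨n, hn⟩ := eventually_atTop.1 (htop.eventually_gt_atTop x)
    refine (Set.finite_lt_nat n).subset fun i hi => ?_
    by_contra h
    exact absurd (hn i (not_lt.1 h)) (not_lt.2 hi)
  apply summable_of_hasFiniteSupport
  refine hfin.subset fun i hi => ?_
  by_contra h
  exact hi (if_neg h)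

lemma cnt_mono (htop : Tendsto lam atTop atTop) (hm : ∀ i, 0 ≤ m i) : Monotone (cnt lam m) := by
  intro x y hxy
  apply (cnt_summable lam m htop x).tsum_le_tsum _ (cnt_summable lam m htop y)
  intro i
  by_cases h : lam i ≤ x
  · simp [h, h.trans hxy]
  · simp only [h, if_false]
    split_ifs
    · exact hm i
    · exact le_rfl

lemma cnt_nonneg (hm : ∀ i, 0 ≤ m i) (x : ℝ) : 0 ≤ cnt lam m x := by
  apply tsum_nonneg
  intro i
  split_ifs
  · exact hm i
  · exact le_rfl

lemma term_real (a M s : ℝ) (ha : 0 < a) (hs : 0 < s) :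
    Integrable (fun x => (if a ≤ Real.exp x then M else 0) * Real.exp (-(s * x))) ∧
    ∫ x, (if a ≤ Real.exp x then M else 0) * Real.exp (-(s * x)) = M * a ^ (-s) / s := by
  have e : (fun x => (if a ≤ Real.exp x then M else 0) * Real.exp (-(s * x)))
      = (Set.Ici (Real.log a)).indicator (fun x => M * Real.exp (-s * x)) := by
    ext x
    by_cases h : a ≤ Real.exp x
    · rw [Set.indicator_of_mem (by simpa [Real.log_le_iff_le_exp ha] using h)]
      simp [h]
    · rw [Set.indicator_of_notMem (by simpa [Real.log_le_iff_le_exp ha] using h)]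
      simp [h]
  rw [e, integrable_indicator_iff measurableSet_Ici, integral_indicator measurableSet_Ici,
    integrableOn_Ici_iff_integrableOn_Ioi, integral_Ici_eq_integral_Ioi, integral_const_mul,
    integral_exp_mul_Ioi (by linarith)]
  refine ⟨(integrableOn_exp_mul_Ioi (by linarith) _).const_mul _, ?_⟩
  rw [Real.rpow_def_of_pos ha, mul_comm (Real.log a)]
  field_simp

lemma term_complex (a M : ℝ) (s : ℂ) (ha : 0 < a) (hs : 0 < s.re) :
    Integrable (fun x : ℝ => ((if a ≤ Real.exp x then M else 0 : ℝ) : ℂ) * Complex.exp (-(s * x))) ∧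
    ∫ x : ℝ, ((if a ≤ Real.exp x then M else 0 : ℝ) : ℂ) * Complex.exp (-(s * x))
      = M * (a : ℂ) ^ (-s) / s := by
  have e : (fun x : ℝ => ((if a ≤ Real.exp x then M else 0 : ℝ) : ℂ) * Complex.exp (-(s * x)))
      = (Set.Ici (Real.log a)).indicator (fun x : ℝ => M * Complex.exp (-s * x)) := by
    ext x
    by_cases h : a ≤ Real.exp x
    · rw [Set.indicator_of_mem (by simpa [Real.log_le_iff_le_exp ha] using h)]
      simp [h]
    · rw [Set.indicator_of_notMem (by simpa [Real.log_le_iff_le_exp ha] using h)]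
      simp [h]
  have hs' : (-s).re < 0 := by simpa using hs
  have hs0 : s ≠ 0 := by rintro rfl; simp at hs
  rw [e, integrable_indicator_iff measurableSet_Ici, integral_indicator measurableSet_Ici,
    integrableOn_Ici_iff_integrableOn_Ioi, integral_Ici_eq_integral_Ioi, integral_const_mul,
    integral_exp_mul_complex_Ioi hs']
  refine ⟨(integrableOn_exp_mul_complex_Ioi hs' _).const_mul _, ?_⟩
  rw [Complex.cpow_def_of_ne_zero (by exact_mod_cast ha.ne'), ← Complex.ofReal_log ha.le,
    mul_comm (Real.log a : ℂ)]
  field_simp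

lemma cnt_integrable (htop : Tendsto lam atTop atTop) (hpos : ∀ i, 0 < lam i) (hm : ∀ i, 0 ≤ m i)
    (s : ℝ) (hs : 0 < s) (hsum : Summable (fun i => m i * lam i ^ (-s))) :
    Integrable (fun x => cnt lam m (Real.exp x) * Real.exp (-(s * x))) := by
  let T : ℕ → ℝ → ℝ := fun i x => (if lam i ≤ Real.exp x then m i else 0) * Real.exp (-(s * x))
  have T0 : ∀ i x, 0 ≤ T i x := by
    intro i x
    apply mul_nonneg _ (Real.exp_pos _).le
    split_ifs
    · exact hm i
    · exact le_rfl
  have Ti : ∀ i, Integrable (T i) := fun i => (term_real _ _ s (hpos i) hs).1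
  have Gi : ∀ n, Integrable (fun x => ∑ i ∈ Finset.range n, T i x) :=
    fun n => integrable_finsetSum _ fun i _ => Ti i
  apply integrable_of_tendsto (G := fun n x => ∑ i ∈ Finset.range n, T i x)
  · filter_upwards with x
    have := (cnt_summable lam m htop (Real.exp x)).hasSum.mul_right (Real.exp (-(s * x)))
    exact this.tendsto_sum_nat
  · intro n; exact (Gi n).1
  · have e : ∀ n, ∫⁻ x, ‖∑ i ∈ Finset.range n, T i x‖ₑ
        = ENNReal.ofReal (∑ i ∈ Finset.range n, m i * lam i ^ (-s) / s) := by
      intro n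
      have : ∑ i ∈ Finset.range n, m i * lam i ^ (-s) / s
          = ∫ x, ∑ i ∈ Finset.range n, T i x := by
        rw [integral_finsetSum _ fun i _ => Ti i]
        exact Finset.sum_congr rfl fun i _ => (term_real _ _ s (hpos i) hs).2.symm
      rw [this, ofReal_integral_eq_lintegral_ofReal (Gi n)]
      · congr 1; ext x
        rw [Real.enorm_of_nonneg (Finset.sum_nonneg fun i _ => T0 i x)]
      · filter_upwards with x
        exact Finset.sum_nonneg fun i _ => T0 i x
    simp_rw [e]
    rw [(ENNReal.tendsto_ofReal (hsum.div_const s).hasSum.tendsto_sum_nat).liminf_eq]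
    exact ENNReal.ofReal_ne_top

lemma cnt_laplace (hpos : ∀ i, 0 < lam i)
    (hm : ∀ i, 0 ≤ m i)
    (s : ℂ) (hs : 0 < s.re) (hsum : Summable (fun i => m i * lam i ^ (-s.re))) (F : ℂ)
    (hF : HasSum (fun i => (m i : ℂ) * (lam i : ℂ) ^ (-s)) F) :
    ∫ x : ℝ, (cnt lam m (Real.exp x) : ℂ) * Complex.exp (-(s * x)) = F / s := by
  have h := hasSum_integral_of_summable_integral_norm (μ := (volume : Measure ℝ))
    (F := fun i (x : ℝ) => ((if lam i ≤ Real.exp x then m i else 0 : ℝ) : ℂ) * Complex.exp (-(s * x)))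
    (fun i => (term_complex _ _ s (hpos i) hs).1)
    (by
      refine (hsum.div_const s.re).congr fun i => ?_
      rw [← (term_real _ _ s.re (hpos i) hs).2]
      congr 1; ext x
      rw [norm_mul, Complex.norm_exp, Complex.norm_real, Real.norm_of_nonneg]
      · simp
      · split_ifs
        · exact hm i
        · exact le_rfl)
  have e1 : ∀ x : ℝ, ∑' i, ((if lam i ≤ Real.exp x then m i else 0 : ℝ) : ℂ) * Complex.exp (-(s * x))
      = (cnt lam m (Real.exp x) : ℂ) * Complex.exp (-(s * x)) := by
    intro x
    rw [tsum_mul_right, ← Complex.ofReal_tsum]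
    rfl
  simp_rw [e1] at h
  refine h.unique ?_
  refine (hF.div_const s).congr_fun ?_
  intro i
  exact (term_complex _ _ s (hpos i) hs).2

end Main

/-- Tauberian theorem for Dirichlet series with a simple pole at `c`: if the
Dirichlet series `f(s) = Σ m_i λ_i^{-s}` converges for `s > c`, extends
analytically to the half-plane `Re z > c`, and `f(z) - K/(z-c)` extends
continuously to `Re z ≥ c`, then the counting function
`N(λ) = Σ_{λ_i ≤ λ} m_i` satisfies `N(λ)/λ^c → K/c`. -/
theorem dirichlet_series_tauberian
    (c : ℝ) (hc : 0 < c)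
    (lam : ℕ → ℝ) (hmono : Monotone lam) (hpos : ∀ i, 0 < lam i)
    (htop : Tendsto lam atTop atTop)
    (m : ℕ → ℝ) (hm : ∀ i, 0 ≤ m i)
    (hsum : ∀ s : ℝ, c < s → Summable (fun i => m i * lam i ^ (-s)))
    (f : ℂ → ℂ) (hf : DifferentiableOn ℂ f {z : ℂ | c < z.re})
    (hfsum : ∀ z : ℂ, c < z.re →
      HasSum (fun i => (m i : ℂ) * (lam i : ℂ) ^ (-z)) (f z))
    (K : ℝ) (G : ℂ → ℂ) (hG : ContinuousOn G {z : ℂ | c ≤ z.re})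
    (hGf : ∀ z : ℂ, c < z.re → G z = f z - (K : ℂ) / (z - (c : ℂ))) :
    Tendsto (fun lamb : ℝ =>
        (∑' i, if lam i ≤ lamb then m i else 0) / lamb ^ c)
      atTop (nhds (K / c)) := by
  have lam0 := hpos 0
  let B : ℝ → ℝ := fun x => cnt lam m (Real.exp x) * Real.exp (-(c * x))
  have hBmon : Monotone (fun x => Real.exp (c * x) * B x) := by
    have : (fun x => Real.exp (c * x) * B x) = fun x => cnt lam m (Real.exp x) := by
      ext x
      simp only [B]
      rw [Real.exp_neg]
      field_simp
    rw [this]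
    exact (cnt_mono lam m htop hm).comp Real.exp_monotone
  have hB0 : ∀ x, 0 ≤ B x := fun x => mul_nonneg (cnt_nonneg lam m hm _) (Real.exp_pos _).le
  have hBm : Measurable B :=
    ((cnt_mono lam m htop hm).comp Real.exp_monotone).measurable.mul (by fun_prop)
  have hBx : ∀ x < Real.log (lam 0), B x = 0 := by
    intro x hx
    have : cnt lam m (Real.exp x) = 0 := by
      unfold cnt
      convert tsum_zero with i
      rw [if_neg]
      rw [not_le]
      exact ((Real.lt_log_iff_exp_lt lam0).1 hx).trans_le (hmono (Nat.zero_le i))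
    simp [B, this]
  have hBi : ∀ s : ℝ, 0 < s → Integrable (fun x => B x * Real.exp (-(s * x))) := by
    intro s hs
    refine (cnt_integrable lam m htop hpos hm (c + s) (by linarith)
      (hsum _ (by linarith))).congr ?_
    filter_upwards with x
    simp only [B]
    rw [mul_assoc, ← Real.exp_add]
    congr 2; ring
  have hcC : (c : ℂ) ≠ 0 := by exact_mod_cast hc.ne'
  have hzc : ∀ z : ℂ, 0 ≤ z.re → z + c ≠ 0 := by
    intro z hz h
    have := congrArg Complex.re h
    simp at this
    linarith
  have hcont : ContinuousOn (fun z : ℂ => (G (z + c) - K / c) / (z + c)) {z : ℂ | 0 ≤ z.re} := by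
    apply ContinuousOn.div
    · apply ContinuousOn.sub _ continuousOn_const
      apply hG.comp (by fun_prop)
      intro z hz
      simpa using hz
    · fun_prop
    · exact hzc
  have hlap : ∀ z : ℂ, 0 < z.re → ∫ x : ℝ, (B x : ℂ) * Complex.exp (-(z * x))
      = ((K / c : ℝ) : ℂ) / z + (G (z + c) - K / c) / (z + c) := by
    intro z hz
    have hz0 : z ≠ 0 := by rintro rfl; simp at hz
    have hre : (z + c).re = z.re + c := by simp
    have hre' : c < (z + c).re := by rw [hre]; linarith
    have h1 := cnt_laplace lam m hpos hm (z + c) (by linarith) (hsum _ hre') _ (hfsum _ hre')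
    have h2 := hGf _ hre'
    have h3 : f (z + c) = G (z + c) + K / z := by rw [h2]; simp
    rw [h3] at h1
    have h4 := hzc z hz.le
    calc _ = ∫ x : ℝ, (cnt lam m (Real.exp x) : ℂ) * Complex.exp (-((z + c) * x)) := by
          congr 1; ext x
          simp only [B]
          push_cast
          rw [mul_assoc, ← Complex.exp_add]
          congr 2; ring
      _ = _ := by
          rw [h1]
          push_cast
          field_simp
          ring
  have hks := key_scaled B hB0 hBm _ hBx hBi (K / c) _ hcont hlap
  have hlim := taub_step B fej c (K / c) hc hB0 hBmon _ hBx fej_nonneg fej_int fej_pos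
    (fun l hl => (hks l hl).1) (fun l hl => (hks l hl).2)
  refine (hlim.comp Real.tendsto_log_atTop).congr' ?_
  filter_upwards [eventually_gt_atTop 0] with x hx
  simp only [Function.comp, B, cnt]
  rw [Real.exp_log hx, Real.exp_neg, ← div_eq_mul_inv, Real.rpow_def_of_pos hx,
    mul_comm c]
end
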